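/- (Rigidity of finite-time blowup at the soliton mass) Let m ≥ 1 be an integer and let u be a classical m-equivariant solution of CSS on I = (−1,0) such that ‖u(t,·)‖_{L²}² = 8π(m+1) for all t ∈ (−1,0) and ‖∂_r u(t,·)‖_{L²} → ∞ as t ↗ 0. Then u is a pseudoconformal transformation of the soliton: there exist λ > 0 and γ ∈ ℝ such that u(t,r) = (e^{iγ}/(λ|t|))·Q(r/(λ|t|))·e^{i·r²/(4t)} for all (t,r) ∈ (−1,0)×(0,∞). -/

import Mathlib

open MeasureTheory Set Filter

noncomputable section

/-- The Jackiw–Pi vortex `Q(r) = √8 (m+1) r^m / (1 + r^(2m+2))`. -/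
def Q (m : ℕ) (r : ℝ) : ℝ :=
  Real.sqrt 8 * (m + 1) * r ^ m / (1 + r ^ (2 * m + 2))

/-- `A_θ[u](r) = -(1/2) ∫₀^r |u(r')|² r' dr'`. -/
def Atheta (u : ℝ → ℂ) (r : ℝ) : ℝ :=
  -(1 / 2) * ∫ s in (0:ℝ)..r, ‖u s‖ ^ 2 * s

/-- Bilinear version `A_θ[f,g](r) = -(1/2) ∫₀^r Re(conj f g) r' dr'`. -/
def Atheta2 (f g : ℝ → ℂ) (r : ℝ) : ℝ :=
  -(1 / 2) * ∫ s in (0:ℝ)..r, ((starRingEnd ℂ) (f s) * g s).re * s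

/-- `A_t[u](r) = -∫_r^∞ (m + A_θ[u](r')) |u(r')|² / r' dr'`. -/
def At (m : ℕ) (u : ℝ → ℂ) (r : ℝ) : ℝ :=
  -∫ s in Set.Ioi r, ((m : ℝ) + Atheta u s) * ‖u s‖ ^ 2 / s

/-- Squared (2D radial) `L²` norm: `‖u‖² = 2π ∫₀^∞ |u(r)|² r dr`. -/
def L2sq (u : ℝ → ℂ) : ℝ :=
  2 * Real.pi * ∫ r in Set.Ioi (0:ℝ), ‖u r‖ ^ 2 * r

/-- Squared equivariant `Ḣ¹_m` norm. -/
def H1msq (m : ℕ) (u : ℝ → ℂ) : ℝ :=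
  2 * Real.pi * ∫ r in Set.Ioi (0:ℝ), (‖deriv u r‖ ^ 2 + (m : ℝ) ^ 2 * ‖u r‖ ^ 2 / r ^ 2) * r

/-- The energy functional. -/
def Energy (m : ℕ) (u : ℝ → ℂ) : ℝ :=
  2 * Real.pi * ∫ r in Set.Ioi (0:ℝ),
    ((1 / 2) * ‖deriv u r‖ ^ 2
      + (1 / 2) * (((m : ℝ) + Atheta u r) / r) ^ 2 * ‖u r‖ ^ 2
      - (1 / 4) * ‖u r‖ ^ 4) * r

/-- The Chern–Simons–Schrödinger equation at the point `(t, r)`: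
`i ∂_t u - A_t[u] u + ∂_r² u + (1/r) ∂_r u - ((m + A_θ[u])/r)² u + |u|² u = 0`. -/
def CSSeq (m : ℕ) (u : ℝ → ℝ → ℂ) (t r : ℝ) : Prop :=
  Complex.I * deriv (fun s => u s r) t
    - (At m (u t) r : ℂ) * u t r
    + deriv (deriv (u t)) r
    + (1 / (r : ℂ)) * deriv (u t) r
    - ((((m : ℝ) + Atheta (u t) r) / r : ℝ) : ℂ) ^ 2 * u t r
    + ((‖u t r‖ : ℝ) : ℂ) ^ 2 * u t r = 0

/-- A classical `m`-equivariant solution of CSS on the open interval `I`. -/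
structure IsCSS (m : ℕ) (I : Set ℝ) (u : ℝ → ℝ → ℂ) : Prop where
  smooth : ContDiffOn ℝ (⊤ : ℕ∞) (fun p : ℝ × ℝ => u p.1 p.2) (I ×ˢ Set.Ioi (0:ℝ))
  integrable : ∀ t ∈ I, IntegrableOn (fun r => ‖u t r‖ ^ 2 * r) (Set.Ioi (0:ℝ))
  equivariant : ∃ U : ℝ → ℝ × ℝ → ℂ,
    ContDiffOn ℝ (⊤ : ℕ∞) (fun p : ℝ × (ℝ × ℝ) => U p.1 p.2) (I ×ˢ (Set.univ : Set (ℝ × ℝ))) ∧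
    ∀ t ∈ I, ∀ x : ℝ × ℝ, x ≠ 0 →
      U t x = u t (Real.sqrt (x.1 ^ 2 + x.2 ^ 2)) *
        (((x.1 : ℂ) + (x.2 : ℂ) * Complex.I) / ((Real.sqrt (x.1 ^ 2 + x.2 ^ 2) : ℝ) : ℂ)) ^ m
  bounded : ∀ J : Set ℝ, J ⊆ I → IsCompact J → ∃ C : ℝ, ∀ t ∈ J,
    Real.sqrt (L2sq (u t)) + Real.sqrt (H1msq m (u t)) ≤ C
  eq : ∀ t ∈ I, ∀ r : ℝ, 0 < r → CSSeq m u t r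

/-- Tightness: uniformly small mass near spatial infinity. -/
def Tight (I : Set ℝ) (u : ℝ → ℝ → ℂ) : Prop :=
  ∀ η : ℝ, 0 < η → ∃ R : ℝ, ∀ t ∈ I,
    2 * Real.pi * ∫ r in Set.Ioi R, ‖u t r‖ ^ 2 * r < η

/-- The real inner product `(f,g)_r = Re (2π ∫₀^∞ f conj(g) r dr)`. -/
def iprod (f g : ℝ → ℂ) : ℝ :=
  2 * Real.pi * (∫ r in Set.Ioi (0:ℝ), f r * (starRingEnd ℂ) (g r) * (r : ℂ)).re

/-- `ΛQ = r Q' + Q`. -/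
def LamQ (m : ℕ) (r : ℝ) : ℝ := r * deriv (Q m) r + Q m r

/-- The linearized Bogomol'nyi operator `L_Q`. -/
def LQ (m : ℕ) (f : ℝ → ℂ) (r : ℝ) : ℂ :=
  deriv f r - ((((m : ℝ) + Atheta (fun s => (Q m s : ℂ)) r) / r : ℝ) : ℂ) * f r
    - ((2 * Atheta2 (fun s => (Q m s : ℂ)) f r / r : ℝ) : ℂ) * (Q m r : ℂ)

end

open scoped Topology
open Real
noncomputable section
set_option hygiene false
notation "Rl" => ℝ
notation "xp" => Real.exp (2 * x)
notation "en" => Real.exp (-(2 * x))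
notation "mo" => (m + 1)
notation "rdd" => rr (d.f t) (d.g t)
notation "rs" => rr (s.f t) (s.g t)
notation "mx" => (m - Mm (rr f g) x)
notation "rfa" => rr fe gb
notation "rfb" => rr ff gc
notation "rfg" => rr f g
notation "dds" => dl (d.f t) (d.g t) (s.f t) (s.g t)
notation "dda" => dl fe gb ff gc
notation "Dda" => di fe gb ff gc
notation "fd" => d.f t x
notation "gd" => d.g t x
notation "fsx" => s.f t x
notation "gsx" => s.g t x
notation "xq" => (x - a - Real.log (-t))
notation "drx" => d.r t x
notation "RR" => ℝ → ℝ
notation "Cm" => (C + 2 * mo)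
notation "ng" => (-(n : ℝ))
notation "PH" => ProfH m C f g f' g'
notation "PMC" => Prof m C
notation "fgx" => (f x * f' x + g x * g' x)
notation "ruv" => rr (uF u t) (uG u t)
notation "rsg" => rr (sF m a γ t) (sG m a γ t)
notation "sEa" => (1 + sE m a t x ^ 2)
notation "mdx" => (m - d.M t x)
notation "fdx" => d.fx t x
notation "gdx" => d.gx t x
notation "fgp" => (f' x ^ 2 + g' x ^ 2)
notation "fpq" => ((f - p) ^ 2 + (g - q) ^ 2)
notation "pq" => (p ^ 2 + q ^ 2)
notation "xna" => (1 - (x / n) ^ 2)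
notation "yna" => (1 - (y / n) ^ 2)
notation "hlf" => (1 / 2)
notation "dem" => d.e m t
notation "Ci" => Complex.I
notation "pie" => Real.pi
notation "PHd" => ProfH m C (d.f t) (d.g t) (d.fx t) (d.gx t)
notation "Irl" => Ioo lo hi
notation "RxR" => ℝ × ℝ
notation "Vx" => (2 * m * Mm r x - Mm r x ^ 2)
notation "Vs" => (2 * m * Mm r s - Mm r s ^ 2)
notation "esn" => Real.exp (-(2 * s))
notation "aln" => by rw [abs_le]; constructor <;> nlinarith
notation "abl" => by rw [abs_le]; constructor <;> linarith
notation "jcf" => by unfold JC at *; fun_prop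
notation "hta" => by linarith [ht.1]
notation "htb" => by linarith [ht.2]
notation "cnn" => by linarith [(Nat.cast_nonneg n : (0:ℝ) ≤ n)]
notation "li" => by linarith
notation "fp" => by fun_prop
notation "po" => by positivity
notation "nu" => by norm_num
notation "Jx" b:60 => ∫ x in (-(n : ℝ))..n, b
alias mlr := mul_le_mul_of_nonneg_right
alias mll := mul_le_mul_of_nonneg_left
alias evf := Eventually.of_forall
alias abn := abs_of_nonneg
alias sqn := sq_nonneg
alias mnn := mul_nonneg
alias icm := intervalIntegral.integral_const_mul
alias ntcm := integral_const_mul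
alias ftc := intervalIntegral.integral_eq_sub_of_hasDerivAt
alias iol := intervalIntegral.integral_of_le
alias sli := setIntegral_le_integral
alias iad := intervalIntegral.integral_add
alias inl := intervalIntegral.norm_integral_le_of_norm_le
alias isb := intervalIntegral.integral_sub
alias imo := intervalIntegral.integral_mono_on
alias xpp := Real.exp_pos
alias xad := Real.exp_add
alias xnm := Real.exp_nat_mul
alias abp := abs_of_pos
alias tcn := tendsto_const_div_atTop_nhds_zero_nat
alias ucc := uIoc_subset_uIcc
alias nwn := nhdsWithin_le_nhds
alias abnn := abs_nonneg
alias hid := hasDerivAt_id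
alias cic := continuous_iff_continuousAt
alias amz := abs_mul
alias alz := abs_le
alias lasz := le_abs_self
alias ncnz := Nat.cast_nonneg
alias mlmz := mul_le_mul
alias inz := integral_nonneg
alias lrz := le_rfl
alias ploz := pow_le_one₀
alias miz := measurableSet_Iic
alias miq := measurableSet_Ioi
alias miw := measurableSet_Ioc
alias mzz := mul_zero
alias maz := mul_assoc
alias ailz := abs_integral_le_integral_abs
alias icz := intervalIntegrable_const
alias tnaz := tendsto_neg_atTop_atBot
alias rtez := Real.tendsto_exp_atBot
alias egaz := eventually_ge_atTop
alias relz := Real.exp_le_exp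
alias rnez := Real.norm_eq_abs
alias loez := le_of_eq
alias plpz := pow_le_pow_left₀
alias aloz := abs_le_of_sq_le_sq
alias tiz := tendsto_id
alias ltz := le_trans
alias gmnz := gt_mem_nhds
alias dlsz := div_le_self
alias aoaz := ae_of_all
alias iaz := integral_add
alias imz := integral_mono
alias smoz := setIntegral_mono_on
alias mloz := mul_le_of_le_one_left
alias icoz := is_const_of_deriv_eq_zero
alias tnuz := tendsto_nhds_unique
alias imlz := inv_mul_le_iff₀
alias iiaz := intervalIntegral.integral_add_adjacent_intervals
alias craz := Complex.re_add_im
alias mohz := monotone_of_hasDerivAt_nonneg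
alias taaz := tendsto_atBot_add_const_right
alias iinz := intervalIntegral.integral_nonneg
alias mloq := mul_le_one₀
alias aalz := abs_add_le
alias paaz := Pi.add_apply
alias tnaq := tendsto_natCast_atTop_atTop
alias slsz := sq_le_sq'
alias ciz := Continuous.intervalIntegrable
alias oiz := ordConnected_Ioo
alias iohz := integral_of_hasDerivAt_of_tendsto
alias lotz := le_of_tendsto_of_tendsto
alias hpz := half_pos
alias muz := mem_univ

lemma daz {a b c d : Rl} (G : Rl -> RR)
    (hG : ContinuousOn (fun p : RxR => G p.1 p.2) (Ioo a b ×ˢ univ)) {t : Rl}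
    (ht : t ∈ Ioo a b) : ∃ K, ∃ s ∈ 𝓝 t, s ⊆ Ioo a b ∧ ∀ y ∈ s, ∀ x ∈ uIcc c d, ‖G y x‖ <= K := by
  obtain ⟨e, he, hs⟩ := Metric.isOpen_iff.1 (isOpen_Ioo (a := a) (b := b)) t ht
  have hsub : Metric.closedBall t (e/2) ⊆ Ioo a b := (Metric.closedBall_subset_ball li).trans hs
  have hc : IsCompact (Metric.closedBall t (e/2) ×ˢ uIcc c d) := (isCompact_closedBall _ _).prod isCompact_uIcc
  obtain ⟨K, hK⟩ := hc.exists_bound_of_continuousOn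
    (hG.mono (prod_mono hsub (subset_univ _)))
  exact ⟨K, _, Metric.closedBall_mem_nhds _ li, hsub, fun y hy x hx => hK (y, x) ⟨hy, hx⟩⟩
lemma cts {a b : Rl} {E : Type*} [TopologicalSpace E] (G : Rl -> Rl -> E)
    (hG : ContinuousOn (fun p : RxR => G p.1 p.2) (Ioo a b ×ˢ univ)) {t : Rl}
    (ht : t ∈ Ioo a b) : Continuous (G t) := by
  have : Continuous (fun x : Rl => (t, x)) := fp
  exact hG.comp_continuous this (fun x => ⟨ht, muz _⟩)
lemma dui {a b c d : Rl} (G Gt : Rl -> RR)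
    (hG : ContinuousOn (fun p : RxR => G p.1 p.2) (Ioo a b ×ˢ univ))
    (hGt : ContinuousOn (fun p : RxR => Gt p.1 p.2) (Ioo a b ×ˢ univ))
    (hd : ∀ t ∈ Ioo a b, forall x, HasDerivAt (fun s => G s x) (Gt t x) t) {t} (ht : t ∈ Ioo a b) :
    HasDerivAt (fun s => ∫ x in c..d, G s x) (∫ x in c..d, Gt t x) t := by
  obtain ⟨K, s, hs, hsub, hK⟩ := daz (c := c) (d := d) Gt hGt ht
  refine (intervalIntegral.hasDerivAt_integral_of_dominated_loc_of_deriv_le (bound := fun _ => K)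
    (s := s) hs ?_ ?_ ?_ ?_ ?_ ?_).2
  · filter_upwards [hs] with y hy
    exact (cts G hG (hsub hy)).aestronglyMeasurable
  · exact (cts G hG ht).intervalIntegrable _ _
  · exact (cts Gt hGt ht).aestronglyMeasurable
  · exact evf fun x hx y hy => hK y hy x (ucc hx)
  · exact icz
  · exact evf fun x hx y hy => hd y (hsub hy) x
lemma cpq {a b c d : Rl} (G : Rl -> RR)
    (hG : ContinuousOn (fun p : RxR => G p.1 p.2) (Ioo a b ×ˢ univ)) :
    ContinuousOn (fun s => ∫ x in c..d, G s x) (Ioo a b) := by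
  intro t ht
  obtain ⟨K, s, hs, hsub, hK⟩ := daz (c := c) (d := d) G hG ht
  refine ContinuousAt.continuousWithinAt ?_
  refine intervalIntegral.continuousAt_of_dominated_interval (bound := fun _ => K) ?_ ?_ ?_ ?_
  · filter_upwards [hs] with y hy
    exact (cts G hG (hsub hy)).aestronglyMeasurable
  · filter_upwards [hs] with y hy
    exact evf fun x hx => hK y hy x (ucc hx)
  · exact icz
  · refine evf fun x hx => ?_
    have hv : ContinuousAt (fun p : RxR => G p.1 p.2) (t, x) := hG.continuousAt ((isOpen_Ioo.prod isOpen_univ).mem_nhds ⟨ht, muz _⟩)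
    exact ContinuousAt.comp (f := fun s : Rl => (s, x)) (g := fun p : RxR => G p.1 p.2) hv
      fp
lemma flz {a b tb tc : Rl} (hv : tb ∈ Ioo a b) (bu : tc ∈ Ioo a b) (f g : ℕ -> RR)
    (F Gl : RR) (K : Rl) (na : ℕ)
    (hd : ∀ n ≥ na, ∀ t ∈ Ioo a b, HasDerivAt (f n) (g n t) t)
    (hc : ∀ n ≥ na, ContinuousOn (g n) (Ioo a b))
    (hF : ∀ t ∈ Ioo a b, Tendsto (fun n => f n t) atTop (𝓝 (F t)))
    (hG : ∀ t ∈ uIcc tb tc, Tendsto (fun n => g n t) atTop (𝓝 (Gl t)))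
    (hK : ∀ n ≥ na, ∀ t ∈ uIcc tb tc, |g n t| <= K) :
    F tc - F tb = ∫ t in tb..tc, Gl t ∧ IntervalIntegrable Gl volume tb tc := by
  have hsub : uIcc tb tc ⊆ Ioo a b := (oiz.uIcc_subset hv bu)
  have ei : ∀ n ≥ na, ∫ t in tb..tc, g n t = f n tc - f n tb := by
    intro n hn
    exact ftc (fun t ht => hd n hn t (hsub ht))
      (((hc n hn).mono hsub).intervalIntegrable)
  have ld : Tendsto (fun n => ∫ t in tb..tc, g n t) atTop (𝓝 (∫ t in tb..tc, Gl t)) := by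
    refine intervalIntegral.tendsto_integral_filter_of_dominated_convergence (fun _ => K) ?_ ?_ ?_ ?_
    · filter_upwards [egaz na] with n hn
      exact (((hc n hn).mono hsub).mono ucc).aestronglyMeasurable measurableSet_uIoc
    · filter_upwards [egaz na] with n hn
      exact evf fun t ht => hK n hn t (ucc ht)
    · exact icz
    · exact evf fun t ht => hG t (ucc ht)
  have lf : Tendsto (fun n => f n tc - f n tb) atTop (𝓝 (F tc - F tb)) := (hF tc bu).sub (hF tb hv)
  refine ⟨tnuz lf (ld.congr' ?_), ?_⟩
  · filter_upwards [egaz na] with n hn using ei n hn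
  · have hms : AEStronglyMeasurable Gl (volume.restrict (uIoc tb tc)) := by
      refine aestronglyMeasurable_of_tendsto_ae atTop (f := fun n => g (n + na)) (fun n => ?_) ?_
      · exact (((hc _ (by omega)).mono hsub).mono ucc).aestronglyMeasurable
          measurableSet_uIoc
      · refine (ae_restrict_iff' measurableSet_uIoc).2 (evf fun t ht => ?_)
        exact (hG t (ucc ht)).comp (tendsto_add_atTop_nat na)
    refine (icz (c := K)).mono_fun hms ?_
    refine (ae_restrict_iff' measurableSet_uIoc).2 (evf fun t ht => ?_)
    refine (le_of_tendsto (hG t (ucc ht)).abs ?_).trans (lasz K)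
    filter_upwards [egaz na] with n hn using hK n hn t (ucc ht)
def chi (n : ℕ) (x : Rl) : Rl := xna ^ 4
def aq (n : ℕ) (x : Rl) : Rl := -8 * (x / n) / n * xna ^ 3
lemma cct (n : ℕ) : Continuous (chi n) := by unfold chi; fun_prop
lemma ccz (n : ℕ) : Continuous (aq n) := by unfold aq; fun_prop
lemma cdw (n : ℕ) x : HasDerivAt (chi n) (aq n x) x := by
  unfold chi aq
  have h : HasDerivAt (fun x : Rl => xna) (-(2 * (x / n) * (1 / n))) x := by
    have := ((hid x).div_const (n : Rl)).pow 2
    simpa using this.const_sub 1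
  refine (h.pow 4).congr_deriv ?_
  push_cast
  ring
lemma ceq (n : ℕ) (hn : 1 <= n) : chi n n = 0 ∧ chi n (-n) = 0 := by
  have : (n : Rl) ≠ 0 := po
  simp [chi, this, neg_div]
lemma dsl {n : ℕ} (hn : 1 <= n) {x : Rl} (hx : |x| <= n) : |x / n| <= 1 ∧ (x / n)^2 <= 1 := by
  have : (0 : Rl) < n := po
  have h : |x / n| <= 1 := by rw [abs_div, abp this]; exact (div_le_one this).2 hx
  exact ⟨h, by rw [<- sq_abs]; nlinarith [abnn (x / n)]⟩
lemma cbd {n : ℕ} (hn : 1 <= n) {x : Rl} (hx : |x| <= n) : 0 <= chi n x ∧ chi n x <= 1 := by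
  obtain ⟨_, h⟩ := dsl hn hx
  unfold chi
  exact ⟨po, ploz li (by nlinarith [sqn (x / n)])⟩
lemma cbz {n : ℕ} (hn : 1 <= n) {x : Rl} (hx : |x| <= n) : |aq n x| <= 8 / n := by
  obtain ⟨hv, h⟩ := dsl hn hx
  have hn' : (0 : Rl) < n := po
  unfold aq
  have bx : |(1 - (x / n)^2)^3| <= 1 := by
    rw [abn (pow_nonneg li 3)]
    exact ploz li (by nlinarith [sqn (x / n)])
  have : |-8 * (x / n) / n| <= 8 / n := by
    rw [abs_div, amz, abp hn']
    gcongr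
    norm_num; linarith
  rw [amz]
  calc _ <= 8 / (n : Rl) * 1 := by gcongr
    _ = _ := by ring
lemma cte x : Tendsto (fun n : ℕ => chi n x) atTop (𝓝 1) := by
  have h : Tendsto (fun n : ℕ => x / (n : Rl)) atTop (𝓝 0) := tcn x
  have := ((h.pow 2).const_sub 1).pow 4
  simpa [chi] using this
lemma ctz x : Tendsto (fun n : ℕ => aq n x) atTop (𝓝 0) := by
  have h : Tendsto (fun n : ℕ => x / (n : Rl)) atTop (𝓝 0) := tcn x
  have bu : Tendsto (fun n : ℕ => (-8 * (x / n)) / (n : Rl)) atTop (𝓝 0) := by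
    have := (h.const_mul (-8)).mul (tendsto_one_div_atTop_nhds_zero_nat (𝕜 := Rl))
    simp only [mzz] at this
    refine this.congr fun n => by ring
  have := bu.mul (((h.pow 2).const_sub 1).pow 3)
  simpa [aq] using this
lemma ctk (f fl : RR) (hf : Integrable f) (g : ℕ -> RR)
    (hg : forall n, Continuous (g n)) (hb : ∀ n : ℕ, n ≥ 1 -> forall x, |x| <= (n : Rl) -> |g n x| <= f x)
    (hl : forall x, Tendsto (fun n : ℕ => g n x) atTop (𝓝 (fl x))) :
    Tendsto (fun n : ℕ => Jx g n x) atTop (𝓝 (∫ x, fl x)) := by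
  have e : ∀ n : ℕ, Jx g n x = ∫ x, (Ioc ng n).indicator (g n) x := by
    intro n
    rw [iol (by linarith [(ncnz n : (0 : Rl) <= n)]), integral_indicator miw]
  simp_rw [e]
  refine tendsto_integral_filter_of_dominated_convergence (fun x => |f x|) ?_ ?_ hf.abs ?_
  · exact evf fun n => ((hg n).aestronglyMeasurable.indicator miw)
  · filter_upwards [egaz 1] with n hn
    refine evf fun x => ?_
    by_cases hx : x ∈ Ioc ng n
    · rw [indicator_of_mem hx]
      exact (hb n hn x (alz.2 ⟨hx.1.le, hx.2⟩)).trans (lasz _)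
    · rw [indicator_of_notMem hx]; simp
  · refine evf fun x => ?_
    refine (hl x).congr' ?_
    obtain ⟨N, hN⟩ := exists_nat_gt |x|
    filter_upwards [egaz N] with n hn
    have : |x| < n := hN.trans_le (by exact_mod_cast hn)
    rw [indicator_of_mem]
    exact ⟨(abs_lt.1 this).1, (abs_lt.1 this).2.le⟩
lemma iea : Integrable (fun x : Rl => exp (-|x|)) := by
  have hv : IntegrableOn (fun x : Rl => exp (-|x|)) (Iic 0) := by
    refine (integrableOn_exp_Iic 0).congr_fun (fun x hx => ?_) miz
    simp [abs_of_nonpos (mem_Iic.1 hx)]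
  have bu : IntegrableOn (fun x : Rl => exp (-|x|)) (Ioi 0) := by
    refine (integrableOn_exp_neg_Ioi 0).congr_fun (fun x hx => ?_) miq
    simp [abp (mem_Ioi.1 hx)]
  have := hv.union bu
  rwa [Iic_union_Ioi, integrableOn_univ] at this
lemma itzz (F F' : RR) (h : forall x, HasDerivAt F (F' x) x) (hi : Integrable F')
    (hb : Tendsto F atBot (𝓝 0)) (ht : Tendsto F atTop (𝓝 0)) : ∫ x, F' x = 0 := by
  have := iohz h hi hb ht
  simpa using this
def HI (f : RR) (c : Rl) : Prop := Integrable f ∧ ∫ x, f x = c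
lemma hio {f : RR} (h : Integrable f) : HI f (∫ x, f x) := ⟨h, rfl⟩
lemma HI.add {f g : RR} {a b : Rl} (h : HI f a) (k : HI g b) : HI (fun x => f x + g x) (a + b) :=
  ⟨h.1.add k.1, by rw [iaz h.1 k.1, h.2, k.2]⟩
lemma HI.sub {f g : RR} {a b : Rl} (h : HI f a) (k : HI g b) : HI (fun x => f x - g x) (a - b) :=
  ⟨h.1.sub k.1, by rw [integral_sub h.1 k.1, h.2, k.2]⟩
lemma HI.mul {f : RR} {a : Rl} (c : Rl) (h : HI f a) : HI (fun x => c * f x) (c * a) :=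
  ⟨h.1.const_mul c, by rw [ntcm, h.2]⟩
lemma HI.congr {f g : RR} {a : Rl} (h : HI f a) (e : forall x, g x = f x) : HI g a := by
  have : g = f := funext e
  rwa [this]
lemma HI.eq {f g : RR} {a b : Rl} (h : HI f a) (k : HI g b) (e : forall x, f x = g x) : a = b := by
  have : f = g := funext e
  rw [<- h.2, <- k.2, this]
lemma HI.le {f g : RR} {a b : Rl} (h : HI f a) (k : HI g b) (e : forall x, f x <= g x) : a <= b := by
  rw [<- h.2, <- k.2]
  exact imz h.1 k.1 e
lemma HI.int {f : RR} {a : Rl} (h : HI f a) : Integrable f := h.1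
lemma HI.abs_le {f g : RR} {a b : Rl} (h : HI f a) (k : HI g b) (e : forall x, |f x| <= g x) :
    |a| <= b := by
  rw [<- h.2, <- k.2]
  exact ailz.trans (imz h.1.abs k.1 e)

def Mm (r : RR) (x : Rl) : Rl := hlf * ∫ s in Iic x, r s * exp (2 * s)
def Zz (m : Rl) (r : RR) (x : Rl) : Rl := ∫ s in Ioi x, Vs * esn
def Vv (m : Rl) (r : RR) (x : Rl) : Rl := -r x - 2 * Zz m r x
def ed : Rl := ∫ x : Rl, exp (-|x|)
structure Prof (m C : Rl) (r : RR) : Prop where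
  hm : 1 <= m
  hC : 0 <= C
  cont : Continuous r
  nn : forall x, 0 <= r x
  int : Integrable (fun x => r x * xp)
  mass : ∫ x, r x * xp = 4 * mo
  near : forall x, x <= 0 -> r x <= C * xp
lemma ezn : 0 <= ed := inz fun x => (xpp _).le
lemma slq {f g : RR} (s : Set Rl) (hf : Integrable f) (hg : Integrable g)
    (h : forall x, f x <= g x) (gg : forall x, 0 <= g x) : ∫ x in s, f x <= ∫ x, g x := by
  calc ∫ x in s, f x <= ∫ x in s, g x := imz hf.integrableOn hg.integrableOn h
    _ <= ∫ x, g x := sli hg (evf gg)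
lemma ihz {f : RR} (hf : Integrable f) (hc : Continuous f) x :
    HasDerivAt (fun y => ∫ s in Iic y, f s) (f x) x := by
  have e : (fun y => ∫ s in Iic y, f s) = fun y => (∫ s in Iic 0, f s) + ∫ s in (0:Rl)..y, f s := by
    funext y
    rw [<- intervalIntegral.integral_Iic_sub_Iic hf.integrableOn hf.integrableOn]; ring
  rw [e]
  exact (intervalIntegral.integral_hasDerivAt_right (hc.intervalIntegrable _ _)
    (hc.stronglyMeasurableAtFilter _ _) hc.continuousAt).const_add _
lemma ihq {f : RR} (hf : Integrable f) (hc : Continuous f) x :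
    HasDerivAt (fun y => ∫ s in Ioi y, f s) (-f x) x := by
  have e : (fun y => ∫ s in Ioi y, f s) = fun y => (∫ s, f s) - ∫ s in Iic y, f s := by
    funext y
    have := integral_add_compl (s := Iic y) miz hf
    rw [compl_Iic] at this
    linarith
  rw [e]
  exact (ihz hf hc x).const_sub _
lemma fbz {f : RR} (hf : Integrable f) : Tendsto (fun y => ∫ s in Iic y, f s) atBot (𝓝 0) := by
  have e : (fun y => ∫ s in Iic y, f s) = fun y => (∫ s, f s) - ∫ s in Ioi y, f s := by
    funext y
    have := integral_add_compl (s := Iic y) miz hf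
    rw [compl_Iic] at this
    linarith
  rw [e]
  have h : Tendsto (fun y : Rl => ∫ s in Ioi y, f s) atBot (𝓝 (∫ s, f s)) := by
    exact (aecover_Ioi tiz).integral_tendsto_of_countably_generated hf
  simpa using h.const_sub (∫ s, f s)
lemma ftz {f : RR} (hf : Integrable f) :
    Tendsto (fun y => ∫ s in Iic y, f s) atTop (𝓝 (∫ s, f s)) := (aecover_Iic tiz).integral_tendsto_of_countably_generated hf
lemma ftq {f : RR} (hf : Integrable f) :
    Tendsto (fun y => ∫ s in Ioi y, f s) atTop (𝓝 0) := by
  have e : (fun y => ∫ s in Ioi y, f s) = fun y => (∫ s, f s) - ∫ s in Iic y, f s := by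
    funext y
    have := integral_add_compl (s := Iic y) miz hf
    rw [compl_Iic] at this
    linarith
  rw [e]
  simpa using (ftz hf).const_sub (∫ s, f s)
lemma iob {f g : RR} (hg : Integrable g) (hf : Continuous f) (h : forall x, |f x| <= g x) :
    Integrable f := hg.mono' hf.aestronglyMeasurable (evf h)
namespace Prof
variable {m C : Rl} {r : RR}
lemma qcont (h : PMC r) : Continuous (fun x => r x * xp) := by
  have := h.cont; fun_prop
lemma qnn (h : PMC r) x : 0 <= r x * xp := mnn (h.nn x) (xpp _).le
lemma M_deriv (h : PMC r) x :
    HasDerivAt (Mm r) (hlf * (r x * xp)) x := (ihz h.int h.qcont x).const_mul _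
lemma M_cont (h : PMC r) : Continuous (Mm r) := cic.2 fun x => (h.M_deriv x).continuousAt
lemma M_nn (h : PMC r) x : 0 <= Mm r x := mnn nu (setIntegral_nonneg miz fun y _ => h.qnn y)
lemma M_le (h : PMC r) x : Mm r x <= 2 * mo := by
  have := slq (Iic x) h.int h.int (fun _ => lrz) h.qnn
  rw [h.mass] at this
  unfold Mm; linarith
lemma M_bot (h : PMC r) : Tendsto (Mm r) atBot (𝓝 0) := by
  have := (fbz h.int).const_mul hlf
  rwa [mzz] at this
lemma M_top (h : PMC r) : Tendsto (Mm r) atTop (𝓝 (2 * mo)) := by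
  have := (ftz h.int).const_mul hlf
  rw [h.mass] at this
  unfold Mm
  convert this using 2; ring
lemma M_near (h : PMC r) {x : Rl} (hx : x <= 0) : Mm r x <= C * exp (4 * x) := by
  have ig : IntegrableOn (fun s : Rl => C * exp (4 * s)) (Iic x) := (integrableOn_exp_mul_Iic nu x).const_mul C
  have hv : ∫ s in Iic x, r s * exp (2 * s) <= ∫ s in Iic x, C * exp (4 * s) := by
    refine smoz h.int.integrableOn ig miz fun s hs => ?_
    have e : exp (4 * s) = exp (2 * s) * exp (2 * s) := by
      rw [<- xad]; ring_nf
    rw [e]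
    have := mlr (h.near s (ltz hs hx)) (xpp (2 * s)).le
    linarith
  rw [ntcm, integral_exp_mul_Iic nu] at hv
  have : 0 <= C * exp (4 * x) := mnn h.hC (xpp _).le
  unfold Mm; linarith
lemma M_bd (h : PMC r) x :
    Mm r x <= Cm * exp (2 * x - 2 * |x|) := by
  have hv := h.hm
  have hC := h.hC
  rcases le_total x 0 with hx | hx
  · rw [abs_of_nonpos hx]
    have e : 2 * x - 2 * -x = 4 * x := by ring
    rw [e]
    have := h.M_near hx
    nlinarith [xpp (4 * x)]
  · rw [abn hx]
    simp only [sub_self, exp_zero, mul_one]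
    linarith [h.M_le x]
lemma M_exp (h : PMC r) x :
    Mm r x * en <= Cm * exp (-(2 * |x|)) := by
  have := mlr (h.M_bd x) (xpp (-(2 * x))).le
  rwa [maz, <- xad, show 2 * x - 2 * |x| + -(2 * x) = -(2 * |x|) by ring] at this
lemma M_exp' (h : PMC r) x :
    Mm r x * en <= Cm * exp (-|x|) := by
  refine (h.M_exp x).trans ?_
  have := h.hC; have := h.hm
  gcongr
  linarith [abnn x]
lemma r_bd (h : PMC r) x :
    r x <= C * exp (-|x|) + r x * xp := by
  have hC := h.hC
  rcases le_total x 0 with hx | hx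
  · have := h.near x hx
    have bu : xp <= exp (-|x|) := by
      apply relz.2; rw [abs_of_nonpos hx]; linarith
    nlinarith [h.qnn x]
  · have : 1 <= xp := one_le_exp li
    nlinarith [h.nn x, mnn hC (xpp (-|x|)).le]
lemma r_int (h : PMC r) : Integrable r := iob ((iea.const_mul C).add h.int) h.cont
    (fun x => by rw [abn (h.nn x)]; exact h.r_bd x)
lemma r_tot (h : PMC r) : ∫ x, r x <= C * ed + 4 * mo := by
  have := imz h.r_int ((iea.const_mul C).add h.int) h.r_bd
  simp only [paaz] at this
  rwa [iaz (iea.const_mul C) h.int, ntcm, h.mass] at this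
lemma B_abs (h : PMC r) x : |2 * m * Mm r x - Mm r x ^ 2| <= 2 * mo * Mm r x := by
  have hv := h.M_nn x
  have bu := h.M_le x
  have := h.hm
  rw [alz]; constructor <;> nlinarith
lemma Bi_bd (h : PMC r) x :
    |Vx * en| <=
      2 * mo * Cm * exp (-|x|) := by
  rw [amz, abp (xpp _)]
  have := h.hm
  calc _ <= 2 * mo * Mm r x * en := by
        gcongr; exact h.B_abs x
    _ = 2 * mo * (Mm r x * en) := by ring
    _ <= 2 * mo * (Cm * exp (-|x|)) := by
        exact mll (h.M_exp' x) li
    _ = _ := by ring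
lemma Bi_cont (h : PMC r) :
    Continuous (fun x => Vx * en) := by
  have := h.M_cont; fun_prop
lemma Bi_int (h : PMC r) :
    Integrable (fun x => Vx * en) := iob (iea.const_mul _) h.Bi_cont h.Bi_bd
lemma Z_deriv (h : PMC r) x :
    HasDerivAt (Zz m r) (-(Vx * en)) x := ihq h.Bi_int h.Bi_cont x
lemma Z_cont (h : PMC r) : Continuous (Zz m r) := cic.2 fun x => (h.Z_deriv x).continuousAt
lemma Z_top (h : PMC r) : Tendsto (Zz m r) atTop (𝓝 0) := ftq h.Bi_int
lemma Z_abs (h : PMC r) x : |Zz m r x| <= 2 * mo * Cm * ed := by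
  have hj : |Zz m r x| <= ∫ s in Ioi x, |Vs * esn| := ailz
  have hm := h.hm; have hC := h.hC
  have := slq (Ioi x) h.Bi_int.abs
    (iea.const_mul (2 * mo * Cm)) h.Bi_bd
    (fun x => po)
  rw [ntcm] at this
  exact hj.trans this
lemma Z_abs2 (h : PMC r) x : |Zz m r x| <= 2 * mo ^ 2 * en := by
  have hj : |Zz m r x| <= ∫ s in Ioi x, |Vs * esn| := ailz
  have ic : IntegrableOn (fun s : Rl => 4 * mo ^ 2 * exp (-2 * s)) (Ioi x) := (integrableOn_exp_mul_Ioi nu x).const_mul _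
  have hm := h.hm
  have : ∫ s in Ioi x, |Vs * esn| <=
      ∫ s in Ioi x, 4 * mo ^ 2 * exp (-2 * s) := by
    refine imz h.Bi_int.abs.integrableOn ic fun s => ?_
    simp only [amz, abp (xpp _)]
    rw [show -(2 * s) = -2 * s by ring]
    gcongr
    have := h.B_abs s
    nlinarith [h.M_le s]
  rw [ntcm, integral_exp_mul_Ioi nu] at this
  rw [show -(2 * x) = -2 * x by ring]
  linarith
lemma V_cont (h : PMC r) : Continuous (Vv m r) := by
  have := h.cont; have := h.Z_cont; unfold Vv; fun_prop
lemma Zq {C' : Rl} {r' : RR} (h : PMC r) (h' : Prof m C' r') :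
    Integrable (fun x => Zz m r x * (r' x * xp)) ∧
    Integrable (fun x => Vx * Mm r' x * en) ∧
    ∫ x, Zz m r x * (r' x * xp) =
      2 * ∫ x, Vx * Mm r' x * en := by
  have ib : Integrable (fun x => Zz m r x * (r' x * xp)) := by
    refine iob (h'.int.const_mul (2 * mo * Cm * ed))
      (h.Z_cont.mul h'.qcont) fun x => ?_
    rw [amz, abn (h'.qnn x)]
    exact mlr (h.Z_abs x) (h'.qnn x)
  have ic : Integrable (fun x => Vx * Mm r' x * en) := by
    refine iob ((h.Bi_int.abs).const_mul (2 * mo)) ?_ fun x => ?_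
    · have := h.M_cont; have := h'.M_cont; fun_prop
    · rw [mul_right_comm, amz _ (Mm r' x), abn (h'.M_nn x), mul_comm]
      exact mlr (h'.M_le x) (abnn _)
  refine ⟨ib, ic, ?_⟩
  have hd : forall x, HasDerivAt (fun x => 2 * (Zz m r x * Mm r' x))
      (Zz m r x * (r' x * xp) -
        2 * (Vx * Mm r' x * en)) x := by
    intro x
    refine (((h.Z_deriv x).mul (h'.M_deriv x)).const_mul 2).congr_deriv ?_
    ring
  have z := itzz _ _ hd (ib.sub (ic.const_mul 2)) ?_ ?_
  · rw [integral_sub ib (ic.const_mul 2), ntcm] at z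
    linarith
  · have : Tendsto (fun x => Zz m r x * Mm r' x) atBot (𝓝 0) := by
      refine bdd_le_mul_tendsto_zero' (2 * mo * Cm * ed)
        (evf fun x => h.Z_abs x) h'.M_bot
    simpa using this.const_mul 2
  · simpa using (h.Z_top.mul h'.M_top).const_mul 2
end Prof

lemma tzz {F F' : RR} (hd : forall x, HasDerivAt F (F' x) x) (hF : Integrable F)
    (hF' : Integrable F') : Tendsto F atBot (𝓝 0) ∧ Tendsto F atTop (𝓝 0) ∧
      (forall x, |F x| <= ∫ y, |F' y|) ∧ forall x, F x = -∫ y in Ioi x, F' y := by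
  have hv : Tendsto F atBot (𝓝 0) := tendsto_zero_of_hasDerivAt_of_integrableOn_Iic (a := 0) (fun x _ => hd x) hF'.integrableOn
      hF.integrableOn
  have bu : Tendsto F atTop (𝓝 0) := tendsto_zero_of_hasDerivAt_of_integrableOn_Ioi (a := 0) (fun x _ => hd x) hF'.integrableOn
      hF.integrableOn
  have bx : forall x, F x = -∫ y in Ioi x, F' y := by
    intro x
    have := integral_Ioi_of_hasDerivAt_of_tendsto' (a := x) (fun y _ => hd y) hF'.integrableOn bu
    rw [this]; ring
  refine ⟨hv, bu, fun x => ?_, bx⟩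
  rw [bx x, abs_neg]
  exact ailz.trans
    (sli hF'.abs (evf fun y => abnn _))
def rr (f g : RR) (x : Rl) : Rl := f x ^ 2 + g x ^ 2
structure ProfH (m C : Rl) (f g f' g' : RR) : Prop where
  prof : PMC rfg
  df : forall x, HasDerivAt f (f' x) x
  dg : forall x, HasDerivAt g (g' x) x
  cf : Continuous f'
  cg : Continuous g'
  int' : Integrable (fun x => f' x ^ 2 + g' x ^ 2)
  bd' : ∫ x, fgp <= C
def KH (m C : Rl) : Rl := C * ed + 12 * mo + C
def KW (m C : Rl) : Rl := 3 * (m ^ 4 + 16 * mo ^ 4) * (C * ed + 4 * mo) + 3 * KH m C ^ 2 * (4 * mo)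
def eF (m : Rl) (f g f' g' : RR) : Rl := ∫ x, ((f' x - mx * f x) ^ 2 + (g' x - mx * g x) ^ 2)
def AF (m : Rl) (f g f' g' : RR) : Rl := ∫ x, (fgp + (m ^ 2 + xp * Vv m rfg x) * rfg x)
def KF (m : Rl) (f g : RR) : Rl := -hlf * (∫ x, rfg x * (rfg x * xp)) - ∫ x, (4 * m * Mm rfg x ^ 2 - 8 / 3 * Mm rfg x ^ 3) * en
namespace ProfH
variable {m C : Rl} {f g f' g' : RR}
lemma am (h : PH) : Continuous f := cic.2 fun x => (h.df x).continuousAt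
lemma ao (h : PH) : Continuous g := cic.2 fun x => (h.dg x).continuousAt
lemma rd (h : PH) x :
    HasDerivAt rfg (2 * fgx) x := by
  refine (((h.df x).pow 2).add ((h.dg x).pow 2)).congr_deriv ?_
  push_cast; ring
lemma dbz (f g f' g' : RR) x : |2 * fgx| <=
    rfg x + fgp := by
  unfold rr
  rw [alz]; constructor <;>
    nlinarith [sqn (f x - f' x), sqn (g x - g' x), sqn (f x + f' x), sqn (g x + g' x)]
lemma rd_int (h : PH) : Integrable (fun x => 2 * fgx) := by
  refine iob (h.prof.r_int.add h.int') ?_ (dbz f g f' g')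
  have := h.cf; have := h.cg; have := h.am; have := h.ao
  fun_prop
lemma r_lim (h : PH) :
    Tendsto rfg atBot (𝓝 0) ∧ Tendsto rfg atTop (𝓝 0) := let t := tzz h.rd h.prof.r_int h.rd_int
  ⟨t.1, t.2.1⟩
lemma KH_nn (h : PH) : 0 <= KH m C := by
  have := h.prof.hm; have := h.prof.hC; have := ezn
  unfold KH; positivity
lemma r_sup (h : PH) x : rfg x <= KH m C := by
  have t := (tzz h.rd h.prof.r_int h.rd_int).2.2.1 x
  have bu := imz h.rd_int.abs (h.prof.r_int.add h.int') (dbz f g f' g')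
  simp only [paaz] at bu
  rw [iaz h.prof.r_int h.int'] at bu
  have := h.prof.r_tot; have := h.bd'; have := h.prof.hm
  unfold KH
  linarith [lasz (rfg x)]
lemma rex_int (h : PH) : Integrable (fun x => rfg x * exp x) := by
  refine iob (h.prof.r_int.add h.prof.int) (by have := h.prof.cont; fun_prop) fun x => ?_
  have hj := h.prof.nn x
  rw [abn (mnn hj (xpp _).le)]
  have e : xp = exp x ^ 2 := by rw [<- xnm]; norm_num
  simp only [paaz, e]
  nlinarith [mnn hj (sqn (exp x - 1)), mnn hj (xpp x).le]
lemma rex_sup (h : PH) x : rfg x * exp x <= KH m C := by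
  have hd : forall x, HasDerivAt (fun x => rfg x * exp x)
      (rfg x * exp x + 2 * fgx * exp x) x := by
    intro x
    refine ((h.rd x).mul (hasDerivAt_exp x)).congr_deriv ?_
    ring
  have bd : forall x, |rfg x * exp x + 2 * fgx * exp x| <= (rfg x + rfg x * xp) +
        (rfg x * xp + fgp) := by
    intro x
    have hj := h.prof.nn x
    have e : xp = exp x ^ 2 := by rw [<- xnm]; norm_num
    refine (aalz _ _).trans (add_le_add ?_ ?_)
    · rw [abn (mnn hj (xpp _).le), e]
      nlinarith [mnn hj (sqn (exp x - 1)), mnn hj (xpp x).le]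
    · have := dbz (fun x => f x * exp x) (fun x => g x * exp x) f' g' x
      simp only [rr] at this ⊢
      rw [e]
      refine (loez ?_).trans (this.trans (loez ?_))
      · congr 1; ring
      · ring
  have ic := (h.prof.r_int.add h.prof.int).add (h.prof.int.add h.int')
  have ib : Integrable (fun x => rfg x * exp x +
      2 * fgx * exp x) := by
    refine iob ic ?_ bd
    have := h.cf; have := h.cg; have := h.am; have := h.ao; have := h.prof.cont
    fun_prop
  have t := (tzz hd h.rex_int ib).2.2.1 x
  have bu := (hio ib.abs).le (((hio h.prof.r_int).add (hio h.prof.int)).add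
    ((hio h.prof.int).add (hio h.int'))) bd
  rw [h.prof.mass] at bu
  have := h.prof.r_tot; have := h.bd'; have := h.prof.hm
  unfold KH
  linarith [lasz (rfg x * exp x)]
lemma rq_int (h : PH) :
    Integrable (fun x => rfg x * (rfg x * xp)) := by
  refine iob (h.prof.int.const_mul (KH m C)) (h.prof.cont.mul h.prof.qcont) fun x => ?_
  rw [abn (mnn (h.prof.nn x) (h.prof.qnn x))]
  exact mlr (h.r_sup x) (h.prof.qnn x)
lemma Wr_cont (h : PH) :
    Continuous (fun x => m ^ 2 + xp * Vv m rfg x) := by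
  have := h.prof.V_cont; fun_prop
lemma Wr_bd (h : PH) x :
    (m ^ 2 + xp * Vv m rfg x) ^ 2 * rfg x <= 3 * (m ^ 4 + 16 * mo ^ 4) * rfg x +
        3 * KH m C ^ 2 * (rfg x * xp) := by
  have hj := h.prof.nn x
  have hz : |xp * Zz m rfg x| <= 2 * mo ^ 2 := by
    have := mll (h.prof.Z_abs2 x) (xpp (2 * x)).le
    rw [amz, abp (xpp _)]
    refine this.trans (loez ?_)
    rw [mul_left_comm, <- xad]; simp
  have e : xp = exp x ^ 2 := by rw [<- xnm]; norm_num
  have bx : (m ^ 2 + xp * Vv m rfg x) ^ 2 <=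
      3 * (m ^ 4 + 16 * mo ^ 4) + 3 * (rfg x * xp) ^ 2 := by
    unfold Vv
    set z := xp * Zz m rfg x with hzd
    have ej : m ^ 2 + xp * (-rfg x - 2 * Zz m rfg x) =
      m ^ 2 - rfg x * xp - 2 * z := by rw [hzd]; ring
    rw [ej]
    have gs : z ^ 2 <= 4 * mo ^ 4 := by
      have : z ^ 2 <= (2 * mo ^ 2) ^ 2 := slsz (alz.1 hz).1 (alz.1 hz).2
      linarith [this, show (2 * mo ^ 2) ^ 2 = 4 * mo ^ 4 by ring]
    set y := rfg x * xp
    nlinarith [sqn (m ^ 2 + y), sqn (m ^ 2 + 2 * z), sqn (y - 2 * z)]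
  have bz : (rfg x * xp) ^ 2 * rfg x <=
      KH m C ^ 2 * (rfg x * xp) := by
    have dy := h.rex_sup x
    have dz : (rfg x * exp x) ^ 2 <= KH m C ^ 2 := plpz (mnn hj (xpp _).le) dy 2
    calc _ = (rfg x * exp x) ^ 2 * (rfg x * xp) := by rw [e]; ring
      _ <= _ := mlr dz (h.prof.qnn x)
  have fg := mlr bx hj
  linarith
lemma Wr_int (h : PH) :
    Integrable (fun x => (m ^ 2 + xp * Vv m rfg x) ^ 2 * rfg x) := by
  refine iob ((h.prof.r_int.const_mul (3 * (m ^ 4 + 16 * mo ^ 4))).add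
    (h.prof.int.const_mul (3 * KH m C ^ 2)))
    ((h.Wr_cont.pow 2).mul h.prof.cont) fun x => ?_
  rw [abn (mnn (sqn _) (h.prof.nn x))]
  exact h.Wr_bd x
lemma Wr_tot (h : PH) :
    ∫ x, (m ^ 2 + xp * Vv m rfg x) ^ 2 * rfg x <= KW m C := by
  have ib := (h.prof.r_int.const_mul (3 * (m ^ 4 + 16 * mo ^ 4)))
  have ic := (h.prof.int.const_mul (3 * KH m C ^ 2))
  have := imz h.Wr_int (ib.add ic) h.Wr_bd
  simp only [paaz] at this
  rw [iaz ib ic, ntcm, ntcm, h.prof.mass] at this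
  refine this.trans ?_
  unfold KW
  have := h.prof.hm
  have := h.prof.r_tot
  gcongr
lemma M2_int {m C : Rl} {r : RR} (h : PMC r) (k : ℕ) (hk : 1 <= k) :
    Integrable (fun x => Mm r x ^ k * en) := by
  obtain ⟨j, rfl⟩ := Nat.exists_eq_add_of_le hk
  refine iob (iea.const_mul ((2 * mo) ^ j * Cm)) ?_ fun x => ?_
  · have := h.M_cont; fun_prop
  · have hj := h.M_nn x
    have hm := h.hm
    rw [abn (mnn (pow_nonneg hj _) (xpp _).le), pow_add, pow_one]
    calc _ = Mm r x ^ j * (Mm r x * en) := by ring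
      _ <= (2 * mo) ^ j * (Cm * exp (-|x|)) := by
        apply mlmz (plpz hj (h.M_le x) j) (h.M_exp' x)
          (mnn hj (xpp _).le) po
      _ = _ := by ring
lemma bogo (h : PH) :
    Integrable (fun x => (f' x - mx * f x) ^ 2 + (g' x - mx * g x) ^ 2) ∧
    Integrable (fun x => fgp + (m ^ 2 + xp * Vv m rfg x) * rfg x) ∧
    AF m f g f' g' - KF m f g = eF m f g f' g' := by
  set r := rfg with hr
  have hp := h.prof
  have ik := M2_int hp 2 nu
  have iu := M2_int hp 3 nu
  have ij := M2_int hp 1 nu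
  obtain ⟨iZ, iB, eZ⟩ := hp.Zq hp
  have irq := h.rq_int
  have ir := hp.r_int
  have Mc := hp.M_cont
  have cn := h.cf; have co := h.cg; have cs := h.am; have ct := h.ao; have cu := hp.cont
  have hm := hp.hm
  have iM : Integrable (fun x => (m - Mm r x) * (2 * fgx)) := by
    refine iob (h.rd_int.abs.const_mul (2 * mo)) fp fun x => ?_
    rw [amz]
    refine mlr ?_ (abnn _)
    rw [alz]; constructor <;> linarith [hp.M_nn x, hp.M_le x]
  have zb : ∫ x, (m - Mm r x) * (2 * fgx) =
      hlf * ∫ x, r x * (r x * xp) := by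
    have hd : forall x, HasDerivAt (fun x => (m - Mm r x) * r x)
        ((m - Mm r x) * (2 * fgx) -
          hlf * (r x * (r x * xp))) x := by
      intro x
      refine (((hp.M_deriv x).const_sub m).mul (h.rd x)).congr_deriv ?_
      rw [<- hr]; ring
    have z := itzz _ _ hd (iM.sub (irq.const_mul _))
      (by simpa using (hp.M_bot.const_sub m).mul h.r_lim.1)
      (by simpa using (hp.M_top.const_sub m).mul h.r_lim.2)
    rw [integral_sub iM (irq.const_mul _), ntcm] at z
    linarith
  have iBr : Integrable (fun x => Vx * r x) := by
    refine iob (ir.const_mul (4 * mo ^ 2)) fp fun x => ?_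
    rw [amz, abn (hp.nn x)]
    refine mlr ?_ (hp.nn x)
    have := hp.B_abs x
    nlinarith [hp.M_le x]
  have zd : ∫ x, Vx * r x = 4 * m * (∫ x, Mm r x ^ 2 * en) -
        4 / 3 * ∫ x, Mm r x ^ 3 * en := by
    have hd : forall x, HasDerivAt (fun x => 2 * (m * (Mm r x ^ 2 * en) - 1 / 3 * (Mm r x ^ 3 * en)))
        (Vx * r x - (4 * m * (Mm r x ^ 2 * en) -
            4 / 3 * (Mm r x ^ 3 * en))) x := by
      intro x
      have de : HasDerivAt (fun x : Rl => en) (en * (-(2 * 1))) x := (((hid x).const_mul 2).neg).exp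
      have ei : xp * en = 1 := by rw [<- xad]; simp
      have mc := hp.M_deriv x
      refine ((((mc.pow 2).mul de).const_mul m).sub
        (((mc.pow 3).mul de).const_mul (1 / 3)) |>.const_mul 2).congr_deriv ?_
      simp only [Pi.pow_apply]
      push_cast
      linear_combination Vx * r x * ei
    have l : ∀ k : ℕ, 1 <= k -> ∀ l : Filter Rl, Tendsto (fun x : Rl => exp (-|x|)) l (𝓝 0) ->
        Tendsto (fun x => Mm r x ^ k * en) l (𝓝 0) := by
      intro k hk l hl
      obtain ⟨j, rfl⟩ := Nat.exists_eq_add_of_le hk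
      have gi := hl.const_mul ((2 * mo) ^ j * Cm)
      rw [mzz] at gi
      refine squeeze_zero (fun x => mnn (pow_nonneg (hp.M_nn x) _) (xpp _).le)
        (fun x => ?_) gi
      rw [pow_add, pow_one]
      calc _ = Mm r x ^ j * (Mm r x * en) := by ring
        _ <= (2 * mo) ^ j * (Cm * exp (-|x|)) := by
          apply mlmz (plpz (hp.M_nn x) (hp.M_le x) j) (hp.M_exp' x)
            (mnn (hp.M_nn x) (xpp _).le) po
        _ = _ := by ring
    have lb : Tendsto (fun x : Rl => exp (-|x|)) atBot (𝓝 0) := rtez.comp (tnaz.comp tendsto_abs_atBot_atTop)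
    have lt : Tendsto (fun x : Rl => exp (-|x|)) atTop (𝓝 0) := rtez.comp (tnaz.comp tendsto_abs_atTop_atTop)
    have ll : ∀ l : Filter Rl, Tendsto (fun x : Rl => exp (-|x|)) l (𝓝 0) -> Tendsto (fun x => 2 * (m * (Mm r x ^ 2 * en) -
          1 / 3 * (Mm r x ^ 3 * en))) l (𝓝 0) := by
      intro l' hl
      have := (((l 2 nu l' hl).const_mul m).sub
        ((l 3 nu l' hl).const_mul (1/3))).const_mul 2
      simpa using this
    have z := itzz _ _ hd
      (iBr.sub ((ik.const_mul (4 * m)).sub (iu.const_mul (4 / 3)))) (ll _ lb) (ll _ lt)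
    have z' := ((hio iBr).sub (((hio ik).mul (4 * m)).sub ((hio iu).mul (4 / 3)))).2
    have := z.symm.trans z'
    linarith
  have eE : (fun x => (f' x - (m - Mm r x) * f x) ^ 2 + (g' x - (m - Mm r x) * g x) ^ 2) = fun x => ((fgp - (m - Mm r x) * (2 * fgx)) +
        m ^ 2 * r x) - Vx * r x := by
    funext x; simp only [hr, rr]; ring
  have iE := (((hio h.int').sub (hio iM)).add ((hio ir).mul (m ^ 2))).sub (hio iBr)
  have eA : (fun x => fgp + (m ^ 2 + xp * Vv m r x) * r x) = fun x => ((fgp + m ^ 2 * r x) - r x * (r x * xp)) -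
        2 * (Zz m r x * (r x * xp)) := by
    funext x; unfold Vv; ring
  have iA := (((hio h.int').add ((hio ir).mul (m ^ 2))).sub (hio irq)).sub ((hio iZ).mul 2)
  refine ⟨?_, ?_, ?_⟩
  · rw [eE]; exact iE.1
  · rw [eA]; exact iA.1
  · unfold AF KF eF
    have ei := (((hio ik).mul (4 * m)).sub ((hio iu).mul (8 / 3))).congr
      (g := fun x => (4 * m * Mm r x ^ 2 - 8 / 3 * Mm r x ^ 3) * en)
      (fun x => by ring)
    have ej := (((hio ik).mul (2 * m)).sub (hio iu)).eq (hio iB) (fun x => by ring)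
    rw [<- hr, eE, eA, iE.2, iA.2, ei.2, zb, zd, eZ]
    simp only [hr] at ej ⊢
    rw [<- ej]
    ring
end ProfH

lemma osz {y A B : Rl} (hy : 0 <= y) (hA : 0 <= A) (hB : 0 <= B)
    (h : ∀ κ > 0, y <= κ * A / 4 + B / κ) : y ^ 2 <= A * B := by
  have := discrim_le_zero (a := A / 4) (b := -y) (c := B) (fun κ => by
    rcases le_or_gt κ 0 with hk | hk
    · nlinarith [mnn (neg_nonneg.2 hk) hy, mul_self_nonneg κ]
    · have hv := mll (h κ hk) hk.le
      have : κ * (κ * A / 4 + B / κ) = A / 4 * (κ * κ) + B := by field_simp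
      linarith)
  unfold discrim at this
  nlinarith
def dl (fe gb ff gc : RR) (x : Rl) : Rl := (fe x - ff x) ^ 2 + (gb x - gc x) ^ 2
lemma dln (fe gb ff gc : RR) x : 0 <= dda x := by unfold dl; positivity
lemma dlw (fe gb ff gc : RR) x :
    dda x <= 2 * (rfa x + rfb x) := by
  unfold dl rr
  nlinarith [sqn (fe x + ff x), sqn (gb x + gc x)]
def di (fe gb ff gc : RR) : Rl := ∫ x, dda x * xp
lemma dtn (fe gb ff gc : RR) : 0 <= Dda := inz fun x => mnn (dln _ _ _ _ x) (xpp _).le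
section two
variable {m C C' : Rl} {fe gb ff gc : RR}
lemma diz (hv : PMC rfa) (bu : Prof m C' rfb)
    (c : Continuous dda) :
    Integrable (fun x => dda x * xp) := by
  refine iob ((hv.int.add bu.int).const_mul 2) fp fun x => ?_
  rw [abn (mnn (dln _ _ _ _ x) (xpp _).le)]
  have := mlr (dlw fe gb ff gc x) (xpp (2 * x)).le
  simp only [paaz]; linarith
lemma rdiff (κ : Rl) (hk : 0 < κ) x : |rfa x - rfb x| <=
    κ / 2 * dda x + (1 / κ) * (rfa x + rfb x) := by
  have key : ∀ a b : Rl, a * b <= κ / 2 * a ^ 2 + 1 / κ * (b ^ 2 / 2) := by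
    intro a b
    have : κ / 2 * a ^ 2 + 1 / κ * (b ^ 2 / 2) - a * b = (κ * a - b) ^ 2 / (2 * κ) := by
      field_simp; ring
    have hj : 0 <= (κ * a - b) ^ 2 / (2 * κ) := po
    linarith
  have hk' : 0 < 1 / κ := po
  have kf := key (fe x - ff x) (fe x + ff x)
  have kg := key (gb x - gc x) (gb x + gc x)
  have kh := key (-(fe x - ff x)) (fe x + ff x)
  have ki := key (-(gb x - gc x)) (gb x + gc x)
  have hs : 1 / κ * ((fe x + ff x) ^ 2 / 2) + 1 / κ * ((gb x + gc x) ^ 2 / 2) <=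
      (1 / κ) * (rfa x + rfb x) := by
    rw [<- mul_add]
    refine mll ?_ hk'.le
    unfold rr
    nlinarith [sqn (fe x - ff x), sqn (gb x - gc x)]
  unfold dl
  rw [alz]
  unfold rr at hs ⊢
  constructor <;> nlinarith
lemma qiz (hv : PMC rfa) (bu : Prof m C' rfb)
    (c : Continuous dda) {κ : Rl} (hk : 0 < κ) (s : Set Rl) (hs : MeasurableSet s) :
    ∫ x in s, |rfa x * xp - rfb x * xp| <= κ / 2 * Dda + (1 / κ) * ((∫ x in s, rfa x * xp) +
        ∫ x in s, rfb x * xp) := by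
  have ia := diz hv bu c
  have ib : Integrable (fun x => κ / 2 * (dda x * xp)) := ia.const_mul _
  have ic : Integrable (fun x => (1 / κ) * (rfa x * xp + rfb x * xp)) := (hv.int.add bu.int).const_mul _
  calc _ <= ∫ x in s, (κ / 2 * (dda x * xp) + (1 / κ) *
        (rfa x * xp + rfb x * xp)) := by
        refine imz (hv.int.sub bu.int).abs.integrableOn (ib.add ic).integrableOn fun x => ?_
        have := mlr (rdiff (fe := fe) (gb := gb) (ff := ff) (gc := gc) κ hk x)
          (xpp (2 * x)).le
        simp only []
        rw [<- sub_mul, amz, abp (xpp (2 * x))]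
        linarith
    _ = κ / 2 * (∫ x in s, dda x * xp) + (1 / κ) * ((∫ x in s, rfa x * xp) +
        ∫ x in s, rfb x * xp) := by
        rw [iaz ib.integrableOn ic.integrableOn, ntcm, ntcm, iaz hv.int.integrableOn bu.int.integrableOn]
    _ <= _ := by
        have : ∫ x in s, dda x * xp <= Dda := sli ia (evf fun x => mnn (dln _ _ _ _ x) (xpp _).le)
        gcongr
lemma dlq (hv : PMC rfa) (bu : Prof m C' rfb)
    (c : Continuous dda) {κ : Rl} (hk : 0 < κ) x :
    |Mm rfa x - Mm rfb x| <=
      κ * Dda / 4 + (Mm rfa x + Mm rfb x) / κ := by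
  have hj := qiz hv bu c hk (Iic x) miz
  have e : Mm rfa x - Mm rfb x = hlf *
      ∫ x in Iic x, (rfa x * xp - rfb x * xp) := by
    rw [integral_sub hv.int.integrableOn bu.int.integrableOn]; unfold Mm; ring
  have bx : |∫ x in Iic x, (rfa x * xp - rfb x * xp)| <= _ := ailz
  rw [e, amz, abp (by norm_num : (0:Rl) < 1 / 2)]
  have bz := bx.trans hj
  have ej : (Mm rfa x + Mm rfb x) / κ = hlf * ((1 / κ) * ((∫ x in Iic x, rfa x * xp) +
        ∫ x in Iic x, rfb x * xp)) := by unfold Mm; ring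
  rw [ej]
  linarith
lemma dsq (hv : PMC rfa) (bu : Prof m C' rfb)
    (c : Continuous dda) x :
    (Mm rfa x - Mm rfb x) ^ 2 <=
      Dda * (Mm rfa x + Mm rfb x) := by
  rw [<- sq_abs]
  exact osz (abnn _) (dtn _ _ _ _) (add_nonneg (hv.M_nn x) (bu.M_nn x))
    fun κ hk => dlq hv bu c hk x
lemma dB (hv : PMC rfa) (bu : Prof m C' rfb) x :
    |(2 * m * Mm rfa x - Mm rfa x ^ 2) - (2 * m * Mm rfb x - Mm rfb x ^ 2)| <=
      4 * mo * |Mm rfa x - Mm rfb x| := by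
  have e : (2 * m * Mm rfa x - Mm rfa x ^ 2) - (2 * m * Mm rfb x - Mm rfb x ^ 2) =
      (2 * m - (Mm rfa x + Mm rfb x)) * (Mm rfa x - Mm rfb x) := by ring
  rw [e, amz]
  refine mlr ?_ (abnn _)
  have := hv.hm
  rw [alz]; constructor <;> linarith [hv.M_nn x, bu.M_nn x, hv.M_le x, bu.M_le x]
lemma doz (hv : PMC rfa) (bu : Prof m C' rfb) (x : Rl) (φ : RR)
    (hφ : IntegrableOn φ (Ioi x))
    (hb : ∀ s > x, |Mm rfa s - Mm rfb s| * esn <= φ s) :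
    |Zz m rfa x - Zz m rfb x| <= 4 * mo * ∫ s in Ioi x, φ s := by
  have hm := hv.hm
  have e : Zz m rfa x - Zz m rfb x = ∫ s in Ioi x, ((2 * m * Mm rfa s - Mm rfa s ^ 2) * esn -
      (2 * m * Mm rfb s - Mm rfb s ^ 2) * esn) := by
    rw [integral_sub hv.Bi_int.integrableOn bu.Bi_int.integrableOn]; rfl
  rw [e, <- ntcm]
  refine ailz.trans ?_
  refine smoz (hv.Bi_int.sub bu.Bi_int).abs.integrableOn (hφ.const_mul _)
    miq fun s hs => ?_
  rw [<- sub_mul, amz, abp (xpp _)]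
  calc _ <= 4 * mo * |Mm rfa s - Mm rfb s| * esn := by
        gcongr; exact dB hv bu s
    _ = 4 * mo * (|Mm rfa s - Mm rfb s| * esn) := by ring
    _ <= _ := by
        refine mll (hb s hs) li
end two
section twoH
variable {m C : Rl} {fe gb fe' gb' ff gc ff' gc' : RR}
lemma dcz (hv : ProfH m C fe gb fe' gb') (bu : ProfH m C ff gc ff' gc') :
    Continuous dda := by
  have := hv.am; have := hv.ao; have := bu.am; have := bu.ao
  unfold dl; fun_prop
lemma dsz (hv : ProfH m C fe gb fe' gb') (bu : ProfH m C ff gc ff' gc') x :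
    (Mm rfa x - Mm rfb x) ^ 2 * en <=
      Dda * (2 * Cm) * exp (-|x|) := by
  have h := mlr (dsq hv.prof bu.prof (dcz hv bu) x)
    (xpp (-(2 * x))).le
  have kf := hv.prof.M_exp' x
  have kg := bu.prof.M_exp' x
  have := mll (add_le_add kf kg) (dtn fe gb ff gc)
  linarith
lemma dsw (hv : ProfH m C fe gb fe' gb') (bu : ProfH m C ff gc ff' gc') (x : Rl) (c : Rl)
    (hc : 0 <= c) (hD : Dda * (2 * Cm) ^ 3 <= c ^ 4) :
    |Zz m rfa x - Zz m rfb x| <= 4 * mo * (c * ed) := by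
  have hm := hv.prof.hm
  have hC := hv.prof.hC
  have i := (iea.const_mul c)
  refine (doz hv.prof bu.prof x (fun s => c * exp (-|s|)) i.integrableOn
    (fun s _ => ?_)).trans ?_
  · set K := 2 * Cm with hK
    set mc := Mm rfa s
    set md := Mm rfb s
    have bf := hv.prof.M_bd s
    have bg := bu.prof.M_bd s
    have nc := hv.prof.M_nn s
    have nd := bu.prof.M_nn s
    have hs : mc + md <= K * exp (2 * s - 2 * |s|) := by rw [hK]; linarith
    have dj : |mc - md| ^ 2 <= Dda * (mc + md) := by
      rw [sq_abs]; exact dsq hv.prof bu.prof (dcz hv bu) s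
    have dk : |mc - md| ^ 2 <= (mc + md) ^ 2 := by
      rw [sq_abs]
      exact slsz li li
    have fk := dtn fe gb ff gc
    have bz : |mc - md| ^ 4 <= (c * exp (2 * s - |s|)) ^ 4 := by
      calc |mc - md| ^ 4 = |mc - md| ^ 2 * |mc - md| ^ 2 := by ring
        _ <= (Dda * (mc + md)) * (mc + md) ^ 2 := mlmz dj dk po po
        _ = Dda * (mc + md) ^ 3 := by ring
        _ <= Dda * (K * exp (2 * s - 2 * |s|)) ^ 3 := by gcongr
        _ = Dda * K ^ 3 * exp (2 * s - 2 * |s|) ^ 3 := by ring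
        _ <= c ^ 4 * exp (2 * s - |s|) ^ 4 := by
          refine mlmz hD ?_ po po
          rw [<- xnm, <- xnm]
          apply relz.2
          push_cast
          linarith [neg_abs_le s]
        _ = _ := by ring
    have dy : |mc - md| <= c * exp (2 * s - |s|) := le_of_pow_le_pow_left₀ nu po bz
    calc _ <= c * exp (2 * s - |s|) * esn := by gcongr
      _ = _ := by rw [maz, <- xad]; ring_nf
  · have : ∫ s in Ioi x, c * exp (-|s|) <= c * ed := by
      rw [ed, <- ntcm]
      exact sli i (evf fun y => po)
    gcongr
lemma dsk (hv : ProfH m C fe gb fe' gb') (bu : ProfH m C ff gc ff' gc') (x : Rl) {κ : Rl}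
    (hk : 0 < κ) :
    dda x <= (1 / κ) * en * Dda + κ * (4 * C) := by
  have c := dcz hv bu
  set dd : RR := fun x => 2 * ((fe x - ff x) * (fe' x - ff' x) + (gb x - gc x) * (gb' x - gc' x))
    with hdd
  have hd : forall x, HasDerivAt dda (dd x) x := by
    intro x
    refine ((((hv.df x).sub (bu.df x)).pow 2).add (((hv.dg x).sub (bu.dg x)).pow 2)).congr_deriv ?_
    simp only [Pi.sub_apply, hdd]
    push_cast; ring
  have ia : Integrable dda := by
    refine iob ((hv.prof.r_int.add bu.prof.r_int).const_mul 2) c fun x => ?_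
    rw [abn (dln _ _ _ _ x)]
    exact dlw fe gb ff gc x
  set nn : RR := fun x => 2 * ((fe' x ^ 2 + gb' x ^ 2) + (ff' x ^ 2 + gc' x ^ 2)) with hnn
  have inn : HI nn _ := ((hio hv.int').add (hio bu.int')).mul 2
  have bd : ∀ κ : Rl, 0 < κ -> forall x, |dd x| <= (1 / κ) * dda x + κ * nn x := by
    intro κ hk x
    have key : ∀ a b : Rl, 2 * (a * b) <= (1 / κ) * a ^ 2 + κ * b ^ 2 := by
      intro a b
      have : (1 / κ) * a ^ 2 + κ * b ^ 2 - 2 * (a * b) = (a - κ * b) ^ 2 / κ := by field_simp; ring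
      have hj : 0 <= (a - κ * b) ^ 2 / κ := po
      linarith
    have kf := key (fe x - ff x) (fe' x - ff' x)
    have kg := key (gb x - gc x) (gb' x - gc' x)
    have kh := key (-(fe x - ff x)) (fe' x - ff' x)
    have ki := key (-(gb x - gc x)) (gb' x - gc' x)
    have l : κ * (fe' x - ff' x) ^ 2 + κ * (gb' x - gc' x) ^ 2 <= κ * nn x := by
      rw [<- mul_add]
      refine mll ?_ hk.le
      rw [hnn]; simp only []
      nlinarith [sqn (fe' x + ff' x), sqn (gb' x + gc' x)]
    unfold dl
    rw [hdd]; simp only []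
    rw [alz]; constructor <;> nlinarith
  have idd : Integrable dd := by
    refine iob ((ia.const_mul (1 / 1)).add (inn.1.const_mul 1)) ?_ (bd 1 one_pos)
    have := hv.cf; have := hv.cg; have := bu.cf; have := bu.cg
    have := hv.am; have := hv.ao; have := bu.am; have := bu.ao
    rw [hdd]; fun_prop
  have iy := diz hv.prof bu.prof c
  have e := (tzz hd ia idd).2.2.2 x
  have ie := (ia.const_mul (1 / κ)).add (inn.1.const_mul κ)
  have sd : dda x <= ∫ y in Ioi x, ((1 / κ) * (en *
      (dda y * exp (2 * y))) + κ * nn y) := by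
    rw [e, <- integral_neg]
    refine smoz idd.neg.integrableOn
      (((iy.const_mul _).const_mul _).add (inn.1.const_mul κ)).integrableOn miq
      fun y hy => ?_
    have b := (neg_le_abs (dd y)).trans (bd κ hk y)
    have : dda y <= en * (dda y * exp (2 * y)) := by
      have : 1 <= en * exp (2 * y) := by
        rw [<- xad]; exact one_le_exp (by linarith [mem_Ioi.1 hy])
      nlinarith [dln fe gb ff gc y]
    have hk' : 0 < 1 / κ := po
    nlinarith
  refine sd.trans ?_
  have hI := ((((hio iy).mul en).mul (1 / κ)).add (inn.mul κ))
  have se := sli (s := Ioi x) hI.1 (evf fun y => by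
    have := dln fe gb ff gc y
    simp only [Pi.zero_apply, hnn]; positivity)
  refine se.trans ?_
  rw [hI.2]
  have := hv.bd'; have := bu.bd'
  unfold di
  nlinarith
end twoH

section twoH
variable {m C : Rl} {fe gb fe' gb' ff gc ff' gc' : RR}
lemma riz (hv : ProfH m C fe gb fe' gb') (bu : ProfH m C ff gc ff' gc') :
    Integrable (fun x => rfa x * (rfb x * xp)) := by
  refine iob (bu.prof.int.const_mul (KH m C)) (hv.prof.cont.mul bu.prof.qcont) fun x => ?_
  rw [abn (mnn (hv.prof.nn x) (bu.prof.qnn x))]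
  exact mlr (hv.r_sup x) (bu.prof.qnn x)
def Nint (m : Rl) (fe gb ff gc : RR) (x : Rl) : Rl := xp * (Vv m rfa x - Vv m rfb x) * (fe x * ff x + gb x * gc x)
lemma nrz (hv : ProfH m C fe gb fe' gb') (bu : ProfH m C ff gc ff' gc') (σ : Rl) (hσ : 0 <= σ)
    (hV : forall x, |Vv m rfa x - Vv m rfb x| <= σ)
    (hM : forall x, |Mm rfa x - Mm rfb x| <= σ) :
    |(∫ x, Nint m fe gb ff gc x) - (KF m fe gb - KF m ff gc)| <=
      σ * (2 * Cm * ed + 1) * Dda := by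
  have c := dcz hv bu
  set rg := rfa with gl
  set rh := rfb with gm
  have pd := hv.prof
  have pe := bu.prof
  rw [<- gl] at pd
  rw [<- gm] at pe
  obtain ⟨zl, bm, el⟩ := pd.Zq pd
  obtain ⟨zm, bn, eo⟩ := pd.Zq pe
  obtain ⟨zv, bv, ew⟩ := pe.Zq pd
  obtain ⟨zw, bw, ey⟩ := pe.Zq pe
  have il := riz hv hv
  have io := riz hv bu
  have iv := riz bu hv
  have iw := riz bu bu
  rw [<- gl] at il io iv
  rw [<- gm] at io iv iw
  have sn : ∫ x, rg x * (rh x * xp) = ∫ x, rh x * (rg x * xp) := by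
    congr 1; funext x; ring
  have id := diz pd pe c
  have cz := pd.V_cont
  have al := pe.V_cont
  have iR : Integrable (fun x => (Vv m rg x - Vv m rh x) * (dda x * xp)) := by
    refine iob (id.const_mul σ) fp fun x => ?_
    rw [amz, abn (mnn (dln fe gb ff gc x) (xpp (2 * x)).le)]
    exact mlr (hV x)
      (mnn (dln fe gb ff gc x) (xpp (2 * x)).le)
  have mf := ProfH.M2_int pd 2 nu
  have mf' := ProfH.M2_int pd 3 nu
  have mg := ProfH.M2_int pe 2 nu
  have mg' := ProfH.M2_int pe 3 nu
  have cw := pd.M_cont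
  have cy := pe.M_cont
  have bdD : forall x, |(Mm rg x - Mm rh x) ^ 3 * en| <=
      σ * (Dda * (2 * Cm)) * exp (-|x|) := by
    intro x
    have e : |(Mm rg x - Mm rh x) ^ 3 * en| =
        |Mm rg x - Mm rh x| * ((Mm rg x - Mm rh x) ^ 2 * en) := by
      rw [amz, abp (xpp _), abs_pow, <- sq_abs (Mm rg x - Mm rh x)]; ring
    rw [e]
    have := mlmz (hM x) (dsz hv bu x) po hσ
    refine this.trans (loez (by ring))
  have iD : Integrable (fun x => (Mm rg x - Mm rh x) ^ 3 * en) := iob (iea.const_mul _) fp bdD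
  have hN := ((((((hio il).add ((hio zl).mul 2)).add
      ((hio io).add ((hio zm).mul 2))).sub
      ((hio iv).add ((hio zv).mul 2))).sub
      ((hio iw).add ((hio zw).mul 2))).mul (-(1/2))).sub ((hio iR).mul (1/2))
      |>.congr (g := Nint m fe gb ff gc) (fun x => by
        unfold Nint Vv dl
        simp only [<- gl, <- gm]
        have qb : rg x = fe x ^ 2 + gb x ^ 2 := rfl
        have qc : rh x = ff x ^ 2 + gc x ^ 2 := rfl
        rw [qb, qc]; ring)
  have kf := ((((hio mf).mul (4 * m)).sub ((hio mf').mul (8 / 3)))).congr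
    (g := fun x => (4 * m * Mm rg x ^ 2 - 8 / 3 * Mm rg x ^ 3) * en)
    (fun x => by ring)
  have kg := ((((hio mg).mul (4 * m)).sub ((hio mg').mul (8 / 3)))).congr
    (g := fun x => (4 * m * Mm rh x ^ 2 - 8 / 3 * Mm rh x ^ 3) * en)
    (fun x => by ring)
  have hb := (((((hio bm).add (hio bn)).sub (hio bv)).sub (hio bw)).mul 2).eq
    ((kf.sub kg).add ((hio iD).mul (2 / 3))) (fun x => by ring)
  have fin : (∫ x, Nint m fe gb ff gc x) - (KF m fe gb - KF m ff gc) = -(2 / 3) * (∫ x, (Mm rg x - Mm rh x) ^ 3 * en) -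
      1 / 2 * ∫ x, (Vv m rg x - Vv m rh x) * (dda x * xp) := by
    rw [hN.2]
    unfold KF
    rw [<- gl, <- gm, kf.2, kg.2, el, eo, ew, ey, sn]
    linear_combination -hb
  rw [fin]
  have bf := (hio iD).abs_le ((hio iea).mul _) bdD
  have bg := (hio iR).abs_le ((hio id).mul σ) (fun x => by
    rw [amz, abn (mnn (dln fe gb ff gc x) (xpp (2 * x)).le)]
    exact mlr (hV x)
      (mnn (dln fe gb ff gc x) (xpp (2 * x)).le))
  have hD := dtn fe gb ff gc
  change _ <= σ * Dda at bg
  change _ <= _ * ed at bf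
  have hm := hv.prof.hm
  have hC := hv.prof.hC
  have hE := ezn
  have pf : 0 <= σ * (Dda * (2 * Cm)) * ed := po
  have pg : 0 <= σ * Dda := po
  rw [alz] at bf bg ⊢
  constructor <;> nlinarith
lemma nbz (m : Rl) (fe gb ff gc : RR) x : |Nint m fe gb ff gc x| <= hlf * (((m ^ 2 + xp * Vv m rfa x) ^ 2 * rfa x + rfb x) +
      ((m ^ 2 + xp * Vv m rfb x) ^ 2 * rfb x + rfa x)) := by
  have e : Nint m fe gb ff gc x = ((m ^ 2 + xp * Vv m rfa x) -
    (m ^ 2 + xp * Vv m rfb x)) * (fe x * ff x + gb x * gc x) := by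
    unfold Nint; ring
  rw [e]
  set wb := m ^ 2 + xp * Vv m rfa x
  set wd := m ^ 2 + xp * Vv m rfb x
  unfold rr
  rw [alz]; constructor <;>
  nlinarith [sqn (wb * fe x - ff x), sqn (wb * gb x - gc x), sqn (wd * ff x - fe x), sqn (wd * gc x - gb x), sqn (wb * fe x + ff x), sqn (wb * gb x + gc x), sqn (wd * ff x + fe x), sqn (wd * gc x + gb x)]
lemma dhz (hv : ProfH m C fe gb fe' gb') (bu : ProfH m C ff gc ff' gc') :
    ∃ c ≤ KW m C + (C * ed + 4 * mo), HI (fun x => hlf * (((m ^ 2 + xp * Vv m rfa x) ^ 2 * rfa x + rfb x) +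
      ((m ^ 2 + xp * Vv m rfb x) ^ 2 * rfb x + rfa x))) c := by
  refine ⟨_, ?_, (((hio hv.Wr_int).add (hio bu.prof.r_int)).add
    ((hio bu.Wr_int).add (hio hv.prof.r_int))).mul hlf⟩
  linarith [hv.Wr_tot, bu.Wr_tot, hv.prof.r_tot, bu.prof.r_tot]
def KK (m C : Rl) : Rl := KH m C * (8 * mo + 1) + 32 * mo * Cm * ed * (4 * mo)
lemma kdz (hv : ProfH m C fe gb fe' gb') (bu : ProfH m C ff gc ff' gc') {κ : Rl} (hk : 0 < κ) :
    |KF m fe gb - KF m ff gc| <= KK m C * (κ * Dda + 1 / κ) := by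
  have c := dcz hv bu
  have pd := hv.prof
  have pe := bu.prof
  have hm := pd.hm
  have hC := pd.hC
  have hE := ezn
  have hD := dtn fe gb ff gc
  have hKH := hv.KH_nn
  have q := qiz pd pe c hk univ MeasurableSet.univ
  rw [setIntegral_univ, setIntegral_univ, setIntegral_univ, pd.mass, pe.mass] at q
  have mf := ProfH.M2_int pd 2 nu
  have mf' := ProfH.M2_int pd 3 nu
  have mg := ProfH.M2_int pe 2 nu
  have mg' := ProfH.M2_int pe 3 nu
  set rg := rfa with gl
  set rh := rfb with gm
  have kf := ((((hio mf).mul (4 * m)).sub ((hio mf').mul (8 / 3)))).congr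
    (g := fun x => (4 * m * Mm rg x ^ 2 - 8 / 3 * Mm rg x ^ 3) * en)
    (fun x => by ring)
  have kg := ((((hio mg).mul (4 * m)).sub ((hio mg').mul (8 / 3)))).congr
    (g := fun x => (4 * m * Mm rh x ^ 2 - 8 / 3 * Mm rh x ^ 3) * en)
    (fun x => by ring)
  have af := ((hio hv.rq_int).sub (hio bu.rq_int)).abs_le
    ((hio (pd.int.sub pe.int).abs).mul (2 * KH m C)) (fun x => by
      have e : rfa x * (rfa x * xp) - rfb x * (rfb x * xp) =
        (rfa x + rfb x) * (rfa x * xp - rfb x * xp) := by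
        ring
      rw [e, amz]
      refine mlr ?_ (abnn _)
      rw [abn (add_nonneg (hv.prof.nn x) (bu.prof.nn x))]
      linarith [hv.r_sup x, bu.r_sup x])
  set A := κ * Dda / 4 + 4 * mo / κ with hA
  have fh : 0 <= A := po
  have ag := (kf.sub kg).abs_le ((hio iea).mul
      (A * (16 * mo * (2 * Cm)))) (fun x => by
      have e : (4 * m * Mm rg x ^ 2 - 8 / 3 * Mm rg x ^ 3) * en - (4 * m * Mm rh x ^ 2 - 8 / 3 * Mm rh x ^ 3) * en = (Mm rg x - Mm rh x) * ((4 * m * (Mm rg x + Mm rh x) -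
          8 / 3 * (Mm rg x ^ 2 + Mm rg x * Mm rh x + Mm rh x ^ 2)) * en) := by ring
      rw [e, amz, amz _ (exp _), abp (xpp _)]
      have nc := pd.M_nn x
      have nd := pe.M_nn x
      have ld := pd.M_le x
      have lf := pe.M_le x
      have bc : |Mm rg x - Mm rh x| <= A := by
        refine (dlq pd pe c hk x).trans ?_
        rw [hA]
        gcongr
        linarith
      have bf : |4 * m * (Mm rg x + Mm rh x) - 8 / 3 * (Mm rg x ^ 2 + Mm rg x * Mm rh x + Mm rh x ^ 2)| <=
          16 * mo * (Mm rg x + Mm rh x) := by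
        rw [alz]; constructor <;> nlinarith [mnn nc nd]
      have bg : (Mm rg x + Mm rh x) * en <=
          (2 * Cm) * exp (-|x|) := by
        linarith [pd.M_exp' x, pe.M_exp' x]
      calc _ <= A * (16 * mo * (Mm rg x + Mm rh x) * en) := by
            gcongr
        _ = A * (16 * mo) * ((Mm rg x + Mm rh x) * en) := by ring
        _ <= A * (16 * mo) * ((2 * Cm) * exp (-|x|)) := by gcongr
        _ = _ := by ring)
  change _ <= _ * ed at ag
  have ah : |KF m fe gb - KF m ff gc| <= 1 / 2 * (2 * KH m C * (κ / 2 * Dda + 1 / κ * (4 * mo + 4 * mo))) +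
      A * (16 * mo * (2 * Cm)) * ed := by
    have af' := af.trans (mll q (by positivity : 0 <= 2 * KH m C))
    unfold KF
    rw [<- gl, <- gm, kf.2, kg.2]
    rw [alz] at af' ag ⊢
    constructor <;> linarith
  refine ah.trans ?_
  unfold KK
  rw [hA]
  have hi : 0 <= 1 / κ := po
  have tb : 1 / 2 * (2 * KH m C * (κ / 2 * Dda + 1 / κ * (4 * mo + 4 * mo))) <=
      KH m C * (8 * mo + 1) * (κ * Dda + 1 / κ) := by
    have w : κ / 2 * Dda + 1 / κ * (4 * mo + 4 * mo) <=
      (8 * mo + 1) * (κ * Dda + 1 / κ) := by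
      have : 0 <= κ * Dda := po
      nlinarith
    have := mll w hKH
    linarith
  have tc : (κ * Dda / 4 + 4 * mo / κ) <= 4 * mo * (κ * Dda + 1 / κ) := by
    have : 0 <= κ * Dda := po
    have e : 4 * mo / κ = 4 * mo * (1 / κ) := by ring
    rw [e]; nlinarith
  have td := mlr tc
    (by positivity : 0 <= (16 * mo * (2 * Cm)) * ed)
  linarith
end twoH
lemma smallness {m C : Rl} (hm : 1 <= m) (hC : 0 <= C) {σ : Rl} (hσ : 0 < σ) :
    ∃ d > 0, ∀ fe gb fe' gb' ff gc ff' gc' : RR, ProfH m C fe gb fe' gb' -> ProfH m C ff gc ff' gc' -> Dda <= d -> (forall x, |Vv m rfa x - Vv m rfb x| <= σ) ∧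
      forall x, |Mm rfa x - Mm rfb x| <= σ := by
  have hE := ezn
  have hKH : 0 <= KH m C := by unfold KH; positivity
  set κ := 8 * (KH m C + 1) / σ with hκ
  have hκ0 : 0 < κ := po
  set η := σ / (2 * κ) with hη
  have hη0 : 0 < η := po
  obtain ⟨xa, gr⟩ : ∃ xa : Rl, xa <= 0 ∧ 4 * C * exp (2 * xa) <= η := by
    have l : Tendsto (fun x : Rl => 4 * C * xp) atBot (𝓝 (4 * C * 0)) := by
      refine Tendsto.const_mul _ (rtez.comp ?_)
      exact tiz.const_mul_atBot nu
    rw [mzz] at l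
    obtain ⟨x, hx⟩ := ((l.eventually (gmnz hη0)).and (eventually_le_atBot 0)).exists
    exact ⟨x, hx.2, hx.1.le⟩
  set κ' := η / (2 * (4 * C + 1)) with hκ'
  have hκ'0 : 0 < κ' := po
  set c := σ / (16 * mo * (ed + 1)) with hc
  have fw : 0 < c := po
  set Kc := 2 * Cm with hKc
  have fu : 0 < Kc := po
  refine ⟨min (min (η * κ' * exp (2 * xa) / 2) (c ^ 4 / Kc ^ 3)) (σ ^ 2 / (4 * mo)), po, ?_⟩
  intro fe gb fe' gb' ff gc ff' gc' hv bu hD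
  have fm := hD.trans ((min_le_left _ _).trans (min_le_left _ _))
  have fn := hD.trans ((min_le_left _ _).trans (min_le_right _ _))
  have fo := hD.trans (min_le_right _ _)
  have dlb : forall x, dda x <= η := by
    intro x
    rcases le_total x xa with hx | hx
    · have a := dlw fe gb ff gc x
      have bf := hv.prof.near x (hx.trans gr.1)
      have bg := bu.prof.near x (hx.trans gr.1)
      have : xp <= exp (2 * xa) := relz.2 li
      nlinarith [gr.2]
    · have a := dsk hv bu x hκ'0
      have ei : en <= exp (-(2 * xa)) := relz.2 li
      have ag : 1 / κ' * en * Dda <= η / 2 := by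
        calc _ <= 1 / κ' * exp (-(2 * xa)) * (η * κ' * exp (2 * xa) / 2) := by
              gcongr
              exact dtn _ _ _ _
          _ = η / 2 * (exp (-(2 * xa)) * exp (2 * xa)) := by field_simp
          _ = η / 2 := by rw [<- xad]; simp
      have ah : κ' * (4 * C) <= η / 2 := by
        rw [hκ', div_mul_eq_mul_div, div_le_iff₀ po]
        nlinarith
      linarith
  constructor
  · intro x
    have af := rdiff (fe := fe) (gb := gb) (ff := ff) (gc := gc) κ hκ0 x
    have ag : κ / 2 * dda x <= σ / 4 := by
      calc _ <= κ / 2 * η := by gcongr; exact dlb x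
        _ = σ / 4 := by rw [hη]; field_simp; ring
    have ah : 1 / κ * (rfa x + rfb x) <= σ / 4 := by
      have : rfa x + rfb x <= 2 * (KH m C + 1) := by
        linarith [hv.r_sup x, bu.r_sup x]
      calc _ <= 1 / κ * (2 * (KH m C + 1)) := by gcongr
        _ = σ / 4 := by rw [hκ]; field_simp; ring
    have ai := dsw hv bu x c fw.le (by
      rw [le_div_iff₀ po] at fn
      exact fn)
    have aj : 4 * mo * (c * ed) <= σ / 4 := by
      have : c * ed <= c * (ed + 1) := by nlinarith
      calc _ <= 4 * mo * (c * (ed + 1)) := by gcongr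
        _ = σ / 4 := by rw [hc]; field_simp; ring
    unfold Vv
    rw [alz] at af ai ⊢
    constructor <;> linarith
  · intro x
    have a := dsq hv.prof bu.prof (dcz hv bu) x
    have b : Mm rfa x + Mm rfb x <= 4 * mo := by
      linarith [hv.prof.M_le x, bu.prof.M_le x]
    rw [le_div_iff₀ po] at fo
    refine aloz ?_ hσ.le
    have := mll b (dtn fe gb ff gc)
    linarith

abbrev JC (lo hi : Rl) (G : Rl -> RR) : Prop := ContinuousOn (fun p : RxR => G p.1 p.2) (Irl ×ˢ univ)
def Dom (F : RR) (K : Rl) : Prop := ∃ Ψ : RR, ∃ c, c <= K ∧ HI Ψ c ∧ forall x, |F x| <= Ψ x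
lemma Dom.mono {F G : RR} {K K' : Rl} (h : Dom F K) (hK : K <= K') (e : forall x, |G x| <= |F x|) :
    Dom G K' := by
  obtain ⟨Ψ, c, hc, hi, hb⟩ := h
  exact ⟨Ψ, c, hc.trans hK, hi, fun x => (e x).trans (hb x)⟩
lemma Dom.int {F : RR} {K : Rl} (h : Dom F K) (hc : Continuous F) : Integrable F := by
  obtain ⟨Ψ, c, _, hi, hb⟩ := h
  exact iob hi.1 hc hb
lemma calz {n : ℕ} {h ψ : RR} {c : Rl} (hψ : HI ψ c) (hj : forall x, 0 <= ψ x)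
    (hb : forall x, |x| <= (n : Rl) -> |h x| <= ψ x) : |Jx h x| <= c := by
  have hn : -(n : Rl) <= n := by linarith [(ncnz n : (0 : Rl) <= n)]
  have hv : ‖Jx h x‖ <= Jx ψ x := by
    refine inl hn (evf fun x hx => ?_)
      hψ.1.intervalIntegrable
    exact hb x (alz.2 ⟨hx.1.le, hx.2⟩)
  refine hv.trans ?_
  rw [iol hn, <- hψ.2]
  exact sli hψ.1 (evf hj)
lemma cpz {n : ℕ} (hn : 1 <= n) {Φ Φx : RR} (hd : forall x, HasDerivAt Φ (Φx x) x)
    (hc : Continuous Φx) :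
    Jx chi n x * Φx x = Jx -(aq n x * Φ x) := by
  have cj : Continuous Φ := cic.2 fun x => (hd x).continuousAt
  have cn := cct n
  have co := ccz n
  have h := ftc (a := -(n : Rl)) (b := n)
    (f := fun x => chi n x * Φ x) (f' := fun x => aq n x * Φ x + chi n x * Φx x)
    (fun x _ => (cdw n x).mul (hd x))
    ((by fun_prop : Continuous fun x => aq n x * Φ x + chi n x * Φx x).intervalIntegrable _ _)
  rw [iad ((by fun_prop : Continuous fun x => aq n x * Φ x).intervalIntegrable _ _)
    ((by fun_prop : Continuous fun x => chi n x * Φx x).intervalIntegrable _ _)] at h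
  obtain ⟨ei, ej⟩ := ceq n hn
  simp only [ei, ej, zero_mul, sub_zero] at h
  rw [intervalIntegral.integral_neg]
  linarith
lemma cons {a b tb tc : Rl} (hv : tb ∈ Ioo a b) (bu : tc ∈ Ioo a b) (E Et Φ Φx : Rl -> RR)
    (hE : JC a b E) (hEt : JC a b Et) (hΦ : JC a b Φ) (hΦx : JC a b Φx)
    (dE : ∀ t ∈ Ioo a b, forall x, HasDerivAt (fun s => E s x) (Et t x) t)
    (dΦ : ∀ t ∈ Ioo a b, forall x, HasDerivAt (Φ t) (Φx t x) x)
    (iE : ∀ t ∈ Ioo a b, Integrable (E t)) (K : Rl)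
    (iΦ : ∀ t ∈ Ioo a b, Dom (Φ t) K) (iR : ∀ t ∈ Ioo a b, Dom (fun x => Et t x - Φx t x) K) :
    (∫ x, E tc x) - (∫ x, E tb x) = ∫ t in tb..tc, ∫ x, (Et t x - Φx t x) ∧
    IntervalIntegrable (fun t => ∫ x, (Et t x - Φx t x)) volume tb tc := by
  have hsub : uIcc tb tc ⊆ Ioo a b := (oiz.uIcc_subset hv bu)
  have ch : ∀ n : ℕ, ContinuousOn (fun p : RxR => chi n p.2) (Ioo a b ×ˢ univ) := fun n => ((cct n).comp continuous_snd).continuousOn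
  have ap : ∀ n : ℕ, ContinuousOn (fun p : RxR => aq n p.2) (Ioo a b ×ˢ univ) := fun n => ((ccz n).comp continuous_snd).continuousOn
  have dom : ∀ t ∈ Ioo a b, ∃ ψ : RR, ∃ c ≤ 9 * K, HI ψ c ∧ (forall x, 0 <= ψ x) ∧
      ∀ n : ℕ, n ≥ 1 -> forall x, |x| <= (n : Rl) ->
        |-(aq n x * Φ t x) + chi n x * (Et t x - Φx t x)| <= ψ x := by
    intro t ht
    obtain ⟨ψ1, cn, kf, ib, bf⟩ := iΦ t ht
    obtain ⟨ψ2, co, kg, ic, bg⟩ := iR t ht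
    refine ⟨_, _, ?_, (ib.mul 8).add ic, fun x => ?_, fun n hn x hx => ?_⟩
    · linarith
    · have := (abnn _).trans (bf x); have := (abnn _).trans (bg x); positivity
    · have xb := cbz hn hx
      have xc := cbd hn hx
      have xd : (8 : Rl) / n <= 8 := dlsz nu (by exact_mod_cast hn)
      refine (aalz _ _).trans (add_le_add ?_ ?_)
      · rw [abs_neg, amz]
        exact mlmz (xb.trans xd) (bf x) (abnn _) nu
      · rw [amz, abn xc.1]
        have := bg x
        have := abnn (Et t x - Φx t x)
        nlinarith
  refine flz hv bu (fun n t => Jx chi n x * E t x)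
    (fun n t => Jx (-(aq n x * Φ t x) + chi n x * (Et t x - Φx t x)))
    (fun t => ∫ x, E t x) _ (9 * K) 1 ?_ ?_ ?_ ?_ ?_
  · intro n hn t ht
    have := ch n
    have d := dui (c := -(n : Rl)) (d := n) (fun t x => chi n x * E t x) (fun t x => chi n x * Et t x)
      fp fp (fun t ht x => (dE t ht x).const_mul _) ht
    refine d.congr_deriv ?_
    have qb := cts _ hEt ht
    have qc := cts _ hΦ ht
    have qd := cts _ hΦx ht
    have cn := cct n
    have co := ccz n
    rw [iad
      ((by fun_prop : Continuous fun x => -(aq n x * Φ t x)).intervalIntegrable _ _)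
      ((by fun_prop : Continuous fun x => chi n x * (Et t x - Φx t x)).intervalIntegrable _ _), <- cpz hn (dΦ t ht) qd, <- iad
      ((by fun_prop : Continuous fun x => chi n x * Φx t x).intervalIntegrable _ _)
      ((by fun_prop : Continuous fun x => chi n x * (Et t x - Φx t x)).intervalIntegrable _ _)]
    congr 1; funext x; ring
  · intro n hn
    have := ch n
    have := ap n
    exact cpq (fun t x => -(aq n x * Φ t x) + chi n x * (Et t x - Φx t x)) fp
  · intro t ht
    have qb := cts _ hE ht
    refine ctk (fun x => |E t x|) _ (iE t ht).abs _
      (fun n => by have := cct n; fun_prop) (fun n hn x hx => ?_) (fun x => ?_)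
    · rw [amz, abn (cbd hn hx).1]
      have := (cbd hn hx).2
      have := abnn (E t x)
      nlinarith
    · simpa using (cte x).mul_const (E t x)
  · intro t ht
    have ht := hsub ht
    have qb := cts _ hEt ht
    have qc := cts _ hΦ ht
    have qd := cts _ hΦx ht
    obtain ⟨ψ, c, hc, hi, hj, hb⟩ := dom t ht
    refine ctk ψ _ hi.1 _ (fun n => by have := cct n; have := ccz n; fun_prop)
      hb (fun x => ?_)
    simpa using ((ctz x).mul_const (Φ t x)).neg.add
      ((cte x).mul_const (Et t x - Φx t x))
  · intro n hn t ht
    obtain ⟨ψ, c, hc, hi, hj, hb⟩ := dom t (hsub ht)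
    exact (calz hi hj (hb n hn)).trans hc

lemma WC {a b : Rl} (F P : Rl -> RR) (φ : RR) (K : Rl) (hF : JC a b F)
    (hP : ∀ s ∈ Ioo a b, ∃ c ≤ K, HI (P s) c) (fv : forall s x, 0 <= P s x)
    (hφ : Integrable φ)
    (hb : ∀ η > 0, ∀ s ∈ Ioo a b, forall x, |F s x| <= η * P s x + (1 / η) * φ x) :
    ContinuousOn (fun s => ∫ x, F s x) (Ioo a b) := by
  refine continuousOn_of_uniform_approx_of_continuousOn fun U hU => ?_
  obtain ⟨ε, hε, hU⟩ := Metric.mem_uniformity_dist.1 hU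
  set η := ε / (2 * (|K| + 1)) with hη
  have hη0 : 0 < η := po
  have hηK : η * K <= ε / 2 := by
    have : η * K <= η * (|K| + 1) := by
      refine mll ?_ hη0.le; linarith [lasz K]
    have e : η * (|K| + 1) = ε / 2 := by rw [hη]; field_simp
    linarith
  have hl : Tendsto (fun n : ℕ => (1 / η) * ((∫ x, φ x) - Jx φ x)) atTop (𝓝 0) := by
    have := intervalIntegral_tendsto_integral hφ (tnaz.comp tnaq)
      (tnaq (R := Rl))
    simpa using (this.const_sub (∫ x, φ x)).const_mul (1 / η)
  obtain ⟨n, hn⟩ := (hl.eventually (gmnz (hpz hε))).exists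
  refine ⟨fun s => Jx F s x, cpq F hF, fun s hs => hU ?_⟩
  obtain ⟨c, hc, hi⟩ := hP s hs
  have iF : Integrable (F s) := iob ((hi.1.const_mul 1).add (hφ.const_mul (1/1))) (cts _ hF hs)
      (fun x => hb 1 one_pos s hs x)
  have hnn : -(n : Rl) <= n := by linarith [(ncnz n : (0 : Rl) <= n)]
  have key : ∀ h : RR, Integrable h -> (∫ x, h x) - Jx h x =
      ∫ x in (Ioc ng n)ᶜ, h x := by
    intro h hh
    rw [iol hnn, <- integral_add_compl miw hh]
    ring
  rw [Real.dist_eq, key _ iF]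
  have ib := (hi.1.const_mul η).integrableOn (s := (Ioc ng n)ᶜ)
  have ic := (hφ.const_mul (1 / η)).integrableOn (s := (Ioc ng n)ᶜ)
  have hv : |∫ x in (Ioc ng n)ᶜ, F s x| <= ∫ x in (Ioc ng n)ᶜ, (η * P s x + (1 / η) * φ x) := ailz.trans (imz iF.abs.integrableOn (ib.add ic)
      (hb η hη0 s hs))
  rw [iaz ib ic, ntcm, ntcm, <- key φ hφ] at hv
  have bu : ∫ x in (Ioc ng n)ᶜ, P s x <= c := by
    rw [<- hi.2]; exact sli hi.1 (evf (fv s))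
  have := mll (bu.trans hc) hη0.le
  linarith
structure Dat where
  (f g ft gt fx gx fxx gxx : Rl -> RR)
def Dat.W (d : Dat) (m t x : Rl) : Rl := m ^ 2 + xp * Vv m rdd x
structure Sol (m lo hi : Rl) (d : Dat) : Prop where
  cf : JC lo hi d.f
  cg : JC lo hi d.g
  cft : JC lo hi d.ft
  cgt : JC lo hi d.gt
  cfx : JC lo hi d.fx
  cgx : JC lo hi d.gx
  cfxx : JC lo hi d.fxx
  cgxx : JC lo hi d.gxx
  dft : ∀ t ∈ Irl, forall x, HasDerivAt (fun s => d.f s x) (d.ft t x) t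
  dgt : ∀ t ∈ Irl, forall x, HasDerivAt (fun s => d.g s x) (d.gt t x) t
  dfx : ∀ t ∈ Irl, forall x, HasDerivAt (d.f t) fdx x
  dgx : ∀ t ∈ Irl, forall x, HasDerivAt (d.g t) gdx x
  dfxx : ∀ t ∈ Irl, forall x, HasDerivAt (d.fx t) (d.fxx t x) x
  dgxx : ∀ t ∈ Irl, forall x, HasDerivAt (d.gx t) (d.gxx t x) x
  bp : ∀ t ∈ Irl, forall x, xp * d.ft t x = -d.gxx t x + d.W m t x * gd
  bq : ∀ t ∈ Irl, forall x, xp * d.gt t x = d.fxx t x - d.W m t x * fd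
lemma Sol.mono {m lo hi lo' hi' : Rl} {d : Dat} (h : Sol m lo hi d) (hv : lo <= lo') (bu : hi' <= hi) :
    Sol m lo' hi' d := by
  have s : Ioo lo' hi' ⊆ Irl := Ioo_subset_Ioo hv bu
  have se : Ioo lo' hi' ×ˢ (univ : Set Rl) ⊆ Irl ×ˢ univ := prod_mono s Subset.rfl
  exact ⟨h.cf.mono se, h.cg.mono se, h.cft.mono se, h.cgt.mono se, h.cfx.mono se, h.cgx.mono se, h.cfxx.mono se, h.cgxx.mono se, fun t ht => h.dft t (s ht), fun t ht => h.dgt t (s ht), fun t ht => h.dfx t (s ht), fun t ht => h.dgx t (s ht), fun t ht => h.dfxx t (s ht), fun t ht => h.dgxx t (s ht), fun t ht => h.bp t (s ht), fun t ht => h.bq t (s ht)⟩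
def Dat.shift (d : Dat) (h : Rl) : Dat := ⟨fun t => d.f (t + h), fun t => d.g (t + h), fun t => d.ft (t + h), fun t => d.gt (t + h), fun t => d.fx (t + h), fun t => d.gx (t + h), fun t => d.fxx (t + h), fun t => d.gxx (t + h)⟩
lemma Sol.shift {m lo hi lo' hi' : Rl} {d : Dat} (h : Sol m lo hi d) (s : Rl) (hv : lo <= lo' + s)
    (bu : hi' + s <= hi) : Sol m lo' hi' (d.shift s) := by
  have k : ∀ t ∈ Ioo lo' hi', t + s ∈ Irl := fun t ht =>
    ⟨hta, htb⟩
  have c : forall G, JC lo hi G -> JC lo' hi' (fun t => G (t + s)) := by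
    intro G hG
    exact hG.comp (f := fun p : RxR => (p.1 + s, p.2)) fp
      (fun p hp => ⟨k _ hp.1, muz _⟩)
  exact ⟨c _ h.cf, c _ h.cg, c _ h.cft, c _ h.cgt, c _ h.cfx, c _ h.cgx, c _ h.cfxx, c _ h.cgxx, fun t ht x => (h.dft _ (k t ht) x).comp_add_const t s, fun t ht x => (h.dgt _ (k t ht) x).comp_add_const t s, fun t ht => h.dfx _ (k t ht), fun t ht => h.dgx _ (k t ht), fun t ht => h.dfxx _ (k t ht), fun t ht => h.dgxx _ (k t ht), fun t ht => h.bp _ (k t ht), fun t ht => h.bq _ (k t ht)⟩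
structure SolH (m lo hi C : Rl) (d : Dat) : Prop extends Sol m lo hi d where
  H : ∀ t ∈ Irl, PHd
def Gi (m : Rl) (d : Dat) (a b a' b' : RR) (t x : Rl) : Rl := fdx * a' x + gdx * b' x + d.W m t x * (fd * a x + gd * b x)
lemma gbz (m : Rl) (d : Dat) (a b a' b' : RR) (t x : Rl) {η : Rl} (hη : 0 < η) :
    |Gi m d a b a' b' t x| <= η * (hlf * ((fdx ^ 2 + gdx ^ 2) + d.W m t x ^ 2 * rdd x)) +
      (1 / η) * (hlf * ((a' x ^ 2 + b' x ^ 2) + rr a b x)) := by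
  have key : ∀ p q : Rl, |p * q| <= η * (hlf * p ^ 2) + (1 / η) * (hlf * q ^ 2) := by
    intro p q
    have ei : η * (hlf * p ^ 2) + (1 / η) * (hlf * q ^ 2) - p * q = (η * p - q) ^ 2 / (2 * η) := by
      field_simp; ring
    have ej : η * (hlf * p ^ 2) + (1 / η) * (hlf * q ^ 2) + p * q = (η * p + q) ^ 2 / (2 * η) := by
      field_simp; ring
    have hv : 0 <= (η * p - q) ^ 2 / (2 * η) := po
    have bu : 0 <= (η * p + q) ^ 2 / (2 * η) := po
    rw [alz]; constructor <;> linarith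
  have kf := key fdx (a' x)
  have kg := key gdx (b' x)
  have kh := key (d.W m t x * fd) (a x)
  have ki := key (d.W m t x * gd) (b x)
  unfold Gi rr
  rw [alz] at *
  constructor <;> linarith [kf.1, kf.2, kg.1, kg.2, kh.1, kh.2, ki.1, ki.2]
def kb (m C : Rl) : Rl := C + KW m C + C * ed + 4 * mo
section fix
variable {m lo hi C : Rl} {d : Dat} {a b a' b' : RR}
lemma SolH.P_HI (S : SolH m lo hi C d) {t} (ht : t ∈ Irl) : ∃ c ≤ hlf * (C + KW m C), HI (fun x => hlf * ((fdx ^ 2 + gdx ^ 2) +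
      d.W m t x ^ 2 * rdd x)) c := by
  have h := S.H t ht
  refine ⟨_, ?_, ((hio h.int').add (hio h.Wr_int)).mul hlf⟩
  have := h.bd'; have := h.Wr_tot
  linarith
lemma ProfH.p_HI (h : ProfH m C a b a' b') : ∃ c ≤ hlf * (C + (C * ed + 4 * mo)),
    HI (fun x => hlf * ((a' x ^ 2 + b' x ^ 2) + rr a b x)) c := by
  refine ⟨_, ?_, ((hio h.int').add (hio h.prof.r_int)).mul hlf⟩
  have := h.bd'; have := h.prof.r_tot
  linarith
lemma gez (S : Sol m lo hi d) {t} (ht : t ∈ Irl) x :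
    xp * (d.gt t x * a x - d.ft t x * b x) - (d.fxx t x * a x + fdx * a' x + (d.gxx t x * b x + gdx * b' x)) =
      -Gi m d a b a' b' t x := by
  unfold Gi
  linear_combination a x * S.bq t ht x - b x * S.bp t ht x
lemma pfz (S : SolH m lo hi C d) (h : ProfH m C a b a' b') {tb tc : Rl} (hv : tb ∈ Irl)
    (bu : tc ∈ Irl) :
    (∫ x, xp * (d.g tc x * a x - d.f tc x * b x)) - (∫ x, xp * (d.g tb x * a x - d.f tb x * b x)) =
      ∫ t in tb..tc, -∫ x, Gi m d a b a' b' t x := by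
  have := h.am; have := h.ao; have := h.cf; have := h.cg
  have := S.cf; have := S.cg; have := S.cft; have := S.cgt
  have := S.cfx; have := S.cgx; have := S.cfxx; have := S.cgxx
  have hm := h.prof.hm
  have hC := h.prof.hC
  have hE := ezn
  obtain ⟨cc, hcc, ip⟩ := h.p_HI
  have r := (cons hv bu (fun t x => xp * (gd * a x - fd * b x))
    (fun t x => xp * (d.gt t x * a x - d.ft t x * b x))
    (fun t x => fdx * a x + gdx * b x)
    (fun t x => d.fxx t x * a x + fdx * a' x + (d.gxx t x * b x + gdx * b' x))
    jcf jcf jcf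
    jcf
    (fun t ht x => (((S.dgt t ht x).mul_const _).sub ((S.dft t ht x).mul_const _)).const_mul _)
    (fun t ht x => ((S.dfxx t ht x).mul (h.df x)).add ((S.dgxx t ht x).mul (h.dg x)))
    ?_ (kb m C) ?_ ?_).1
  · rw [r]
    refine intervalIntegral.integral_congr fun t ht => ?_
    have ht := oiz.uIcc_subset hv bu ht
    simp only [gez S.toSol ht, integral_neg]
  · intro t ht
    have hh := S.H t ht
    refine iob ((hh.prof.int.add h.prof.int).const_mul 1) ?_ fun x => ?_
    · have := hh.am; have := hh.ao; have := h.am; have := h.ao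
      fun_prop
    · rw [amz, abp (xpp _)]
      have k : |gd * a x - fd * b x| <= rdd x + rr a b x := by
        unfold rr; rw [alz]; constructor <;>
        nlinarith [sqn (gd - a x), sqn (gd + a x), sqn (fd - b x), sqn (fd + b x), sqn fd, sqn gd, sqn (a x), sqn (b x)]
      have := mll k (xpp (2 * x)).le
      simp only [paaz]
      linarith
  · intro t ht
    have hh := S.H t ht
    refine ⟨_, _, ?_, ((hio hh.int').mul hlf).add ip, fun x => ?_⟩
    · have := hh.bd'
      have : 0 <= KW m C := ltz (inz fun x => mnn (sqn _) (hh.prof.nn x)) hh.Wr_tot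
      have : 0 <= C * ed := po
      unfold kb; linarith
    · unfold rr; rw [alz]; constructor <;>
      nlinarith [sqn (fdx - a x), sqn (fdx + a x), sqn (gdx - b x), sqn (gdx + b x), sqn (a' x), sqn (b' x)]
  · intro t ht
    obtain ⟨cn, fy, ib⟩ := S.P_HI ht
    refine ⟨_, _, ?_, (ib.mul 1).add (ip.mul (1 / 1)), fun x => ?_⟩
    · have : 0 <= KW m C := ltz (inz fun x => mnn (sqn _) ((S.H t ht).prof.nn x)) (S.H t ht).Wr_tot
      have : 0 <= C * ed := po
      unfold kb; linarith
    · simp only [gez S.toSol ht, abs_neg]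
      exact gbz m d a b a' b' t x one_pos
lemma gcz (S : SolH m lo hi C d) (h : ProfH m C a b a' b') :
    ContinuousOn (fun t => ∫ x, Gi m d a b a' b' t x) Irl := by
  obtain ⟨cc, hcc, ip⟩ := h.p_HI
  refine WC _ _ _ _ ?_ (fun s hs => S.P_HI hs) (fun s x => ?_) ip.1
    (fun η hη s hs x => gbz m d a b a' b' s x hη)
  · have := h.am; have := h.ao; have := h.cf; have := h.cg
    have := S.cf; have := S.cg; have := S.cft; have := S.cgt
    have := S.cfx; have := S.cgx; have := S.cfxx; have := S.cgxx
    have c : ContinuousOn (fun p : RxR => -(exp (2 * p.2) * (d.gt p.1 p.2 * a p.2 - d.ft p.1 p.2 * b p.2) - (d.fxx p.1 p.2 * a p.2 + d.fx p.1 p.2 * a' p.2 + (d.gxx p.1 p.2 * b p.2 + d.gx p.1 p.2 * b' p.2))))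
      (Irl ×ˢ univ) := jcf
    refine c.congr fun p hp => ?_
    have := gez (a := a) (b := b) (a' := a') (b' := b') S.toSol hp.1 p.2
    simp only
    linarith
  · unfold rr; positivity
lemma gaz (S : SolH m lo hi C d) (h : ProfH m C a b a' b') {t} (ht : t ∈ Irl) :
    |∫ x, Gi m d a b a' b' t x| <= kb m C := by
  obtain ⟨cc, hcc, ip⟩ := h.p_HI
  obtain ⟨cn, fy, ib⟩ := S.P_HI ht
  have hh := S.H t ht
  have hE := ezn
  have hC := h.prof.hC
  have hm := h.prof.hm
  have ke : 0 <= KW m C := ltz (inz fun x => mnn (sqn _) (hh.prof.nn x)) hh.Wr_tot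
  have i : Integrable (Gi m d a b a' b' t) := by
    refine iob ((ib.mul 1).add (ip.mul (1 / 1))).1 ?_ fun x => gbz m d a b a' b' t x one_pos
    have := hh.cf; have := hh.cg; have := hh.am; have := hh.ao; have := hh.Wr_cont
    have := h.cf; have := h.cg; have := h.am; have := h.ao
    unfold Gi Dat.W
    fun_prop
  have := (hio i).abs_le ((ib.mul 1).add (ip.mul (1 / 1))) fun x => gbz m d a b a' b' t x one_pos
  have : 0 <= C * ed := po
  unfold kb; linarith
end fix

lemma ilz {f : RR} {a b C : Rl} (h : ∀ x ∈ uIoc a b, |f x| <= C) :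
    |∫ x in a..b, f x| <= C * |b - a| := by
  have := intervalIntegral.norm_integral_le_of_norm_le_const (f := f) h
  rwa [rnez] at this
lemma ptz {m lo hi C : Rl} {d e : Dat} (S : SolH m lo hi C d) (S' : SolH m lo hi C e)
    {tb tc : Rl} (hv : tb ∈ Irl) (bu : tc ∈ Irl) :
    (∫ x, xp * (d.g tc x * e.f tc x - d.f tc x * e.g tc x)) - (∫ x, xp * (d.g tb x * e.f tb x - d.f tb x * e.g tb x)) = ∫ t in tb..tc, -(∫ x, Nint m (d.f t) (d.g t) (e.f t) (e.g t) x) ∧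
    IntervalIntegrable (fun t => -∫ x, Nint m (d.f t) (d.g t) (e.f t) (e.g t) x) volume tb tc := by
  have := S.cf; have := S.cg; have := S.cft; have := S.cgt
  have := S.cfx; have := S.cgx; have := S.cfxx; have := S.cgxx
  have := S'.cf; have := S'.cg; have := S'.cft; have := S'.cgt
  have := S'.cfx; have := S'.cgx; have := S'.cfxx; have := S'.cgxx
  have hm := (S.H tb hv).prof.hm
  have hC := (S.H tb hv).prof.hC
  have hE := ezn
  have hCE : 0 <= C * ed := po
  have ke : 0 <= KW m C := ltz (inz fun x => mnn (sqn _) ((S.H tb hv).prof.nn x)) (S.H tb hv).Wr_tot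
  have key : ∀ t ∈ Irl, forall x, xp * ((d.gt t x * e.f t x + gd * e.ft t x) - (d.ft t x * e.g t x + fd * e.gt t x)) - ((d.fxx t x * e.f t x + fdx * e.fx t x) - (fdx * e.fx t x + fd * e.fxx t x) + ((d.gxx t x * e.g t x + gdx * e.gx t x) - (gdx * e.gx t x + gd * e.gxx t x))) =
      -Nint m (d.f t) (d.g t) (e.f t) (e.g t) x := by
    intro t ht x
    have qb := S.bp t ht x
    have qc := S.bq t ht x
    have qd := S'.bp t ht x
    have qe := S'.bq t ht x
    unfold Dat.W at *
    unfold Nint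
    linear_combination e.f t x * qc - e.g t x * qb + gd * qd - fd * qe
  have r := (cons hv bu (fun t x => xp * (gd * e.f t x - fd * e.g t x))
    (fun t x => xp * ((d.gt t x * e.f t x + gd * e.ft t x) - (d.ft t x * e.g t x + fd * e.gt t x)))
    (fun t x => fdx * e.f t x - fd * e.fx t x + (gdx * e.g t x - gd * e.gx t x))
    (fun t x => (d.fxx t x * e.f t x + fdx * e.fx t x) - (fdx * e.fx t x + fd * e.fxx t x) + ((d.gxx t x * e.g t x + gdx * e.gx t x) - (gdx * e.gx t x + gd * e.gxx t x)))
    jcf jcf jcf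
    jcf
    (fun t ht x => (((S.dgt t ht x).mul (S'.dft t ht x)).sub
      ((S.dft t ht x).mul (S'.dgt t ht x))).const_mul _)
    (fun t ht x => (((S.dfxx t ht x).mul (S'.dfx t ht x)).sub
      ((S.dfx t ht x).mul (S'.dfxx t ht x))).add
      (((S.dgxx t ht x).mul (S'.dgx t ht x)).sub ((S.dgx t ht x).mul (S'.dgxx t ht x))))
    ?_ (2 * kb m C) ?_ ?_)
  · have ei : ∀ t ∈ uIcc tb tc, (∫ x, (xp * ((d.gt t x * e.f t x + gd * e.ft t x) - (d.ft t x * e.g t x + fd * e.gt t x)) - ((d.fxx t x * e.f t x + fdx * e.fx t x) - (fdx * e.fx t x + fd * e.fxx t x) + ((d.gxx t x * e.g t x + gdx * e.gx t x) - (gdx * e.gx t x + gd * e.gxx t x))))) =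
        -(∫ x, Nint m (d.f t) (d.g t) (e.f t) (e.g t) x) := by
      intro t ht
      have ht := oiz.uIcc_subset hv bu ht
      simp only [key t ht, integral_neg]
    exact ⟨r.1.trans (intervalIntegral.integral_congr ei), r.2.congr fun t ht => ei t (ucc ht)⟩
  · intro t ht
    have hh := S.H t ht
    have h := S'.H t ht
    refine iob ((hh.prof.int.add h.prof.int).const_mul 1) ?_ fun x => ?_
    · have := hh.am; have := hh.ao; have := h.am; have := h.ao
      fun_prop
    · rw [amz, abp (xpp _)]
      have k : |gd * e.f t x - fd * e.g t x| <=
          rdd x + rr (e.f t) (e.g t) x := by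
        unfold rr; rw [alz]; constructor <;>
        nlinarith [sqn (gd - e.f t x), sqn (gd + e.f t x), sqn (fd - e.g t x), sqn (fd + e.g t x), sqn fd, sqn gd, sqn (e.f t x), sqn (e.g t x)]
      have := mll k (xpp (2 * x)).le
      simp only [paaz]
      linarith
  · intro t ht
    obtain ⟨cn, fy, ib⟩ := (S.H t ht).p_HI
    obtain ⟨co, gf, ic⟩ := (S'.H t ht).p_HI
    refine ⟨_, _, ?_, ib.add ic, fun x => ?_⟩
    · unfold kb; linarith
    · unfold rr; rw [alz]; constructor <;>
      nlinarith [sqn (fdx - e.f t x), sqn (fdx + e.f t x), sqn (gdx - e.g t x), sqn (gdx + e.g t x), sqn (e.fx t x - fd), sqn (e.fx t x + fd), sqn (e.gx t x - gd), sqn (e.gx t x + gd)]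
  · intro t ht
    obtain ⟨cn, fy, ib⟩ := dhz (S.H t ht) (S'.H t ht)
    refine ⟨_, _, ?_, ib, fun x => ?_⟩
    · unfold kb; linarith
    · simp only [key t ht, abs_neg]
      exact nbz _ _ _ _ _ x
lemma ProfH.rot {m C : Rl} {f g f' g' : RR} (h : PH) :
    ProfH m C g (fun x => -f x) g' (fun x => -f' x) := by
  have e : rr g (fun x => -f x) = rfg := by funext x; unfold rr; ring
  have ej : (fun x => g' x ^ 2 + (-f' x) ^ 2) = fun x => f' x ^ 2 + g' x ^ 2 := by funext x; ring
  exact ⟨by rw [e]; exact h.prof, h.dg, fun x => (h.df x).neg, h.cg, h.cf.neg,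
    by rw [ej]; exact h.int', by rw [ej]; exact h.bd'⟩
lemma dlz {m lo hi C : Rl} {d : Dat} (S : SolH m lo hi C d) {s t : Rl} (hs : s ∈ Irl)
    (ht : t ∈ Irl) : di (d.f s) (d.g s) (d.f t) (d.g t) <= 2 * kb m C * |s - t| := by
  have h := S.H t ht
  have h' := S.H s hs
  have r := pfz S h.rot ht hs
  have b : |∫ τ in t..s, -∫ x, Gi m d (d.g t) (fun x => -fd) (d.gx t) (fun x => -fdx) τ x| <=
      kb m C * |s - t| := by
    refine ilz fun τ hτ => ?_
    rw [abs_neg]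
    exact gaz S h.rot (oiz.uIcc_subset ht hs (ucc hτ))
  rw [<- r] at b
  have ib := hio h.prof.int
  have ic := hio h'.prof.int
  have ia := hio (diz h.prof h'.prof (dcz h h'))
  have cj := h.am; have cn := h.ao; have co := h'.am; have cs := h'.ao
  have ix : Integrable (fun x => xp * (d.g s x * gd - d.f s x * -fd)) := by
    refine ((((ib.add ic).sub ia).mul hlf).congr fun x => ?_).1
    unfold rr dl; ring
  have eD := ((ib.add ic).sub ((hio ix).mul 2)).eq
    (hio (diz h'.prof h.prof (dcz h' h))) fun x => by unfold rr dl; ring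
  rw [h.prof.mass, h'.prof.mass] at eD
  have ej : ∫ x, xp * (gd * gd - fd * -fd) = 4 * mo := by
    rw [<- h.prof.mass]; congr 1; funext x; unfold rr; ring
  rw [ej] at b
  unfold di
  have := alz.1 b
  linarith
lemma kcz {m lo hi C : Rl} {d : Dat} (S : SolH m lo hi C d) :
    ContinuousOn (fun t => KF m (d.f t) (d.g t)) Irl := by
  intro t ht
  rw [ContinuousWithinAt, tendsto_iff_dist_tendsto_zero]
  have hl : Tendsto (fun s => KK m C * ((2 * kb m C + 1) * √|s - t|)) (𝓝[Irl] t) (𝓝 0) := by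
    have c : Continuous (fun s => KK m C * ((2 * kb m C + 1) * √|s - t|)) := fp
    have := c.tendsto t
    simp only [sub_self, abs_zero, Real.sqrt_zero, mzz] at this
    exact this.mono_left nwn
  refine squeeze_zero' (evf fun s => dist_nonneg) ?_ hl
  filter_upwards [self_mem_nhdsWithin] with s hs
  rw [Real.dist_eq]
  rcases eq_or_ne s t with rfl | hne
  · simp
  have hp : 0 < |s - t| := abs_pos.2 (sub_ne_zero.2 hne)
  have hq : 0 < √|s - t| := Real.sqrt_pos.2 hp
  have k := kdz (S.H s hs) (S.H t ht) (κ := 1 / √|s - t|) po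
  have hKK : 0 <= KK m C := by
    by_contra hneg
    have := (abnn _).trans k
    have : 0 < 1 / √|s - t| * di (d.f s) (d.g s) (d.f t) (d.g t) + 1 / (1 / √|s - t|) := by
      have := dtn (d.f s) (d.g s) (d.f t) (d.g t)
      positivity
    nlinarith
  refine k.trans (mll ?_ hKK)
  have l := dlz S hs ht
  have e : |s - t| = √|s - t| * √|s - t| := (Real.mul_self_sqrt hp.le).symm
  rw [e] at l
  have : 1 / √|s - t| * di (d.f s) (d.g s) (d.f t) (d.g t) <= 2 * kb m C * √|s - t| := by
    rw [one_div, imlz hq]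
    linarith
  rw [one_div_one_div]
  linarith
lemma alq {lo hi : Rl} {K : RR} (hK : ContinuousOn K Irl) {t : Rl}
    (ht : t ∈ Irl) : Tendsto (fun h => h⁻¹ * ∫ s in t..(t + h), K s) (𝓝[>] 0) (𝓝 (K t)) := by
  have hd : HasDerivAt (fun u => ∫ s in t..u, K s) (K t) t := by
    refine intervalIntegral.integral_hasDerivAt_right (by simp) ?_
      (hK.continuousAt (isOpen_Ioo.mem_nhds ht))
    exact hK.stronglyMeasurableAtFilter isOpen_Ioo t ht
  have := hd.tendsto_slope_zero_right
  simpa using this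
theorem ecz {m lo hi C : Rl} {d : Dat} (S : SolH m lo hi C d) {tb tc : Rl}
    (hv : tb ∈ Irl) (bu : tc ∈ Irl) (hlt : tb <= tc) :
    eF m (d.f tb) (d.g tb) (d.fx tb) (d.gx tb) = eF m (d.f tc) (d.g tc) (d.fx tc) (d.gx tc) := by
  set K : RR := fun t => KF m (d.f t) (d.g t) with hKdef
  set A : RR := fun t => AF m (d.f t) (d.g t) (d.fx t) (d.gx t) with hAdef
  have hK : ContinuousOn K Irl := kcz S
  have hm := (S.H tb hv).prof.hm
  have hC := (S.H tb hv).prof.hC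
  have hE := ezn
  set om : Rl -> RR := fun h t =>
    ∫ x, xp * (d.g (t + h) x * fd - d.f (t + h) x * gd) with hom
  have lom : ∀ t ∈ Irl, Tendsto (fun h => h⁻¹ * om h t) (𝓝[>] 0) (𝓝 (-A t)) := by
    intro t ht
    have c := (gcz S (S.H t ht)).neg
    have l := alq c ht
    have e : ∫ x, Gi m d (d.f t) (d.g t) (d.fx t) (d.gx t) t x = A t := by
      rw [hAdef]; unfold AF; congr 1; funext x; unfold Gi Dat.W rr; ring
    simp only [Pi.neg_apply, e] at l
    refine l.congr' ?_
    have : ∀ᶠ h in 𝓝[>] (0:Rl), t + h ∈ Irl := by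
      have co : Tendsto (fun h => t + h) (𝓝[>] (0:Rl)) (𝓝 t) := by
        have : Continuous (fun h => t + h) := fp
        simpa using (this.tendsto 0).mono_left nwn
      exact co (isOpen_Ioo.mem_nhds ht)
    filter_upwards [this] with h hh
    have r := pfz S (S.H t ht) ht hh
    have z : ∫ x, xp * (gd * fd - fd * gd) = 0 := by
      rw [<- integral_zero Rl Rl]; congr 1; funext x; ring
    rw [z, sub_zero] at r
    rw [hom, <- r]
  have lh : Tendsto (fun h => h⁻¹ * (om h tc - om h tb) + (h⁻¹ * (∫ s in tc..(tc + h), K s) - h⁻¹ * (∫ s in tb..(tb + h), K s))) (𝓝[>] 0)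
      (𝓝 ((-A tc - -A tb) + (K tc - K tb))) := by
    refine ((((lom tc bu).sub (lom tb hv)).add ((alq hK bu).sub (alq hK hv)))).congr
      fun h => by ring
  have small : ∀ σ > 0, |(-A tc - -A tb) + (K tc - K tb)| <=
      (σ * (2 * Cm * ed + 1) * (2 * kb m C)) * (tc - tb) := by
    intro σ hσ
    obtain ⟨dd, hdd, sm⟩ := smallness hm hC hσ
    refine le_of_tendsto lh.abs ?_
    have br : ∀ᶠ h in 𝓝[>] (0:Rl), 2 * kb m C * h < dd := by
      have : Continuous (fun h => 2 * kb m C * h) := fp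
      have t := (this.tendsto 0).mono_left (nwn (s := Ioi 0))
      simp only [mzz] at t
      exact t.eventually (gmnz hdd)
    have bs : ∀ᶠ h in 𝓝[>] (0:Rl), h < hi - tc :=
      nwn (gmnz (by linarith [bu.2]))
    filter_upwards [br, bs, self_mem_nhdsWithin] with h af ag ah
    have ah : 0 < h := ah
    have SS : SolH m lo (hi - h) C (d.shift h) := ⟨S.toSol.shift h li li, fun t ht =>
        S.H (t + h) ⟨hta, htb⟩⟩
    have sa : SolH m lo (hi - h) C d :=
      ⟨S.toSol.mono lrz li, fun t ht => S.H t ⟨ht.1, htb⟩⟩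
    have gb : tb ∈ Ioo lo (hi - h) := ⟨hv.1, li⟩
    have gc : tc ∈ Ioo lo (hi - h) := ⟨bu.1, li⟩
    obtain ⟨r, ri⟩ := ptz SS sa gb gc
    have r : om h tc - om h tb = _ := r
    have sub : uIcc tb tc ⊆ Ioo lo (hi - h) := oiz.uIcc_subset gb gc
    have kf : IntervalIntegrable (fun t => K (t + h)) volume tb tc := by
      refine ContinuousOn.intervalIntegrable (hK.comp fp fun t ht => ?_)
      exact ⟨by linarith [(sub ht).1], by linarith [(sub ht).2]⟩
    have kg : ∀ x ∈ Icc tb (tc + h), ∀ y ∈ Icc tb (tc + h), IntervalIntegrable K volume x y := by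
      intro x hx y hy
      refine (hK.mono fun z hz => ?_).intervalIntegrable
      have := ordConnected_Icc.uIcc_subset hx hy hz
      exact ⟨by linarith [this.1, hv.1], by linarith [this.2]⟩
    have kh := kg tb ⟨li, li⟩ tc ⟨li, li⟩
    have eK : (∫ s in tc..(tc + h), K s) - (∫ s in tb..(tb + h), K s) =
        ∫ t in tb..tc, (K (t + h) - K t) := by
      rw [isb kf kh, intervalIntegral.integral_comp_add_right]
      have pd := iiaz
        (kg tb ⟨li, li⟩ tc ⟨li, li⟩)
        (kg tc ⟨li, li⟩ (tc + h) ⟨li, li⟩)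
      have pe := iiaz
        (kg tb ⟨li, li⟩ (tb + h) ⟨li, li⟩)
        (kg (tb + h) ⟨li, li⟩ (tc + h) ⟨li, li⟩)
      linarith
    have tot : |(om h tc - om h tb) + ∫ t in tb..tc, (K (t + h) - K t)| <=
        (σ * (2 * Cm * ed + 1) * (2 * kb m C * h)) * |tc - tb| := by
      rw [r, <- iad ri (kf.sub kh)]
      refine ilz fun t ht => ?_
      have ht := sub (ucc ht)
      have gp : t ∈ Irl := ⟨ht.1, htb⟩
      have gq : t + h ∈ Irl := ⟨hta, htb⟩
      have D := dlz S gq gp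
      rw [add_sub_cancel_left, abp ah] at D
      obtain ⟨qb, qc⟩ := sm _ _ _ _ _ _ _ _ (S.H _ gq) (S.H _ gp) (D.trans af.le)
      have nr := nrz (S.H _ gq) (S.H _ gp) σ hσ.le qb qc
      have nf := nr.trans (mll D po)
      rw [<- abs_neg]
      refine ltz (loez ?_) nf
      congr 1
      change -(-(∫ x, Nint m (d.f (t + h)) (d.g (t + h)) (d.f t) (d.g t) x) + (KF m (d.f (t + h)) (d.g (t + h)) - KF m (d.f t) (d.g t))) = _
      ring
    rw [<- mul_sub, <- mul_add, eK, amz, abp (inv_pos.2 ah), imlz ah]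
    rw [abn (sub_nonneg.2 hlt)] at tot
    linarith
  have zero : (-A tc - -A tb) + (K tc - K tb) = 0 := by
    have l : Tendsto (fun σ : Rl => (σ * (2 * Cm * ed + 1) * (2 * kb m C)) * (tc - tb))
        (𝓝[>] 0) (𝓝 0) := by
      have : Continuous (fun σ : Rl => (σ * (2 * Cm * ed + 1) * (2 * kb m C)) * (tc - tb)) := fp
      simpa using (this.tendsto 0).mono_left (nwn (s := Ioi 0))
    have := ge_of_tendsto l (by filter_upwards [self_mem_nhdsWithin] with σ hσ using small σ hσ)
    exact abs_nonpos_iff.1 this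
  rw [<- (S.H tb hv).bogo.2.2, <- (S.H tc bu).bogo.2.2]
  change A tb - K tb = A tc - K tc
  linarith

structure SolX (lo hi : Rl) (d : Dat) (fxt gxt : Rl -> RR) : Prop where
  cfxt : JC lo hi fxt
  cgxt : JC lo hi gxt
  dfxt : ∀ t ∈ Irl, forall x, HasDerivAt (fun s => d.fx s x) (fxt t x) t
  dgxt : ∀ t ∈ Irl, forall x, HasDerivAt (fun s => d.gx s x) (gxt t x) t
  dftx : ∀ t ∈ Irl, forall x, HasDerivAt (d.ft t) (fxt t x) x
  dgtx : ∀ t ∈ Irl, forall x, HasDerivAt (d.gt t) (gxt t x) x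
lemma SolX.mono {lo hi lo' hi' : Rl} {d : Dat} {fxt gxt : Rl -> RR} (h : SolX lo hi d fxt gxt)
    (hv : lo <= lo') (bu : hi' <= hi) : SolX lo' hi' d fxt gxt := by
  have s : Ioo lo' hi' ⊆ Irl := Ioo_subset_Ioo hv bu
  have se : Ioo lo' hi' ×ˢ (univ : Set Rl) ⊆ Irl ×ˢ univ := prod_mono s Subset.rfl
  exact ⟨h.cfxt.mono se, h.cgxt.mono se, fun t ht => h.dfxt t (s ht), fun t ht => h.dgxt t (s ht), fun t ht => h.dftx t (s ht), fun t ht => h.dgtx t (s ht)⟩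
def Dat.p (d : Dat) (t x : Rl) : Rl := fd * gdx - gd * fdx
def Dat.pt (d : Dat) (fxt gxt : Rl -> RR) (t x : Rl) : Rl := (d.ft t x * gdx + fd * gxt t x) - (d.gt t x * fdx + gd * fxt t x)
def Dat.M (d : Dat) (t x : Rl) : Rl := Mm rdd x
def Dat.r (d : Dat) (t x : Rl) : Rl := rdd x
def Dat.v (d : Dat) (t x : Rl) : Rl := fdx ^ 2 + gdx ^ 2
def momR (m : Rl) (d : Dat) (k kf kg kh : RR) (t x : Rl) : Rl := 2 * (kf x + k x) * d.v t x - 1 / 2 * (kh x + 2 * kg x) * drx + 2 * k x * mdx ^ 2 * drx - (k x + 1 / 2 * kf x) * (drx * (drx * xp))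
def momJ (m : Rl) (d : Dat) (k kf kg : RR) (t x : Rl) : Rl := k x * xp * (fd * d.gt t x - gd * d.ft t x)
    - 1 / 2 * (kf x + 2 * k x) * (2 * (fd * fdx + gd * gdx))
    + 1 / 2 * (kg x + 2 * kf x) * drx - k x * d.v t x
    + k x * (m ^ 2 + xp * Vv m rdd x) * drx
    + 1 / 2 * k x * xp * drx ^ 2
section mom
variable {m lo hi C : Rl} {d : Dat} {fxt gxt : Rl -> RR} {k kf kg kh : RR}
lemma pcq (S : Sol m lo hi d) (X : SolX lo hi d fxt gxt) : JC lo hi (d.pt fxt gxt) := by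
  have := S.cf; have := S.cg; have := S.cft; have := S.cgt; have := S.cfx; have := S.cgx
  have := X.cfxt; have := X.cgxt
  unfold JC Dat.pt at *; fun_prop
lemma pcz (S : Sol m lo hi d) : JC lo hi d.p := by
  have := S.cf; have := S.cg; have := S.cfx; have := S.cgx
  unfold JC Dat.p at *; fun_prop
lemma pdz (S : Sol m lo hi d) (X : SolX lo hi d fxt gxt) {t} (ht : t ∈ Irl) x :
    HasDerivAt (fun s => d.p s x) (d.pt fxt gxt t x) t := ((S.dft t ht x).mul (X.dgxt t ht x)).sub ((S.dgt t ht x).mul (X.dfxt t ht x))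
lemma mdz (S : Sol m lo hi d) (X : SolX lo hi d fxt gxt) {A B : Rl} (hk : Continuous k) {t : Rl}
    (ht : t ∈ Irl) :
    HasDerivAt (fun s => ∫ x in A..B, k x * xp * d.p s x)
      (∫ x in A..B, k x * xp * d.pt fxt gxt t x) t := by
  have cn := pcz S
  have co := pcq S X
  exact dui (fun s x => k x * xp * d.p s x)
    (fun s x => k x * xp * d.pt fxt gxt s x) jcf
    jcf (fun t ht x => (pdz S X ht x).const_mul _) ht
lemma vdz {r' : Rl} {f g : RR} (h : PMC rfg) {x : Rl}
    (hr : HasDerivAt rfg r' x) :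
    HasDerivAt (Vv m rfg) (-r' + 2 * ((2 * m * Mm rfg x - Mm rfg x ^ 2) *
      en)) x := by
  refine (hr.neg.sub ((h.Z_deriv x).const_mul 2)).congr_deriv ?_
  ring
lemma rdq (S : Sol m lo hi d) {t} (ht : t ∈ Irl) x :
    HasDerivAt (d.r t) (2 * (fd * fdx + gd * gdx)) x := by
  refine (((S.dfx t ht x).pow 2).add ((S.dgx t ht x).pow 2)).congr_deriv ?_
  push_cast; ring
lemma bt x : HasDerivAt (fun x : Rl => xp) (2 * xp) x := by
  refine (((hid x).const_mul 2).exp).congr_deriv ?_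
  simp; ring
lemma mcz (S : Sol m lo hi d) {t} (ht : t ∈ Irl)
    (hP : PMC rdd) (cj : Continuous k) (cn : Continuous kf)
    (co : Continuous kg) (cs : Continuous kh) : Continuous (momR m d k kf kg kh t) := by
  have qb := cts _ S.cf ht; have qc := cts _ S.cg ht
  have qd := cts _ S.cfx ht; have qe := cts _ S.cgx ht
  have := hP.M_cont; have := hP.cont
  unfold momR Dat.v Dat.r Dat.M
  fun_prop
lemma miqz (S : Sol m lo hi d) (X : SolX lo hi d fxt gxt) {t : Rl}
    (ht : t ∈ Irl) (hP : PMC rdd)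
    (db : forall x, HasDerivAt k (kf x) x) (dj : forall x, HasDerivAt kf (kg x) x)
    (dk : forall x, HasDerivAt kg (kh x) x) (cs : Continuous kh) (A B : Rl) :
    ∫ x in A..B, k x * xp * d.pt fxt gxt t x =
      (∫ x in A..B, momR m d k kf kg kh t x) + (momJ m d k kf kg t B - momJ m d k kf kg t A) := by
  have cj : Continuous k := cic.2 fun x => (db x).continuousAt
  have cn : Continuous kf := cic.2 fun x => (dj x).continuousAt
  have co : Continuous kg := cic.2 fun x => (dk x).continuousAt
  set r' : RR := fun x => 2 * (fd * fdx + gd * gdx) with hr'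
  have cR := mcz S ht hP cj cn co cs
  have cP := cts _ (pcq S X) ht
  set J : RR := momJ m d k kf kg t with hJ
  have dJ : forall x, HasDerivAt J (k x * xp * d.pt fxt gxt t x -
      momR m d k kf kg kh t x) x := by
    intro x
    have af := ((db x).mul (bt x)).mul (((S.dfx t ht x).mul (X.dgtx t ht x)).sub
      ((S.dgx t ht x).mul (X.dftx t ht x)))
    have dr : HasDerivAt r' (2 * ((fdx * fdx + fd * d.fxx t x) + (gdx * gdx + gd * d.gxx t x))) x := (((S.dfx t ht x).mul (S.dfxx t ht x)).add ((S.dgx t ht x).mul (S.dgxx t ht x))).const_mul 2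
    have ag := (((dj x).add ((db x).const_mul 2)).const_mul hlf).mul dr
    have rd := rdq S ht x
    have ah := (((dk x).add ((dj x).const_mul 2)).const_mul hlf).mul rd
    have ai := (db x).mul (((S.dfxx t ht x).pow 2).add ((S.dgxx t ht x).pow 2))
    have aj := ((db x).mul (((bt x).mul (vdz hP rd)).const_add (m ^ 2))).mul rd
    have ak := (((db x).const_mul hlf).mul (bt x)).mul (rd.pow 2)
    refine (((((af.sub ag).add ah).sub ai).add aj).add ak).congr_deriv ?_
    have qb := S.bp t ht x
    have qc := S.bq t ht x
    have ee : xp * en = 1 := by rw [<- xad]; simp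
    simp only [Dat.W] at qb qc
    simp only [Pi.mul_apply, paaz, Pi.pow_apply, Pi.sub_apply, momR, Dat.pt, Dat.v, Dat.M, hr']
    simp only [Dat.r, rr] at *
    simp only [Nat.add_one_sub_one, pow_one, Nat.cast_ofNat]
    set Mx := Mm (fun x => fd ^ 2 + gd ^ 2) x with hMx
    have eM : Mm rdd x = Mx := rfl
    have eV : Vv m rdd x = Vv m (fun x => fd ^ 2 + gd ^ 2) x := rfl
    simp only [eM, eV] at *
    linear_combination ((kf x + 2 * k x) * fd + 2 * k x * fdx) * qc - ((kf x + 2 * k x) * gd + 2 * k x * gdx) * qb + 2 * k x * (2 * m * Mx - Mx ^ 2) * (fd ^ 2 + gd ^ 2) * ee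
  have h := ftc (a := A) (b := B) (fun x _ => dJ x)
    ((by fun_prop : Continuous fun x => k x * xp * d.pt fxt gxt t x - momR m d k kf kg kh t x).intervalIntegrable _ _)
  rw [isb ((by fun_prop : Continuous fun x => k x * xp * d.pt fxt gxt t x).intervalIntegrable _ _) (cR.intervalIntegrable _ _)] at h
  linarith
lemma mizz (S : Sol m lo hi d) (X : SolX lo hi d fxt gxt) {A B : Rl} {t : Rl}
    (ht : t ∈ Irl) (hP : PMC rdd)
    (db : forall x, HasDerivAt k (kf x) x) (dj : forall x, HasDerivAt kf (kg x) x)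
    (dk : forall x, HasDerivAt kg (kh x) x) (cs : Continuous kh)
    (eA : k A = 0 ∧ kf A = 0 ∧ kg A = 0) (eB : k B = 0 ∧ kf B = 0 ∧ kg B = 0) :
    ∫ x in A..B, k x * xp * d.pt fxt gxt t x =
      ∫ x in A..B, momR m d k kf kg kh t x := by
  simp [miqz S X ht hP db dj dk cs A B, momJ, eA.1, eA.2.1, eA.2.2, eB.1, eB.2.1, eB.2.2]
end mom
def ar (n : ℕ) (x : Rl) : Rl := (-8 * xna ^ 3 + 48 * (x / n) ^ 2 * xna ^ 2) / n ^ 2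
def au (n : ℕ) (x : Rl) : Rl := (144 * (x / n) * xna ^ 2 - 192 * (x / n) ^ 3 * xna) / n ^ 3
lemma cdz (n : ℕ) x : HasDerivAt (aq n) (ar n x) x := by
  unfold aq ar
  have hj : HasDerivAt (fun x : Rl => x / n) (1 / n) x := (hid x).div_const (n : Rl)
  have h := (hj.fun_pow 2).const_sub 1
  refine (((hj.const_mul (-8)).div_const (n : Rl)).mul (h.fun_pow 3)).congr_deriv ?_
  push_cast
  simp only [div_eq_mul_inv]
  ring
lemma cdq (n : ℕ) x : HasDerivAt (ar n) (au n x) x := by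
  unfold ar au
  have hj : HasDerivAt (fun x : Rl => x / n) (1 / n) x := (hid x).div_const (n : Rl)
  have h := (hj.fun_pow 2).const_sub 1
  refine ((((h.fun_pow 3).const_mul (-8)).add (((hj.fun_pow 2).const_mul 48).mul
    (h.fun_pow 2))).div_const ((n : Rl) ^ 2)).congr_deriv ?_
  push_cast
  simp only [div_eq_mul_inv]
  ring
lemma ccq (n : ℕ) : Continuous (au n) := by unfold au; fun_prop
lemma cez (n : ℕ) (hn : 1 <= n) : (aq n (-n) = 0 ∧ ar n (-n) = 0) ∧
    aq n n = 0 ∧ ar n n = 0 := by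
  have : (n : Rl) ≠ 0 := po
  unfold aq ar
  simp [this, neg_div]
lemma cbq (n : ℕ) (hn : 1 <= n) (x : Rl) (hx : |x| <= n) : |ar n x| <= 56 / n := by
  have h := (dsl hn hx).2
  have hn' : (1 : Rl) <= n := by exact_mod_cast hn
  unfold ar
  set z := (x / n) ^ 2
  have za : 0 <= z := sqn _
  have af : (1 - z) ^ 2 <= 1 := ploz li li
  have ag : (1 - z) ^ 3 <= 1 := ploz li li
  have ah : 0 <= (1 - z) ^ 3 := pow_nonneg li _
  have ai : z * (1 - z) ^ 2 <= 1 := mloq h (sqn _) af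
  have aj : 0 <= z * (1 - z) ^ 2 := mnn za (sqn _)
  rw [abs_div, abp (by positivity : (0:Rl) < (n:Rl) ^ 2)]
  have : |-8 * (1 - z) ^ 3 + 48 * z * (1 - z) ^ 2| <= 56 := aln
  exact div_le_div₀ nu this po (by nlinarith)
lemma cbw (n : ℕ) (hn : 1 <= n) (x : Rl) (hx : |x| <= n) : |au n x| <= 336 / n := by
  have h := (dsl hn hx).2
  have hn' : (1 : Rl) <= n := by exact_mod_cast hn
  unfold au
  set y := x / n
  have yd : |y| <= 1 := by rw [<- sq_le_one_iff_abs_le_one]; exact h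
  have za : 0 <= y ^ 2 := sqn _
  have af : (1 - y ^ 2) ^ 2 <= 1 := ploz li li
  have ai : |y * (1 - y ^ 2) ^ 2| <= 1 := by
    rw [amz, abn (by positivity : 0 <= (1 - y ^ 2) ^ 2)]
    exact mloq yd (sqn _) af
  have aj : |y ^ 3 * (1 - y ^ 2)| <= 1 := by
    rw [amz, abs_pow, abn (by linarith : 0 <= 1 - y ^ 2)]
    exact mloq (ploz (abnn _) yd) li li
  rw [abs_div, abp (by positivity : (0:Rl) < (n:Rl) ^ 3)]
  have : |144 * y * (1 - y ^ 2) ^ 2 - 192 * y ^ 3 * (1 - y ^ 2)| <= 336 := by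
    rw [alz] at *; constructor <;> linarith [ai.1, ai.2, aj.1, aj.2]
  exact div_le_div₀ nu this po (by nlinarith [sqn (n:Rl), mnn (sub_nonneg.2 hn') (sqn (n:Rl))])

def wsq (m : Rl) (f g f' g' : RR) (x : Rl) : Rl := (f' x - mx * f x) ^ 2 + (g' x - mx * g x) ^ 2
lemma Prof.M_mono {m C : Rl} {r : RR} (h : PMC r) : Monotone (Mm r) := mohz h.M_deriv fun x => mnn nu (h.qnn x)
def cB (m e : Rl) : Rl := 2 * mo + e / 2
def KB (m e xa : Rl) : Rl := 2 * e + 2 * (2 * mo) ^ 2 * (2 * (2 * exp (-(2 * xa)) * (mo + cB m e * exp xa)) + 4 * e + 4 * mo * exp (-(2 * xa)))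
namespace ProfH
variable {m C : Rl} {f g f' g' : RR}
lemma w_cont (h : PH) : Continuous (wsq m f g f' g') := by
  have := h.am; have := h.ao; have := h.cf; have := h.cg; have := h.prof.M_cont
  unfold wsq; fun_prop
lemma w_HI (h : PH) : HI (wsq m f g f' g') (eF m f g f' g') := ⟨h.bogo.1, rfl⟩
lemma w_nn x : 0 <= wsq m f g f' g' x := by unfold wsq; positivity
lemma e_nn : 0 <= eF m f g f' g' := inz fun x => po
lemma av (h : PH) x :
    |1 / 2 * (rfg x * xp) - (2 * mo * Mm rfg x - Mm rfg x ^ 2)| <=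
      cB m (eF m f g f' g') * exp x := by
  set G : RR := fun x => 1 / 2 * (rfg x * xp) -
    (2 * mo * Mm rfg x - Mm rfg x ^ 2) with hG
  set G' : RR := fun x => xp * (f x * (f' x - mx * f x) +
    g x * (g' x - mx * g x)) with hG'
  have dG : forall x, HasDerivAt G (G' x) x := by
    intro x
    refine ((((h.rd x).mul (bt x)).const_mul hlf).sub
      (((h.prof.M_deriv x).const_mul (2 * mo)).sub ((h.prof.M_deriv x).fun_pow 2))).congr_deriv ?_
    simp only [hG', rr]; push_cast; ring
  have iq : Integrable (fun x => rfg x * xp + wsq m f g f' g' x) := h.prof.int.add h.w_HI.1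
  have cq : Continuous (fun x => rfg x * xp + wsq m f g f' g' x) := h.prof.qcont.add h.w_cont
  set N : RR := fun x => ∫ s in Iic x, (rfg s * exp (2 * s) + wsq m f g f' g' s) with hN
  have dN := ihz iq cq
  have Nnn : forall x, 0 <= N x := fun x => inz fun s => add_nonneg (h.prof.qnn s) (w_nn s)
  have Nle : N x <= 4 * mo + eF m f g f' g' := by
    have := sli (s := Iic x) iq
      (evf fun s => add_nonneg (h.prof.qnn s) (w_nn s))
    rw [iaz h.prof.int h.w_HI.1, h.prof.mass, h.w_HI.2] at this
    exact this
  have bd : forall x, |G' x| <= exp x * (1 / 2 * (rfg x * xp + wsq m f g f' g' x)) := by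
    intro x
    have e : xp = exp x ^ 2 := by rw [<- xnm]; norm_num
    simp only [hG', wsq, rr, e]
    set E := exp x
    have hE : 0 < E := xpp x
    generalize f' x - mx * f x = a
    generalize g' x - mx * g x = b
    have ei : E ^ 2 * (f x * a + g x * b) = E * (E * (f x * a + g x * b)) := by ring
    rw [ei, amz, abp hE]
    refine mll ?_ hE.le
    rw [alz]; constructor <;> nlinarith [sqn (E * f x - a), sqn (E * g x - b), sqn (E * f x + a), sqn (E * g x + b)]
  have dE : forall x, HasDerivAt (fun x => 1 / 2 * (exp x * N x))
      (1 / 2 * (exp x * N x + exp x * (rfg x * xp + wsq m f g f' g' x))) x := fun x => (((hasDerivAt_exp x).mul (dN x)).const_mul hlf)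
  have lE : Tendsto (fun x => 1 / 2 * (exp x * N x)) atBot (𝓝 0) := by
    have := ((rtez).mul (fbz iq)).const_mul hlf
    simpa only [mzz] using this
  have lq : Tendsto (fun x => rfg x * xp) atBot (𝓝 0) := by
    have t : Tendsto (fun x : Rl => 2 * x) atBot atBot := tiz.const_mul_atBot nu
    simpa using h.r_lim.1.mul (rtez.comp t)
  have lG : Tendsto G atBot (𝓝 0) := by
    simpa using (lq.const_mul hlf).sub ((h.prof.M_bot.const_mul (2 * mo)).sub
      (h.prof.M_bot.pow 2))
  have mf : Monotone (fun x => 1 / 2 * (exp x * N x) - G x) := by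
    refine mohz (fun x => (dE x).sub (dG x)) fun x => ?_
    have := (alz.1 (bd x)).2
    have := mnn (xpp x).le (Nnn x)
    simp only [Pi.zero_apply]; linarith
  have mg : Monotone (fun x => 1 / 2 * (exp x * N x) + G x) := by
    refine mohz (fun x => (dE x).add (dG x)) fun x => ?_
    have := (alz.1 (bd x)).1
    have := mnn (xpp x).le (Nnn x)
    simp only [Pi.zero_apply]; linarith
  have kf := mf.le_of_tendsto (by simpa using lE.sub lG) x
  have kg := mg.le_of_tendsto (by simpa using lE.add lG) x
  have kh := mll Nle (xpp x).le
  simp only [hG] at kf kg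
  unfold cB
  rw [alz]; constructor <;> linarith
lemma aw (h : PH) {xa : Rl} (hx : Mm rfg xa < 1 / 2) :
    ∫ x, fgp <= KB m (eF m f g f' g') xa := by
  set e := eF m f g f' g' with he
  have eh : 0 <= e := e_nn
  have hm := h.prof.hm
  have rd := integral_Iic_of_hasDerivAt_of_tendsto' (a := xa) (fun y _ => h.rd y)
    h.rd_int.integrableOn h.r_lim.1
  have bf : ∫ x in Iic xa, (1 / 2 * rfg x - 2 * wsq m f g f' g' x) <=
      ∫ x in Iic xa, 2 * fgx := by
    refine smoz ((h.prof.r_int.const_mul _).sub (h.w_HI.1.const_mul _)).integrableOn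
      h.rd_int.integrableOn miz fun x hx' => ?_
    have hM : Mm rfg x < 1 / 2 := (h.prof.M_mono hx').trans_lt hx
    simp only [rr, wsq]
    obtain ⟨a, ha⟩ : ∃ a, a = f' x - mx * f x := ⟨_, rfl⟩
    obtain ⟨b, hb⟩ : ∃ a, a = g' x - mx * g x := ⟨_, rfl⟩
    have ha' : f' x = a + mx * f x := by rw [ha]; ring
    have hb' : g' x = b + mx * g x := by rw [hb]; ring
    change _ * (f x ^ 2 + g x ^ 2) - 2 * ((f' x - mx * f x) ^ 2 + (g' x - mx * g x) ^ 2) <= _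
    rw [<- ha, <- hb, ha', hb']
    have : 0 <= (m - Mm rfg x - 1 / 2) := li
    nlinarith [mnn this (sqn (f x)), mnn this (sqn (g x)), sqn (f x + 2 * a), sqn (g x + 2 * b)]
  rw [integral_sub (h.prof.r_int.const_mul _).integrableOn (h.w_HI.1.const_mul _).integrableOn, ntcm, ntcm, rd, sub_zero] at bf
  have bg : ∫ x in Iic xa, wsq m f g f' g' x <= e := (sli h.w_HI.1 (evf w_nn))
  have bh : ∫ x in Ioi xa, rfg x <= 4 * mo * exp (-(2 * xa)) := by
    have i := h.prof.int.mul_const (exp (-(2 * xa)))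
    have := smoz h.prof.r_int.integrableOn i.integrableOn miq
      (s := Ioi xa) (fun x hx' => by
        show rfg x <= _
        rw [maz, <- xad]
        have : xa < x := hx'
        have := one_le_exp (by linarith : 0 <= 2 * x + -(2 * xa))
        nlinarith [h.prof.nn x])
    refine this.trans ?_
    have := sli (s := Ioi xa) i
      (evf fun s => mnn (h.prof.qnn s) (xpp _).le)
    refine this.trans (loez ?_)
    rw [integral_mul_const, h.prof.mass]
  have bi : rfg xa <= 2 * exp (-(2 * xa)) * (mo + cB m e * exp xa) := by
    have c := (alz.1 (h.av xa)).2
    have ma := h.prof.M_nn xa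
    have ei : exp (2 * xa) * exp (-(2 * xa)) = 1 := by rw [<- xad]; simp
    have c' : rfg xa * exp (2 * xa) <= 2 * (mo + cB m e * exp xa) := by
      nlinarith [sqn (Mm rfg xa)]
    have := mlr c' (xpp (-(2 * xa))).le
    rw [maz, ei] at this
    linarith
  have bj : ∫ x, rfg x = (∫ x in Iic xa, rfg x) + ∫ x in Ioi xa, rfg x := by
    rw [<- setIntegral_union (Iic_disjoint_Ioi lrz) miq h.prof.r_int.integrableOn
      h.prof.r_int.integrableOn, Iic_union_Ioi, setIntegral_univ]
  have bk := (hio h.int').le ((h.w_HI.mul 2).add ((hio h.prof.r_int).mul (2 * (2 * mo) ^ 2)))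
    (fun x => by
      have ma := h.prof.M_nn x
      have mc := h.prof.M_le x
      have ei : mx ^ 2 <= (2 * mo) ^ 2 := by
        apply slsz; all_goals linarith
      simp only [wsq]
      have k : forall a b c, (a:Rl) ^ 2 <= 2 * (a - c * b) ^ 2 + 2 * (c ^ 2 * b ^ 2) := fun a b c => by
        nlinarith [sqn (a - 2 * (c * b))]
      have kf := k (f' x) (f x) mx
      have kg := k (g' x) (g x) mx
      have kh := mlr ei (sqn (f x))
      have ki := mlr ei (sqn (g x))
      have er : rfg x = f x ^ 2 + g x ^ 2 := rfl
      rw [er]; linarith)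
  unfold KB
  have : (∫ x, rfg x) <= (2 * (2 * exp (-(2 * xa)) * (mo + cB m e * exp xa)) + 4 * e + 4 * mo * exp (-(2 * xa))) := li
  have := mll this (by positivity : 0 <= 2 * (2 * mo) ^ 2)
  linarith
lemma ax (h : PH) {xa Y : Rl} (hx : 1 / 2 <= Mm rfg xa) (hY : xa <= Y) :
    2 * mo - Mm rfg Y <= 2 * mo * exp ((xa - Y) / 2) +
      cB m (eF m f g f' g') * exp Y := by
  set c := cB m (eF m f g f' g') with hc
  have eh : 0 <= eF m f g f' g' := e_nn
  have hm := h.prof.hm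
  have cj : 0 <= c := by rw [hc]; unfold cB; positivity
  have dh : ∀ x : Rl, HasDerivAt (fun x : Rl => exp (x / 2)) (exp (x / 2) * hlf) x := fun x => ((hid x).div_const 2).exp
  have d : forall x, HasDerivAt (fun x => (2 * mo - Mm rfg x) * exp (x / 2) - c * (exp x * exp (x / 2))) (-(1 / 2 * (rfg x * xp)) * exp (x / 2) + (2 * mo - Mm rfg x) * (exp (x / 2) * hlf) - c * (exp x * exp (x / 2) + exp x * (exp (x / 2) * hlf))) x := fun x => (((h.prof.M_deriv x).const_sub _).mul (dh x)).sub (((hasDerivAt_exp x).mul (dh x)).const_mul c)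
  have an : AntitoneOn (fun x => (2 * mo - Mm rfg x) * exp (x / 2) -
      c * (exp x * exp (x / 2))) (Ici xa) := by
    refine antitoneOn_of_hasDerivWithinAt_nonpos (convex_Ici xa)
      (fun x _ => (d x).continuousAt.continuousWithinAt) (fun x _ => (d x).hasDerivWithinAt) fun x hx' => ?_
    rw [interior_Ici] at hx'
    have hM : 1 / 2 <= Mm rfg x := hx.trans (h.prof.M_mono (le_of_lt hx'))
    have mc := h.prof.M_le x
    have k := (alz.1 (h.av x)).1
    have E := xpp (x / 2)
    have eg := xpp x
    have kg : -(1 / 2 * (rfg x * xp)) + (2 * mo - Mm rfg x) * hlf -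
      c * exp x <= 0 := by nlinarith
    have kh := mnn (mnn cj eg.le) E.le
    have ki := mul_nonpos_of_nonpos_of_nonneg kg E.le
    linarith
  have k := an self_mem_Ici hY hY
  have ma := h.prof.M_nn xa
  have ei : exp ((xa - Y) / 2) = exp (xa / 2) * exp (-(Y / 2)) := by
    rw [<- xad]; ring_nf
  have ej : exp (Y / 2) * exp (-(Y / 2)) = 1 := by rw [<- xad]; simp
  have ke := mnn cj (mul_pos (xpp xa) (xpp (xa / 2))).le
  have kf := mnn ma (xpp (xa / 2)).le
  simp only at k
  have k' : (2 * mo - Mm rfg Y) * exp (Y / 2) <= 2 * mo * exp (xa / 2) + c * (exp Y * exp (Y / 2)) := li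
  have kg := mlr k' (xpp (-(Y / 2))).le
  have et : (2 * mo - Mm rfg Y) * exp (Y / 2) * exp (-(Y / 2)) =
    2 * mo - Mm rfg Y := by rw [maz, ej, mul_one]
  have eu : (2 * mo * exp (xa / 2) + c * (exp Y * exp (Y / 2))) * exp (-(Y / 2))
    = 2 * mo * (exp (xa / 2) * exp (-(Y / 2))) + c * exp Y := by
    linear_combination c * exp Y * ej
  rw [et, eu] at kg
  rw [ei]; exact kg
end ProfH
lemma conc {m : Rl} (e : Rl) {δ : Rl} (hδ : 0 < δ) (X : Rl) : ∃ K : Rl, ∀ C f g f' g', PH -> eF m f g f' g' = e -> K < ∫ x, fgp ->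
    2 * mo - Mm rfg X <= δ := by
  have ld : Tendsto (fun Y : Rl => cB m e * exp Y) atBot (𝓝 0) := by
    simpa using rtez.const_mul (cB m e)
  obtain ⟨Y, hY, hYX⟩ := ((ld.eventually (gmnz (hpz hδ))).and (eventually_le_atBot X)).exists
  have lf : Tendsto (fun xa : Rl => 2 * mo * exp ((xa - Y) / 2)) atBot (𝓝 0) := by
    have : Tendsto (fun xa : Rl => (xa - Y) / 2) atBot atBot := (taaz _ (-Y) tiz).atBot_div_const nu
    simpa using (rtez.comp this).const_mul (2 * mo)
  obtain ⟨xa, gr, hxY⟩ := ((lf.eventually (gmnz (hpz hδ))).and (eventually_le_atBot Y)).exists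
  refine ⟨KB m e xa, fun C f g f' g' h he hK => ?_⟩
  have hM : 1 / 2 <= Mm rfg xa := by
    by_contra hc
    have := h.aw (not_le.1 hc)
    rw [he] at this; linarith
  have k := h.ax hM hxY
  rw [he] at k
  have := h.prof.M_mono hYX
  linarith

structure Bl (m lo : Rl) (d : Dat) (fxt gxt : Rl -> RR) : Prop where
  lk : lo < 0
  S : Sol m lo 0 d
  X : SolX lo 0 d fxt gxt
  H : forall a b, lo < a -> b < 0 -> ∃ C, ∀ t ∈ Ioo a b, PHd
  bl : ∀ K : Rl, ∃ ta < 0, ∀ t ∈ Ioo ta 0, K < ∫ x, d.v t x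
def Dat.e (d : Dat) (m t : Rl) : Rl := eF m (d.f t) (d.g t) (d.fx t) (d.gx t)
def Dat.w (d : Dat) (m t x : Rl) : Rl := wsq m (d.f t) (d.g t) (d.fx t) (d.gx t) x
namespace Bl
variable {m lo : Rl} {d : Dat} {fxt gxt : Rl -> RR}
lemma Ht (B : Bl m lo d fxt gxt) {t} (ht : t ∈ Ioo lo 0) :
    ∃ C, PHd := by
  obtain ⟨C, h⟩ := B.H ((lo + t) / 2) (t / 2) hta htb
  exact ⟨C, h t ⟨hta, htb⟩⟩
lemma SH (B : Bl m lo d fxt gxt) {a b : Rl} (ha : lo < a) (hb : b < 0) : ∃ C, SolH m a b C d := by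
  obtain ⟨C, h⟩ := B.H a b ha hb
  exact ⟨C, { toSol := B.S.mono ha.le hb.le, H := h }⟩
lemma e_const (B : Bl m lo d fxt gxt) {s t : Rl} (hs : s ∈ Ioo lo 0) (ht : t ∈ Ioo lo 0) :
    d.e m s = dem := by
  wlog h : s <= t generalizing s t
  · exact (this ht hs (not_le.1 h).le).symm
  obtain ⟨C, S⟩ := B.SH (a := (lo + s) / 2) (b := t / 2) (by linarith [hs.1]) htb
  exact ecz S ⟨by linarith [hs.1], htb⟩ ⟨by linarith [hs.1], htb⟩ h
lemma conc' (B : Bl m lo d fxt gxt) {δ : Rl} (hδ : 0 < δ) (X : Rl) : ∃ ta ∈ Ioo lo 0,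
    ∀ t ∈ Ioo ta 0, 2 * mo - d.M t X <= δ := by
  have hl := B.lk
  have bu : lo / 2 ∈ Ioo lo 0 := ⟨li, li⟩
  obtain ⟨K, hK⟩ := conc (m := m) (d.e m (lo / 2)) hδ X
  obtain ⟨ta, hj, hb⟩ := B.bl K
  refine ⟨max ta (lo / 2), ⟨lt_max_of_lt_right bu.1, max_lt hj bu.2⟩, fun t ht => ?_⟩
  have bx := le_max_left ta (lo / 2)
  have bz := le_max_right ta (lo / 2)
  have ht' : t ∈ Ioo lo 0 := ⟨hta, ht.2⟩
  obtain ⟨C, hp⟩ := B.Ht ht'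
  exact hK C _ _ _ _ hp (B.e_const ht' bu) (hb t ⟨hta, ht.2⟩)
end Bl
lemma pwz {m : Rl} {d : Dat} {t x s c : Rl} (hc : 0 < c) :
    |s * (xp * d.p t x)| <= 1 / 2 * (c * (s ^ 2 * (xp * (drx * xp)))
      + (1 / c) * d.w m t x) := by
  simp only [Dat.p, Dat.r, Dat.w, wsq, rr]
  set k := m - Mm (fun x => fd ^ 2 + gd ^ 2) x with hk
  have ek : m - Mm rdd x = k := rfl
  simp only [ek]
  obtain ⟨a, ha⟩ : ∃ a, a = fdx - k * fd := ⟨_, rfl⟩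
  obtain ⟨b, hb⟩ : ∃ b, b = gdx - k * gd := ⟨_, rfl⟩
  have ei : fd * gdx - gd * fdx = fd * b - gd * a := by
    rw [ha, hb]; ring
  rw [ei, <- ha, <- hb]
  generalize xp = E
  generalize fd = F
  generalize gd = G
  have q : ∀ u v : Rl, |u * v| <= 1 / 2 * (c * u ^ 2 + 1 / c * v ^ 2) := by
    intro u v
    have pd : 1 / 2 * (c * u ^ 2 + 1 / c * v ^ 2) - u * v = (c * u - v) ^ 2 / (2 * c) := by
      field_simp; ring
    have pe : 1 / 2 * (c * u ^ 2 + 1 / c * v ^ 2) + u * v = (c * u + v) ^ 2 / (2 * c) := by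
      field_simp; ring
    have hv : 0 <= (c * u - v) ^ 2 / (2 * c) := po
    have bu : 0 <= (c * u + v) ^ 2 / (2 * c) := po
    rw [alz]; constructor <;> linarith
  have qb := alz.1 (q (s * E * F) b)
  have qc := alz.1 (q (s * E * G) a)
  rw [alz]; constructor <;> nlinarith [qb.1, qb.2, qc.1, qc.2]
def Vn (d : Dat) (n : ℕ) (t : Rl) : Rl := Jx chi n x * xp * (drx * xp)
section vir
variable {m lo hi C : Rl} {d : Dat} {fxt gxt : Rl -> RR}
lemma rcq (S : Sol m lo hi d) : JC lo hi d.r := by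
  have := S.cf; have := S.cg
  unfold JC Dat.r rr at *; fun_prop
lemma vdq (S : Sol m lo hi d) {t} (ht : t ∈ Irl) {n : ℕ} (hn : 1 <= n) :
    HasDerivAt (Vn d n) (Jx 2 * ((aq n x + 2 * chi n x) *
      (xp * d.p t x))) t := by
  have cn := rcq S
  have co : JC lo hi (fun t x => 2 * (fd * d.ft t x + gd * d.gt t x)) := by
    have := S.cf; have := S.cg; have := S.cft; have := S.cgt
    unfold JC at *; fun_prop
  have cs := cct n
  have ct := ccz n
  have h := dui (c := -(n : Rl)) (d := n)
    (fun t x => chi n x * xp * (drx * xp))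
    (fun t x => chi n x * xp * ((2 * (fd * d.ft t x + gd * d.gt t x)) * xp))
    jcf jcf (fun t ht x => by
      refine HasDerivAt.const_mul _ (HasDerivAt.mul_const ?_ _)
      refine (((S.dft t ht x).fun_pow 2).add ((S.dgt t ht x).fun_pow 2)).congr_deriv ?_
      push_cast; ring) ht
  refine h.congr_deriv ?_
  set J : RR := fun x => -2 * (chi n x * (xp * d.p t x)) with hJ
  have sd := cts _ S.cf ht
  have se := cts _ S.cg ht
  have sh := cts _ S.cft ht
  have si := cts _ S.cgt ht
  have sj := cts _ (pcz S) ht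
  have dJ : forall x, HasDerivAt J (chi n x * xp * ((2 * (fd * d.ft t x + gd * d.gt t x)) * xp) - 2 * ((aq n x + 2 * chi n x) *
      (xp * d.p t x))) x := by
    intro x
    have dp : HasDerivAt (d.p t) (fd * d.gxx t x - gd * d.fxx t x) x := by
      refine (((S.dfx t ht x).mul (S.dgxx t ht x)).sub ((S.dgx t ht x).mul (S.dfxx t ht x))).congr_deriv ?_
      ring
    refine (((cdw n x).mul ((bt x).fun_mul dp)).const_mul (-2)).congr_deriv ?_
    linear_combination -2 * chi n x * xp * (fd * S.bp t ht x + gd * S.bq t ht x)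
  have := ftc (a := -(n:Rl)) (b := n) (fun x _ => dJ x)
    (ciz fp _ _)
  rw [isb (ciz fp _ _)
    (ciz fp _ _)] at this
  obtain ⟨ei, ej⟩ := ceq n hn
  have zb : J n = 0 := by simp [hJ, ei]
  have zd : J (-n) = 0 := by simp [hJ, ej]
  rw [zb, zd] at this
  linarith
lemma vnz {t : Rl} (hr : forall x, 0 <= drx) {n : ℕ} (hn : 1 <= n) : 0 <= Vn d n t := by
  refine iinz cnn fun x hx => ?_
  have := (cbd hn (alz.2 hx)).1
  have := hr x
  positivity
lemma vdbz {t : Rl} (h : PHd) {n : ℕ} (hn : 1 <= n)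
    {c : Rl} (hc : 0 < c) :
    |Jx 2 * ((aq n x + 2 * chi n x) * (xp * d.p t x))| <=
      (2 + 8 / n) * (c * Vn d n t + 1 / c * dem) := by
  have gj : -(n : Rl) <= n := cnn
  have cn := cct n
  have rc : Continuous (d.r t) := h.prof.cont
  have wc : Continuous (d.w m t) := h.w_cont
  have hA : (0:Rl) <= 2 + 8 / n := po
  have hv : ‖Jx 2 * ((aq n x + 2 * chi n x) * (xp * d.p t x))‖ <= Jx (2 + 8 / n) * (c * (chi n x * xp * (drx * xp))
        + 1 / c * d.w m t x) := by
    refine inl gj (evf fun x hx => ?_)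
      (ciz fp _ _)
    have hx' : |x| <= n := alz.2 ⟨hx.1.le, hx.2⟩
    obtain ⟨yd, ye⟩ := dsl hn hx'
    set s := xna ^ 2 with hs
    have sb : 0 <= s := sqn _
    have es : chi n x = s ^ 2 := by rw [hs, chi]; ring
    have za := sqn (x / n)
    have sd : s <= 1 := ploz li li
    have bf : |aq n x + 2 * chi n x| <= (2 + 8 / n) * s := by
      have : |aq n x| <= 8 / n * s := by
        have e : aq n x = (-8 * (x / n) / n) * (xna * s) := by rw [aq, hs]; ring
        rw [e, amz]
        have nb : (0:Rl) < n := po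
        have : |-8 * (x / n) / (n:Rl)| <= 8 / n := by
          rw [abs_div, amz, abp nb]; gcongr; norm_num; linarith
        refine mlmz this ?_ (abnn _) po
        rw [abn (mnn li sb)]
        nlinarith
      refine (aalz _ _).trans ?_
      rw [es, abn (by positivity : 0 <= 2 * s ^ 2)]
      nlinarith
    have k := pwz (m := m) (d := d) (t := t) (x := x) (s := s) hc
    rw [amz, abn sb] at k
    rw [rnez, amz, abs_two, amz, es]
    rw [es] at bf
    have kg := mlr bf (abnn (xp * d.p t x))
    have kh := mll k hA
    linarith
  refine hv.trans ?_
  rw [icm, iad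
    (ciz fp _ _) (ciz fp _ _), icm, icm]
  refine mll (add_le_add lrz (mll ?_ po)) hA
  rw [iol gj]
  exact sli h.w_HI.1 (evf fun x => ProfH.w_nn x)
lemma vsz {t : Rl} (h : PMC rdd) {n : ℕ} (hn : 1 <= n) (X : Rl) :
    Vn d n t <= exp (2 * X) * (4 * mo) + exp (2 * n) * (2 * (2 * mo - d.M t X)) := by
  have gj : -(n : Rl) <= n := cnn
  have cn := cct n
  have rc : Continuous (d.r t) := h.cont
  have ia : Integrable (fun x => drx * xp) := h.int
  have ib := ia.const_mul (exp (2 * X))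
  have ic := ((ia.indicator (miq (a := X)))).const_mul (exp (2 * n))
  have qn : forall x, 0 <= drx * xp := h.qnn
  have nn : forall x, 0 <= exp (2 * X) * (drx * xp) + exp (2 * n) *
      (Ioi X).indicator (fun x => drx * xp) x := fun x => by
    have := qn x
    have : 0 <= (Ioi X).indicator (fun x => drx * xp) x := indicator_nonneg (fun x _ => qn x) x
    positivity
  have k := calz (n := n) (h := fun x => chi n x * xp * (drx * xp))
    ((hio ib).add (hio ic)) nn fun x hx => by
      have y := cbd hn hx
      have q := qn x
      rw [abn (mnn (mnn y.1 (xpp _).le) q)]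
      have yf : chi n x * xp <= xp := mloz (xpp _).le y.2
      by_cases hX : X < x
      · rw [indicator_of_mem (show x ∈ Ioi X from hX)]
        have : xp <= exp (2 * n) := relz.2 (by linarith [(alz.1 hx).2])
        nlinarith [xpp (2 * X), mnn (xpp (2 * X)).le q]
      · rw [indicator_of_notMem (show x ∉ Ioi X from hX)]
        have : xp <= exp (2 * X) := relz.2 li
        nlinarith
  refine (lasz _).trans (k.trans (loez ?_))
  rw [ntcm, ntcm, integral_indicator miq]
  have ei : ∫ x, drx * xp = 4 * mo := h.mass
  have ej : d.M t X = 1 / 2 * ∫ x in Iic X, drx * xp := rfl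
  have et : (∫ x in Iic X, drx * xp) + ∫ x in Ioi X, drx * xp =
      4 * mo := by
    rw [<- setIntegral_union (Iic_disjoint_Ioi lrz) miq ia.integrableOn
      ia.integrableOn, Iic_union_Ioi, setIntegral_univ, ei]
  rw [ei, ej]; congr 2; linarith
end vir
namespace Bl
variable {m lo : Rl} {d : Dat} {fxt gxt : Rl -> RR}
lemma Vn_le (B : Bl m lo d fxt gxt) {t} (ht : t ∈ Ioo lo 0) {n : ℕ} (hn : 1 <= n) :
    Vn d n t <= (2 + 8 / n) ^ 2 * dem * t ^ 2 := by
  set A : Rl := 2 + 8 / n with hA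
  have ab : 0 <= A := po
  have eh : 0 <= dem := ProfH.e_nn
  have key : ∀ η > 0, sqrt (Vn d n t + η) <= sqrt (2 * η) + A * sqrt (dem + η) * |t| := by
    intro η hη
    have ld : Tendsto (fun X : Rl => exp (2 * X) * (4 * mo)) atBot (𝓝 0) := by
      have : Tendsto (fun x : Rl => 2 * x) atBot atBot := tiz.const_mul_atBot nu
      simpa using (rtez.comp this).mul_const (4 * mo)
    obtain ⟨X, hX⟩ := (ld.eventually (gmnz (hpz hη))).exists
    obtain ⟨ta, hj, hc⟩ := B.conc' (δ := η / (4 * exp (2 * n))) po X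
    set s := max ta t / 2 with hs
    have mf := le_max_left ta t
    have mg := le_max_right ta t
    have mh : max ta t < 0 := max_lt hj.2 ht.2
    have hst : t <= s := by rw [hs]; linarith
    have gn : s ∈ Ioo lo 0 := ⟨hta, by rw [hs]; linarith⟩
    have hc' := hc s ⟨by rw [hs]; linarith, gn.2⟩
    obtain ⟨C, hp⟩ := B.Ht gn
    have vb := vsz (d := d) hp.prof hn X
    have vc : Vn d n s <= η := by
      have : exp (2 * n) * (2 * (2 * mo - d.M s X)) <= η / 2 := by
        calc _ <= exp (2 * n) * (2 * (η / (4 * exp (2 * n)))) := by gcongr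
          _ = η / 2 := by field_simp; ring
      linarith
    have nn : ∀ r ∈ Ioo lo 0, 0 <= Vn d n r := fun r hr => by
      obtain ⟨C, hp⟩ := B.Ht hr
      exact vnz hp.prof.nn hn
    have hsub : Icc t s ⊆ Ioo lo 0 := fun r hr => ⟨ht.1.trans_le hr.1, hr.2.trans_lt gn.2⟩
    have dd : ∀ r ∈ Icc t s, HasDerivWithinAt (fun r => sqrt (Vn d n r + η))
        ((Jx 2 * ((aq n x + 2 * chi n x) * (xp * d.p r x))) /
          (2 * sqrt (Vn d n r + η))) (Icc t s) r := fun r hr =>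
      (((vdq B.S (hsub hr) hn).add_const η).sqrt (by
        have := nn r (hsub hr); positivity)).hasDerivWithinAt
    have bb : ∀ r ∈ Icc t s, ‖(Jx 2 * ((aq n x + 2 * chi n x) * (xp * d.p r x))) / (2 * sqrt (Vn d n r + η))‖ <=
        A * sqrt (dem + η) := by
      intro r hr
      obtain ⟨C, hp⟩ := B.Ht (hsub hr)
      have va := nn r (hsub hr)
      set a := sqrt (Vn d n r + η) with ha
      set b := sqrt (dem + η) with hb
      have ad : 0 < a := Real.sqrt_pos.2 po
      have bc : 0 < b := Real.sqrt_pos.2 po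
      have ag : a ^ 2 = Vn d n r + η := sq_sqrt po
      have bg : b ^ 2 = dem + η := sq_sqrt po
      have k := vdbz hp hn (c := b / a) po
      rw [B.e_const (hsub hr) ht] at k
      rw [norm_div, rnez, Real.norm_of_nonneg po, div_le_iff₀ po]
      refine k.trans ?_
      have : b / a * Vn d n r + 1 / (b / a) * dem <= b * a + a * b := by
        have : Vn d n r <= a ^ 2 := li
        have : dem <= b ^ 2 := li
        calc _ <= b / a * a ^ 2 + 1 / (b / a) * b ^ 2 := by gcongr
          _ = _ := by field_simp
      calc _ <= A * (b * a + a * b) := mll this ab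
        _ = _ := by ring
    have := Convex.norm_image_sub_le_of_norm_hasDerivWithin_le dd bb (convex_Icc t s)
      (right_mem_Icc.2 hst) (left_mem_Icc.2 hst)
    rw [rnez, rnez] at this
    have tb := (lasz _).trans this
    have tc : |t - s| <= |t| := by
      rw [abs_of_nonpos li, abs_of_neg ht.2]; linarith [gn.2]
    have td : sqrt (Vn d n s + η) <= sqrt (2 * η) := Real.sqrt_le_sqrt li
    have te := mll tc (mnn ab (Real.sqrt_nonneg (dem + η)))
    linarith
  have ld : Tendsto (fun η : Rl => sqrt (Vn d n t + η)) (𝓝[>] 0) (𝓝 (sqrt (Vn d n t + 0))) := (Continuous.tendsto fp 0).mono_left nwn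
  have lf : Tendsto (fun η : Rl => sqrt (2 * η) + A * sqrt (dem + η) * |t|) (𝓝[>] 0)
      (𝓝 (sqrt (2 * 0) + A * sqrt (dem + 0) * |t|)) := (Continuous.tendsto fp 0).mono_left nwn
  have h := lotz ld lf (by filter_upwards [self_mem_nhdsWithin] with η hη using key η hη)
  simp only [add_zero, mzz, Real.sqrt_zero, zero_add] at h
  have bu := (Real.sqrt_le_iff.1 h).2
  refine bu.trans (loez ?_)
  rw [mul_pow, mul_pow, sq_sqrt eh, sq_abs]
lemma vir (B : Bl m lo d fxt gxt) {t} (ht : t ∈ Ioo lo 0) :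
    ∃ c ≤ 4 * dem * t ^ 2, HI (fun x => xp * (drx * xp)) c := by
  obtain ⟨C, hp⟩ := B.Ht ht
  have rc : Continuous (d.r t) := hp.prof.cont
  have nn : forall x, 0 <= xp * (drx * xp) := fun x => mnn (xpp _).le (hp.prof.qnn x)
  have bd : ∀ N : ℕ, ∫ x in (-(N : Rl))..N, xp * (drx * xp) <=
      4 * dem * t ^ 2 := by
    intro N
    have hN : -(N : Rl) <= N := by linarith [(ncnz N : (0:Rl) <= N)]
    have ld : Tendsto (fun n : ℕ => chi n N * ∫ x in (-(N : Rl))..N, xp * (drx * xp)) atTop (𝓝 (1 * ∫ x in (-(N : Rl))..N, xp * (drx * xp))) := (cte N).mul_const _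
    have lf : Tendsto (fun n : ℕ => (2 + 8 / (n:Rl)) ^ 2 * dem * t ^ 2) atTop
        (𝓝 ((2 + 0) ^ 2 * dem * t ^ 2)) := ((((tcn 8).const_add 2).pow 2).mul_const _).mul_const _
    have := lotz ld lf (by
      filter_upwards [egaz (N + 1)] with n hn
      have nc : 1 <= n := by omega
      have nN : (N : Rl) <= n := by exact_mod_cast (by omega : N <= n)
      refine ltz ?_ (B.Vn_le ht nc)
      have cn := cct n
      rw [<- icm]
      calc _ <= ∫ x in (-(N : Rl))..N, chi n x * xp * (drx * xp) := by
            refine imo hN (ciz fp _ _)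
              (ciz fp _ _) fun x hx => ?_
            rw [maz]
            refine mlr ?_ (nn x)
            have af := (dsl nc (x := (N:Rl)) (by rw [abn (ncnz N)]; exact nN)).2
            have ag : (x / n) ^ 2 <= ((N:Rl) / n) ^ 2 := by
              rw [div_pow, div_pow]; gcongr 1; exact slsz hx.1 hx.2
            unfold chi
            exact plpz li li 4
        _ <= _ := by
            rw [iol hN, Vn, iol li]
            refine setIntegral_mono_set (Continuous.integrableOn_Ioc fp) ?_
              (LE.le.eventuallyLE (Ioc_subset_Ioc li nN))
            filter_upwards [ae_restrict_mem miw] with x hx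
            have := (cbd nc (alz.2 ⟨hx.1.le, hx.2⟩)).1
            have := nn x
            simp only [Pi.zero_apply]
            rw [maz]; positivity)
    linarith
  have tt := tnaq (R := Rl)
  have ii : Integrable (fun x => xp * (drx * xp)) := integrable_of_intervalIntegral_norm_bounded (4 * dem * t ^ 2)
      (fun N : ℕ => Continuous.integrableOn_Ioc fp)
      (tnaz.comp tt) tt (evf fun N => by
        simp only [Function.comp]
        refine ltz (loez ?_) (bd N)
        congr 1; funext x; exact Real.norm_of_nonneg (nn x))
  refine ⟨_, ?_, hio ii⟩
  exact le_of_tendsto' (intervalIntegral_tendsto_integral ii (tnaz.comp tt) tt) bd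
end Bl

lemma ctq x : Tendsto (fun n : ℕ => ar n x) atTop (𝓝 0) := by
  refine squeeze_zero_norm' ?_ (tcn 56)
  obtain ⟨N, hN⟩ := exists_nat_ge |x|
  filter_upwards [egaz (N + 1)] with n hn
  exact cbq n (by omega) x (hN.trans (by exact_mod_cast (by omega : N <= n)))
lemma ctw x : Tendsto (fun n : ℕ => au n x) atTop (𝓝 0) := by
  refine squeeze_zero_norm' ?_ (tcn 336)
  obtain ⟨N, hN⟩ := exists_nat_ge |x|
  filter_upwards [egaz (N + 1)] with n hn
  exact cbw n (by omega) x (hN.trans (by exact_mod_cast (by omega : N <= n)))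
section
variable {m lo hi C : Rl} {d : Dat} {fxt gxt : Rl -> RR}
lemma mtz {t : Rl} (h : PHd) :
    HI (fun x => 2 * d.v t x + 2 * mdx ^ 2 * drx -
      drx * (drx * xp)) (2 * dem) := by
  have hm := h.prof.hm
  set F : RR := fun x => (m - Mm rdd x) * rdd x with hF
  set F' : RR := fun x => -(1 / 2 * (rdd x * xp)) * rdd x +
    (m - Mm rdd x) * (2 * (fd * fdx + gd * gdx)) with hF'
  have dF : forall x, HasDerivAt F (F' x) x := fun x => ((h.prof.M_deriv x).const_sub m).mul (h.rd x)
  have mb : forall x, |m - Mm rdd x| <= 2 * mo := fun x => by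
    have := h.prof.M_nn x; have := h.prof.M_le x
    rw [alz]; constructor <;> linarith
  have cr := h.prof.cont
  have cM := h.prof.M_cont
  have cn := h.cf; have co := h.cg; have cs := h.am; have ct := h.ao
  have iF : Integrable F := by
    refine iob (h.prof.r_int.const_mul (2 * mo)) fp fun x => ?_
    rw [hF, amz, abn (h.prof.nn x)]
    exact mlr (mb x) (h.prof.nn x)
  have iF' : Integrable F' := by
    refine iob (h.rq_int.add (h.rd_int.abs.const_mul (2 * mo))) fp fun x => ?_
    refine (aalz _ _).trans (add_le_add ?_ ?_)
    · have := mnn (h.prof.nn x) (h.prof.qnn x)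
      rw [show -(1 / 2 * (rdd x * xp)) * rdd x =
        -(1 / 2 * (rdd x * (rdd x * xp))) by ring, abs_neg, abn po]
      linarith
    · rw [amz]
      exact mlr (mb x) (abnn _)
  have z := tzz dF iF iF'
  have za : ∫ x, F' x = 0 := by
    have := iohz dF iF' z.1 z.2.1
    simpa using this
  have := (h.w_HI.mul 2).add (HI.mul 2 (⟨iF', za⟩ : HI F' 0))
  rw [mzz, add_zero] at this
  refine this.congr fun x => ?_
  simp only [Dat.v, Dat.M, Dat.r, wsq, hF']
  have er : rdd x = fd ^ 2 + gd ^ 2 := rfl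
  rw [er]; ring
lemma mbz {t : Rl} (h : PHd) {n : ℕ} (hn : 1 <= n) {x : Rl}
    (hx : |x| <= n) : |momR m d (chi n) (aq n) (ar n) (au n) t x| <=
      18 * d.v t x + (224 + 8 * mo ^ 2) * drx + 5 * (drx * (drx * xp)) := by
  have ke := cbd hn hx
  have nc : (1:Rl) <= n := by exact_mod_cast hn
  have kf := alz.1 ((cbz hn hx).trans (dlsz nu nc))
  have kg := alz.1 ((cbq n hn x hx).trans (dlsz nu nc))
  have kh := alz.1 ((cbw n hn x hx).trans (dlsz nu nc))
  have va : 0 <= d.v t x := by unfold Dat.v; positivity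
  have rf : 0 <= drx := h.prof.nn x
  have qa : 0 <= drx * (drx * xp) := po
  have hm := h.prof.hm
  have ma : 0 <= d.M t x := h.prof.M_nn x
  have mc : d.M t x <= 2 * mo := h.prof.M_le x
  have ei : mdx ^ 2 <= (2 * mo) ^ 2 := by apply slsz; all_goals linarith
  have ej : chi n x * mdx ^ 2 <= (2 * mo) ^ 2 := by
    nlinarith [sqn mdx, mnn (sub_nonneg.2 ke.2) (sqn mdx)]
  have et : 0 <= chi n x * mdx ^ 2 := mnn ke.1 (sqn _)
  unfold momR
  have af : |2 * (aq n x + chi n x) * d.v t x| <= 18 * d.v t x := by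
    rw [amz, abn va]
    refine mlr ?_ va
    rw [alz]; constructor <;> linarith [kf.1, kf.2, ke.1, ke.2]
  have ag : |1 / 2 * (au n x + 2 * ar n x) * drx| <= 224 * drx := by
    rw [amz, abn rf]
    refine mlr ?_ rf
    rw [alz]; constructor <;> linarith [kg.1, kg.2, kh.1, kh.2]
  have ah : |2 * chi n x * mdx ^ 2 * drx| <= 8 * mo ^ 2 * drx := by
    rw [amz, abn rf]
    refine mlr ?_ rf
    rw [alz]; constructor <;> nlinarith
  have ai : |(chi n x + 1 / 2 * aq n x) * (drx * (drx * xp))| <=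
      5 * (drx * (drx * xp)) := by
    rw [amz, abn qa]
    refine mlr ?_ qa
    rw [alz]; constructor <;> linarith [kf.1, kf.2, ke.1, ke.2]
  have bf := alz.1 af; have bg := alz.1 ag; have bh := alz.1 ah; have bi := alz.1 ai
  rw [alz]; constructor <;> linarith [bf.1, bf.2, bg.1, bg.2, bh.1, bh.2, bi.1, bi.2]
end
namespace Bl
variable {m lo : Rl} {d : Dat} {fxt gxt : Rl -> RR}
lemma p_int (B : Bl m lo d fxt gxt) {t} (ht : t ∈ Ioo lo 0) :
    Integrable (fun x => xp * d.p t x) ∧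
    |∫ x, xp * d.p t x| <= 3 * dem * |t| := by
  obtain ⟨C, hp⟩ := B.Ht ht
  obtain ⟨c, hc, hi⟩ := B.vir ht
  have pc := cts _ (pcz B.S) ht
  have ta : 0 < |t| := abs_pos.2 ht.2.ne
  have eh : 0 <= dem := ProfH.e_nn
  have hw : HI (d.w m t) dem := hp.w_HI
  have b := fun x => pwz (m := m) (d := d) (t := t) (x := x) (s := 1) (c := 1 / |t|) po
  have k := HI.mul hlf ((hi.mul (1 / |t|)).add (hw.mul (1 / (1 / |t|))))
  have ii : Integrable (fun x => xp * d.p t x) :=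
    iob k.1 fp fun x => by simpa using b x
  refine ⟨ii, ((hio ii).abs_le k fun x => by simpa using b x).trans ?_⟩
  have : 1 / |t| * c <= 4 * dem * |t| := by
    rw [one_div, imlz ta]
    refine hc.trans (loez ?_)
    rw [<- sq_abs]; ring
  rw [one_div_one_div]
  nlinarith [mnn eh ta.le]
lemma P_diff (B : Bl m lo d fxt gxt) {s t : Rl} (hs : s ∈ Ioo lo 0) (ht : t ∈ Ioo lo 0) (hst : s <= t) :
    (∫ x, xp * d.p t x) - (∫ x, xp * d.p s x) = 2 * d.e m s * (t - s) := by
  obtain ⟨C, SH⟩ := B.SH (a := (lo + s) / 2) (b := t / 2) (by linarith [hs.1]) htb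
  have hs' : s ∈ Ioo ((lo + s) / 2) (t / 2) := ⟨by linarith [hs.1], htb⟩
  have ht' : t ∈ Ioo ((lo + s) / 2) (t / 2) := ⟨by linarith [hs.1], htb⟩
  have X := B.X.mono (lo' := (lo + s) / 2) (hi' := t / 2) (by linarith [hs.1]) htb
  have S := SH.toSol
  have big : ∀ r ∈ Ioo ((lo + s) / 2) (t / 2), r ∈ Ioo lo 0 := fun r hr =>
    ⟨by linarith [hr.1, hs.1], by linarith [hr.2, ht.2]⟩
  have sub : uIcc s t ⊆ Ioo ((lo + s) / 2) (t / 2) := oiz.uIcc_subset hs' ht'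
  have id : ∀ n ≥ 1, ∀ r ∈ Ioo ((lo + s) / 2) (t / 2), ∫ x in (-(n:Rl))..n, chi n x * xp * d.pt fxt gxt r x =
      ∫ x in (-(n:Rl))..n, momR m d (chi n) (aq n) (ar n) (au n) r x := by
    intro n hn r hr
    obtain ⟨ei, ej⟩ := ceq n hn
    obtain ⟨et, eu⟩ := cez n hn
    exact mizz S X hr (SH.H r hr).prof (cdw n) (cdz n) (cdq n) (ccq n)
      ⟨ej, et⟩ ⟨ei, eu⟩
  have dom : ∀ r ∈ Ioo ((lo + s) / 2) (t / 2), HI (fun x => 18 * d.v r x + (224 + 8 * mo ^ 2) * d.r r x + 5 * (d.r r x * (d.r r x * xp))) (18 * (∫ x, d.v r x) + (224 + 8 * mo ^ 2) * (∫ x, d.r r x) + 5 * ∫ x, (d.r r x * (d.r r x * xp))) := fun r hr => ((((hio (SH.H r hr).int').mul 18)).add ((hio (SH.H r hr).prof.r_int).mul _)).add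
      ((hio (SH.H r hr).rq_int).mul 5)
  have dw : forall r x, 0 <= 18 * d.v r x + (224 + 8 * mo ^ 2) * d.r r x +
      5 * (d.r r x * (d.r r x * xp)) := fun r x => by
    have : 0 <= d.v r x := by unfold Dat.v; positivity
    have : 0 <= d.r r x := by unfold Dat.r rr; positivity
    positivity
  have key := (flz hs' ht' (fun n t => ∫ x in (-(n:Rl))..n, chi n x * xp * d.p t x)
    (fun n t => ∫ x in (-(n:Rl))..n, chi n x * xp * d.pt fxt gxt t x)
    (fun t => ∫ x, xp * d.p t x) (fun t => 2 * dem)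
    (18 * C + (224 + 8 * mo ^ 2) * (C * ed + 4 * mo) + 5 * (KH m C * (4 * mo))) 1
    (fun n hn r hr => mdz S X (cct n) hr)
    (fun n hn => by
      have := pcq S X
      have := cct n
      exact cpq (fun t x => chi n x * xp * d.pt fxt gxt t x)
        jcf)
    (fun r hr => by
      have pc := cts _ (pcz S) hr
      refine ctk (fun x => |xp * d.p r x|) _ (B.p_int (big r hr)).1.abs _
        (fun n => by have := cct n; fun_prop) (fun n hn x hx => ?_) (fun x => ?_)
      · have := cbd hn hx
        rw [maz, amz, abn this.1]
        exact mloz (abnn _) this.2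
      · simpa [maz] using (cte x).mul_const (xp * d.p r x))
    (fun r hr => by
      have hr' := sub hr
      have hH := SH.H r hr'
      rw [<- (mtz hH).2]
      have := ctk _ (fun x => 2 * d.v r x + 2 * (m - d.M r x) ^ 2 * d.r r x - d.r r x * (d.r r x * xp)) (dom r hr').1
        (fun n => momR m d (chi n) (aq n) (ar n) (au n) r)
        (fun n => mcz S hr' hH.prof (cct n) (ccz n)
          (cic.2 fun x => (cdq n x).continuousAt) (ccq n))
        (fun n hn x hx => mbz hH hn hx) (fun x => by
          have l := ((((((ctz x).add (cte x)).const_mul 2).mul_const (d.v r x)).sub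
            ((((ctw x).add ((ctq x).const_mul 2)).const_mul hlf).mul_const (d.r r x))).add
            ((((cte x).const_mul 2).mul_const ((m - d.M r x) ^ 2)).mul_const (d.r r x))).sub
            (((cte x).add ((ctz x).const_mul hlf)).mul_const
              (d.r r x * (d.r r x * xp)))
          unfold momR
          convert l using 2
          ring)
      refine this.congr' ?_
      filter_upwards [egaz 1] with n hn
      exact (id n hn r hr').symm)
    (fun n hn r hr => by
      have hr' := sub hr
      have hH := SH.H r hr'
      have hm := hH.prof.hm
      rw [id n hn r hr']
      refine (calz (dom r hr') (dw r) fun x hx => mbz hH hn hx).trans ?_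
      have bf : ∫ x, d.v r x <= C := hH.bd'
      have bg : ∫ x, d.r r x <= C * ed + 4 * mo := hH.prof.r_tot
      have bh : ∫ x, d.r r x * (d.r r x * xp) <= KH m C * (4 * mo) := by
        refine (hio hH.rq_int).le (HI.mul (KH m C) ⟨hH.prof.int, hH.prof.mass⟩) fun x => ?_
        exact mlr (hH.r_sup x) (hH.prof.qnn x)
      gcongr)).1
  rw [key, intervalIntegral.integral_congr (g := fun _ => 2 * d.e m s)
    (fun r hr => by simp only; rw [B.e_const (big r (sub hr)) hs]), intervalIntegral.integral_const, smul_eq_mul]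
  ring
lemma P_eq (B : Bl m lo d fxt gxt) {s : Rl} (hs : s ∈ Ioo lo 0) :
    (∫ x, xp * d.p s x) = 2 * d.e m s * s := by
  have eh : 0 <= d.e m s := ProfH.e_nn
  have ld : Tendsto (fun t : Rl => 3 * d.e m s * |t| - 2 * d.e m s * (t - s)) (𝓝[<] 0)
      (𝓝 (3 * d.e m s * |0| - 2 * d.e m s * (0 - s))) := (Continuous.tendsto fp 0).mono_left nwn
  have lf : Tendsto (fun t : Rl => -(3 * d.e m s * |t|) - 2 * d.e m s * (t - s)) (𝓝[<] 0)
      (𝓝 (-(3 * d.e m s * |0|) - 2 * d.e m s * (0 - s))) := (Continuous.tendsto fp 0).mono_left nwn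
  have ev : ∀ᶠ t in 𝓝[<] (0:Rl), t ∈ Ioo s 0 := Ioo_mem_nhdsLT hs.2
  have hev : ∀ t ∈ Ioo s 0, |∫ x, xp * d.p t x| <= 3 * d.e m s * |t| ∧
      (∫ x, xp * d.p t x) - (∫ x, xp * d.p s x) = 2 * d.e m s * (t - s) := by
    intro t ht
    have ht' : t ∈ Ioo lo 0 := ⟨hs.1.trans ht.1, ht.2⟩
    refine ⟨?_, B.P_diff hs ht' ht.1.le⟩
    rw [B.e_const hs ht']; exact (B.p_int ht').2
  have hv := ge_of_tendsto ld (ev.mono fun t ht => by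
    have := hev t ht; have := (alz.1 this.1).2
    show (∫ x, xp * d.p s x) <= _
    linarith)
  have bu := le_of_tendsto lf (ev.mono fun t ht => by
    have := hev t ht; have := (alz.1 this.1).1
    show _ <= (∫ x, xp * d.p s x)
    linarith)
  simp only [abs_zero, mzz] at hv bu
  linarith
lemma rigid (B : Bl m lo d fxt gxt) {t} (ht : t ∈ Ioo lo 0) :
    (forall x, fdx = mdx * fd - xp * gd / (2 * t) ∧
      gdx = mdx * gd + xp * fd / (2 * t)) ∧
    HI (fun x => xp * (drx * xp)) (4 * dem * t ^ 2) := by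
  obtain ⟨C, hp⟩ := B.Ht ht
  obtain ⟨c, hc, hi⟩ := B.vir ht
  have ta : t ≠ 0 := ht.2.ne
  have hw : HI (d.w m t) dem := hp.w_HI
  have hP : HI (fun x => xp * d.p t x) (2 * dem * t) := ⟨(B.p_int ht).1, B.P_eq ht⟩
  set F : RR := fun x => (fdx - mdx * fd + xp * gd / (2 * t)) ^ 2 +
    (gdx - mdx * gd - xp * fd / (2 * t)) ^ 2 with hF
  have k := ((hw.sub (hP.mul (1 / t))).add (hi.mul (1 / (4 * t ^ 2)))).congr (g := F) fun x => by
    simp only [hF, Dat.w, wsq, Dat.p, Dat.r, rr, Dat.M]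
    field_simp; ring
  have tc : 0 < 4 * t ^ 2 := po
  have fa : forall x, 0 <= F x := fun x => by simp only [hF]; positivity
  have cj : 1 / (4 * t ^ 2) * c <= dem := by
    rw [one_div, imlz tc]; linarith
  have ei : 1 / t * (2 * dem * t) = 2 * dem := by field_simp
  have nn : 0 <= ∫ x, F x := inz fa
  have z : ∫ x, F x = 0 := by
    refine le_antisymm ?_ nn
    rw [k.2, ei]; linarith
  have zc : c = 4 * dem * t ^ 2 := by
    rw [k.2, ei] at z
    have : 1 / (4 * t ^ 2) * c = dem := li
    rw [<- this]; field_simp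
  have Fc : Continuous F := by
    have := hp.am; have := hp.ao; have := hp.cf; have := hp.cg
    have : Continuous (d.M t) := hp.prof.M_cont
    fun_prop
  have fz : F = 0 := by
    have := (integral_eq_zero_iff_of_nonneg fa k.1).1 z
    exact (Fc.ae_eq_iff_eq volume continuous_const).1 this
  refine ⟨fun x => ?_, zc ▸ hi⟩
  have hx : F x = 0 := by rw [fz]; rfl
  simp only [hF] at hx
  have af := pow_eq_zero_iff (two_ne_zero) |>.1 ((add_eq_zero_iff_of_nonneg (sqn _) (sqn _)).1 hx).1
  have ag := pow_eq_zero_iff (two_ne_zero) |>.1 ((add_eq_zero_iff_of_nonneg (sqn _) (sqn _)).1 hx).2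
  constructor <;> linarith
end Bl

lemma Mprof {m C : Rl} {r : RR} (h : PMC r)
    (hr : forall x, HasDerivAt r (2 * (m - Mm r x) * r x) x) :
    (forall x, r x * xp = 2 * (Mm r x * (2 * mo - Mm r x))) ∧
    ∃ a, forall x, Mm r x = 2 * mo * exp (2 * mo * (x - a)) / (1 + exp (2 * mo * (x - a))) := by
  have hm := h.hm
  set L := 2 * mo with hL
  have la : 0 < L := li
  have ei : forall x, r x * xp = 2 * (Mm r x * (L - Mm r x)) := by
    have dd : forall x, HasDerivAt (fun x => r x * xp - 2 * (Mm r x * (L - Mm r x))) 0 x := by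
      intro x
      have := ((hr x).mul (((hid x).const_mul 2).exp)).sub
        (((h.M_deriv x).mul ((h.M_deriv x).const_sub L)).const_mul 2)
      refine this.congr_deriv ?_
      simp only [id]; rw [hL]; ring
    have cst : forall x y, r x * xp - 2 * (Mm r x * (L - Mm r x)) = r y * exp (2 * y) - 2 * (Mm r y * (L - Mm r y)) := fun x y => icoz (fun x => (dd x).differentiableAt) (fun x => (dd x).deriv) x y
    have lq : Tendsto (fun x => r x * xp) atBot (𝓝 0) := by
      have ld : Tendsto (fun x : Rl => C * exp (4 * x)) atBot (𝓝 0) := by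
        have := (rtez.comp (tiz.const_mul_atBot (by norm_num : (0:Rl) < 4))).const_mul C
        simpa using this
      refine squeeze_zero' (evf h.qnn) ?_ ld
      filter_upwards [eventually_le_atBot 0] with x hx
      have e : exp (4 * x) = xp * xp := by
        rw [<- xad]; ring_nf
      rw [e, <- maz]
      exact mlr (h.near x hx) (xpp _).le
    have lf : Tendsto (fun x => r x * xp - 2 * (Mm r x * (L - Mm r x))) atBot (𝓝 0) := by
      have := lq.sub ((h.M_bot.mul (h.M_bot.const_sub L)).const_mul 2)
      simpa using this
    intro x
    have : (fun x => r x * xp - 2 * (Mm r x * (L - Mm r x))) = fun _ => r x * xp - 2 * (Mm r x * (L - Mm r x)) := funext fun y => cst y x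
    rw [this] at lf
    have := tnuz lf tendsto_const_nhds
    linarith
  refine ⟨ei, ?_⟩
  obtain ⟨xa, hj⟩ : ∃ xa, Mm r xa = L / 2 := by
    have := mem_range_of_exists_le_of_exists_ge h.M_cont
      ((h.M_bot.eventually (gmnz (hpz la))).exists.imp fun _ h => h.le)
      ((h.M_top.eventually (lt_mem_nhds (half_lt_self la))).exists.imp fun _ h => h.le)
    exact this
  have dM : forall x, HasDerivAt (Mm r) (Mm r x * (L - Mm r x)) x := fun x => by
    have := h.M_deriv x; rw [ei x] at this; convert this using 1; ring
  set D : RR := fun x => Mm r x * (1 + exp (L * (x - xa))) - L * exp (L * (x - xa)) with hD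
  have dE : forall x, HasDerivAt (fun x => exp (L * (x - xa))) (exp (L * (x - xa)) * L) x := fun x => by
    have := (((hid x).sub_const xa).const_mul L).exp
    simpa using this
  have dD : forall x, HasDerivAt D ((L - Mm r x) * D x) x := fun x => by
    have := ((dM x).mul ((dE x).const_add 1)).sub ((dE x).const_mul L)
    refine this.congr_deriv ?_
    rw [hD]; ring
  have dm : forall x, HasDerivAt (fun x => D x ^ 2) (2 * (L - Mm r x) * D x ^ 2) x := fun x => by
    have := (dD x).pow 2
    refine this.congr_deriv ?_
    norm_num; ring
  have da : D xa = 0 := by simp only [hD, hj, sub_self, mzz, exp_zero]; ring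
  have mf : Monotone fun x => D x ^ 2 := by
    refine monotone_of_deriv_nonneg (fun x => (dm x).differentiableAt) fun x => ?_
    rw [(dm x).deriv]
    exact mnn (by linarith [h.M_le x]) (sqn _)
  have dq : forall x, HasDerivAt (fun x => D x ^ 2 * exp (-(2 * L) * x))
      (-2 * Mm r x * (D x ^ 2 * exp (-(2 * L) * x))) x := fun x => by
    have := (dm x).mul (((hid x).const_mul (-(2 * L))).exp)
    refine this.congr_deriv ?_
    simp only [id]; ring
  have mg : Antitone fun x => D x ^ 2 * exp (-(2 * L) * x) := by
    refine antitone_of_deriv_nonpos (fun x => (dq x).differentiableAt) fun x => ?_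
    rw [(dq x).deriv]
    have := h.M_nn x
    have : 0 <= Mm r x * (D x ^ 2 * exp (-(2 * L) * x)) := po
    linarith
  have Dz : forall x, D x = 0 := fun x => by
    rcases le_total x xa with hx | hx
    · have := mf hx
      simp only [da] at this
      nlinarith [sqn (D x)]
    · have := mg hx
      simp only [da] at this
      have e := xpp (-(2 * L) * x)
      by_contra hne
      have : 0 < D x ^ 2 := po
      nlinarith [mul_pos this e]
  refine ⟨xa, fun x => ?_⟩
  have := Dz x
  rw [hD] at this
  rw [eq_div_iff po]
  linarith
def sA (m a x t : Rl) : Rl := sqrt 8 * mo * exp (mo * xq) /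
    (1 + exp (2 * mo * xq)) * exp (-x)
section
variable {m lo : Rl} {d : Dat} {fxt gxt : Rl -> RR}
lemma Bl.hr (B : Bl m lo d fxt gxt) {t} (ht : t ∈ Ioo lo 0) x :
    HasDerivAt rdd (2 * (m - Mm rdd x) * rdd x) x := by
  have hv := ((B.S.dfx t ht x).pow 2).add ((B.S.dgx t ht x).pow 2)
  refine hv.congr_deriv ?_
  obtain ⟨ea, eb⟩ := (B.rigid ht).1 x
  rw [ea, eb]
  simp only [rr, Dat.M]; norm_num; ring
lemma Bl.scale (B : Bl m lo d fxt gxt) : ∃ a, ∀ t ∈ Ioo lo 0, forall x, d.M t x = 2 * mo * exp (2 * mo * xq) /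
      (1 + exp (2 * mo * xq)) ∧
    drx * xp = 2 * (d.M t x * (2 * mo - d.M t x)) := by
  set qa : RR := fun y => exp (2 * y) * (2 * ((2 * mo * exp (2 * mo * y) / (1 + exp (2 * mo * y))) *
    (2 * mo - (2 * mo * exp (2 * mo * y) / (1 + exp (2 * mo * y)))))) with gk
  have key : ∀ t ∈ Ioo lo 0, ∃ b, (forall x, d.M t x = 2 * mo * exp (2 * mo * (x - b)) /
      (1 + exp (2 * mo * (x - b))) ∧
      drx * xp = 2 * (d.M t x * (2 * mo - d.M t x))) ∧ Integrable qa ∧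
      exp (2 * b) * (∫ y, qa y) = 4 * dem * t ^ 2 := by
    intro t ht
    obtain ⟨C, hC⟩ := B.Ht ht
    obtain ⟨pd, b, pe⟩ := Mprof hC.prof (B.hr ht)
    refine ⟨b, fun x => ⟨pe x, pd x⟩, ?_⟩
    obtain ⟨ib, ic⟩ := (B.rigid ht).2
    have e : (fun x => xp * (drx * xp)) =
        fun x => exp (2 * b) * qa (x - b) := by
      funext x
      rw [show drx * xp = _ from pd x, pe x, gk]
      simp only
      rw [<- maz (exp (2 * b)), <- xad, show 2 * b + 2 * (x - b) = 2 * x by ring]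
    rw [e] at ib ic
    rw [ntcm, integral_sub_right_eq_self] at ic
    refine ⟨?_, ic⟩
    have := (ib.const_mul (exp (2 * b))⁻¹).comp_add_right b
    simpa [inv_mul_cancel_left₀ (xpp (2 * b)).ne'] using this
  have hlo := B.lk
  set ta := lo / 2 with go
  have me : ta ∈ Ioo lo 0 := ⟨li, li⟩
  obtain ⟨bc, -, iq, ke⟩ := key ta me
  have hm := (B.Ht me).choose_spec.prof.hm
  have q0p : forall y, 0 < qa y := fun y => by
    rw [gk]
    have : 2 * mo - (2 * mo * exp (2 * mo * y) / (1 + exp (2 * mo * y))) =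
      2 * mo / (1 + exp (2 * mo * y)) := by
      have : 1 + exp (2 * mo * y) ≠ 0 := po
      field_simp; ring
    simp only [this]; positivity
  have Vp : 0 < ∫ y, qa y := by
    refine (integral_pos_iff_support_of_nonneg (fun y => (q0p y).le) iq).2 ?_
    have : Function.support qa = univ := eq_univ_of_forall fun y => (q0p y).ne'
    rw [this]; simp
  have ep : 0 < d.e m ta := by
    have tc : 0 < ta ^ 2 := sq_pos_of_ne_zero me.2.ne
    have : 0 < 4 * d.e m ta * ta ^ 2 := ke ▸ po
    by_contra hc
    nlinarith
  refine ⟨log (4 * d.e m ta / ∫ y, qa y) / 2, fun t ht x => ?_⟩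
  obtain ⟨b, p, -, k⟩ := key t ht
  rw [B.e_const ht me] at k
  have hb : b = log (4 * d.e m ta / ∫ y, qa y) / 2 + log (-t) := by
    have tb : 0 < -t := htb
    have : exp (2 * b) = (4 * d.e m ta / ∫ y, qa y) * (-t) ^ 2 := by
      rw [neg_sq]; field_simp; linarith
    have := congrArg log this
    rw [Real.log_exp, Real.log_mul po po, Real.log_pow] at this
    push_cast at this; linarith
  have := p x
  rwa [hb, <- sub_sub] at this
end

section
variable {m lo : Rl} {d : Dat} {fxt gxt : Rl -> RR}
lemma zpz {C : Rl} {r : RR} (h : PMC r)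
    (ei : forall x, r x * xp = 2 * (Mm r x * (2 * mo - Mm r x))) x :
    xp * Vv m r x = -(2 * (Mm r x * (2 * mo - Mm r x))) + 2 * Mm r x := by
  have dd : forall x, HasDerivAt (fun x => Zz m r x + Mm r x * exp (-2 * x)) 0 x := fun x => by
    have := (h.Z_deriv x).add ((h.M_deriv x).mul (((hid x).const_mul (-2)).exp))
    refine this.congr_deriv ?_
    rw [ei x]
    simp only [id, neg_mul]; ring
  have l : Tendsto (fun x => Zz m r x + Mm r x * exp (-2 * x)) atTop (𝓝 0) := by
    have ld : Tendsto (fun x : Rl => exp (-2 * x)) atTop (𝓝 0) := rtez.comp (tiz.const_mul_atTop_of_neg nu)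
    simpa using h.Z_top.add (h.M_top.mul ld)
  have e : (fun x => Zz m r x + Mm r x * exp (-2 * x)) = fun _ => Zz m r x + Mm r x * exp (-2 * x) := funext fun y => icoz (fun x => (dd x).differentiableAt) (fun x => (dd x).deriv) y x
  rw [e] at l
  have l := tnuz tendsto_const_nhds l
  have ee : xp * exp (-2 * x) = 1 := by rw [<- xad]; simp
  rw [<- ei x, Vv]
  linear_combination (-2 * xp) * l + 2 * Mm r x * ee
lemma Bl.tder (B : Bl m lo d fxt gxt) {t} (ht : t ∈ Ioo lo 0)
    (ei : forall x, drx * xp = 2 * (d.M t x * (2 * mo - d.M t x))) x :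
    d.ft t x = -((m + 1 - d.M t x) / t) * fd + xp / (4 * t ^ 2) * gd ∧
    d.gt t x = -((m + 1 - d.M t x) / t) * gd - xp / (4 * t ^ 2) * fd := by
  obtain ⟨C, hC⟩ := B.Ht ht
  have hZ := zpz hC.prof ei x
  have ta : t ≠ 0 := ht.2.ne
  have R := (B.rigid ht).1
  have dM := (hC.prof.M_deriv x)
  rw [show rdd x * xp = _ from ei x] at dM
  have dE : HasDerivAt (fun x => xp) (xp * 2) x := by
    simpa using ((hid x).const_mul 2).exp
  have kf : d.fxx t x = _ := (B.S.dfxx t ht x).unique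
    (((((dM.const_sub m).mul (B.S.dfx t ht x))).sub ((dE.mul (B.S.dgx t ht x)).div_const (2 * t))).congr_of_eventuallyEq
      (evf fun y => (R y).1))
  have kg : d.gxx t x = _ := (B.S.dgxx t ht x).unique
    (((((dM.const_sub m).mul (B.S.dgx t ht x))).add ((dE.mul (B.S.dfx t ht x)).div_const (2 * t))).congr_of_eventuallyEq
      (evf fun y => (R y).2))
  have qb := B.S.bp t ht x
  have qc := B.S.bq t ht x
  obtain ⟨ra, rb⟩ := R x
  simp only [Dat.W, hZ] at qb qc
  rw [kg, ra, rb] at qb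
  rw [kf, ra, rb] at qc
  have E := xpp (2 * x)
  constructor
  · refine mul_left_cancel₀ E.ne' (qb.trans ?_)
    simp only [Dat.M]
    field_simp; ring
  · refine mul_left_cancel₀ E.ne' (qc.trans ?_)
    simp only [Dat.M]
    field_simp; ring
lemma Bl.form (B : Bl m lo d fxt gxt) : ∃ a γ : Rl, ∀ t ∈ Ioo lo 0, ∀ x : Rl, (fd : ℂ) + gd * Ci = Complex.exp (Ci * γ) * (sA m a x t : Rl) *
      Complex.exp (Ci * (xp / (4 * t) : Rl)) := by
  obtain ⟨a, ha⟩ := B.scale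
  refine ⟨a, ?_⟩
  have hlo := B.lk
  have mem : lo / 2 ∈ Ioo lo 0 := ⟨li, li⟩
  have hm := (B.Ht mem).choose_spec.prof.hm
  set s : Rl -> RR := fun t x => x - a - log (-t) with hs
  set N : Rl -> RR := fun t x => exp (-(mo * s t x) + x) * (1 + exp (2 * mo * s t x)) with hN
  set w : Rl -> Rl -> ℂ := fun t x => ((fd : ℂ) + gd * Ci) * (N t x : ℂ) *
    Complex.exp (Ci * ((-(xp / (4 * t)) : Rl) : ℂ)) with hw
  have Nx : ∀ t ∈ Ioo lo 0, forall x, HasDerivAt (N t) (-mdx * N t x) x := by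
    intro t ht x
    have db : HasDerivAt (s t) 1 x := ((hid x).sub_const a).sub_const _
    have := (((db.const_mul mo).neg.add (hid x)).exp).mul ((db.const_mul (2 * mo)).exp.const_add 1)
    refine this.congr_deriv ?_
    rw [(ha t ht x).1]
    simp only [hN, hs]
    have : 1 + exp (2 * mo * xq) ≠ 0 := po
    simp only [paaz, Pi.neg_apply, id]
    field_simp; ring
  have Nt : ∀ t ∈ Ioo lo 0, forall x, HasDerivAt (fun t => N t x) ((m + 1 - d.M t x) / t * N t x) t := by
    intro t ht x
    have ta : t ≠ 0 := ht.2.ne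
    have db : HasDerivAt (fun t => s t x) (-(-1 / -t)) t :=
      ((hid t).neg.log (by simpa using ta)).const_sub (x - a)
    have := (((db.const_mul mo).neg.add_const x).exp).mul ((db.const_mul (2 * mo)).exp.const_add 1)
    refine this.congr_deriv ?_
    rw [(ha t ht x).1]
    simp only [hN, hs]
    have : 1 + exp (2 * mo * xq) ≠ 0 := po
    simp only [Pi.neg_apply]
    field_simp; ring
  have wx : ∀ t ∈ Ioo lo 0, forall x, HasDerivAt (w t) 0 x := by
    intro t ht x
    have ta : (t : ℂ) ≠ 0 := by exact_mod_cast ht.2.ne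
    have dE : HasDerivAt (fun x => -(xp / (4 * t))) (-(xp * 2 / (4 * t))) x := by
      have : HasDerivAt (fun x => xp) (xp * 2) x := by
        simpa using ((hid x).const_mul 2).exp
      exact (this.div_const _).neg
    have := ((((B.S.dfx t ht x).ofReal_comp).add ((B.S.dgx t ht x).ofReal_comp.mul_const Ci)).mul
      (Nx t ht x).ofReal_comp).mul (dE.ofReal_comp.const_mul Ci).cexp
    refine this.congr_deriv ?_
    obtain ⟨ra, rb⟩ := (B.rigid ht).1 x
    simp only [ra, rb, paaz, Pi.mul_apply]
    push_cast
    field_simp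
    ring_nf
    simp only [Complex.I_sq]; ring
  have wt : ∀ t ∈ Ioo lo 0, forall x, HasDerivAt (fun t => w t x) 0 t := by
    intro t ht x
    have ta : (t : ℂ) ≠ 0 := by exact_mod_cast ht.2.ne
    have dE : HasDerivAt (fun t => -(xp / (4 * t))) (xp / (4 * t ^ 2)) t := by
      have := (((hid t).const_mul 4).inv (by simpa using ht.2.ne)).const_mul (-xp)
      refine (this.congr_deriv ?_).congr_of_eventuallyEq (evf fun y => ?_)
      · have := ht.2.ne
        simp only [id]; field_simp
      · simp; ring
    have := ((((B.S.dft t ht x).ofReal_comp).add ((B.S.dgt t ht x).ofReal_comp.mul_const Ci)).mul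
      (Nt t ht x).ofReal_comp).mul (dE.ofReal_comp.const_mul Ci).cexp
    refine this.congr_deriv ?_
    obtain ⟨ra, rb⟩ := B.tder ht (fun y => (ha t ht y).2) x
    simp only [ra, rb, paaz, Pi.mul_apply]
    push_cast
    field_simp
    ring_nf
    simp only [Complex.I_sq]; ring
  have wc : ∀ t ∈ Ioo lo 0, forall x, w t x = w (lo / 2) 0 := by
    intro t ht x
    have hv : w t x = w t 0 := icoz (fun x => (wx t ht x).differentiableAt) (fun x => (wx t ht x).deriv) x 0
    rw [hv]
    refine IsOpen.is_const_of_deriv_eq_zero isOpen_Ioo isPreconnected_Ioo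
      (f := fun t => w t 0) (fun t ht => ((wt t ht 0).differentiableAt).differentiableWithinAt)
      (fun t ht => (wt t ht 0).deriv) ht mem
  have NA : forall t x, sA m a x t * N t x = sqrt 8 * mo := by
    intro t x
    simp only [sA, hN, hs]
    have : 1 + exp (2 * mo * xq) ≠ 0 := po
    rw [xad, exp_neg, exp_neg]
    field_simp
  set z : ℂ := w (lo / 2) 0 / ((sqrt 8 * mo : Rl) : ℂ) with hz
  have sk : 0 < sqrt 8 * mo := po
  have sk' : ((sqrt 8 * mo : Rl) : ℂ) ≠ 0 := by exact_mod_cast sk.ne'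
  have vz : ∀ t ∈ Ioo lo 0, forall x, (fd : ℂ) + gd * Ci = z * (sA m a x t : Rl) *
      Complex.exp (Ci * (xp / (4 * t) : Rl)) := by
    intro t ht x
    have na : (N t x : ℂ) ≠ 0 := by
      have : 0 < N t x := by simp only [hN]; positivity
      exact_mod_cast this.ne'
    have hv : ((sA m a x t : Rl) : ℂ) = ((sqrt 8 * mo : Rl) : ℂ) / N t x := by
      rw [eq_div_iff na]; exact_mod_cast NA t x
    rw [hv, hz, <- wc t ht x, hw]
    simp only
    rw [div_mul_div_cancel₀ sk', mul_right_comm _ _ (Complex.exp _), mul_div_assoc, div_self na, mul_one, maz, <- Complex.exp_add]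
    simp
  have zn : ‖z‖ = 1 := by
    have h := congrArg (fun y => ‖y‖ ^ 2) (vz _ mem 0)
    simp only [norm_mul, Complex.norm_exp_I_mul_ofReal, mul_one, Complex.norm_real] at h
    rw [<- Complex.normSq_eq_norm_sq, Complex.normSq_add_mul_I, mul_pow, rnez, sq_abs] at h
    obtain ⟨hv, bu⟩ := ha _ mem 0
    have bx : sA m a 0 (lo / 2) ^ 2 = d.r (lo / 2) 0 := by
      rw [hv] at bu
      simp only [mzz, exp_zero, mul_one] at bu
      rw [bu, sA]
      set E := exp (mo * (0 - a - log (-(lo / 2)))) with hE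
      have : exp (2 * mo * (0 - a - log (-(lo / 2)))) = E ^ 2 := by
        rw [hE, <- xnm]; push_cast; ring_nf
      rw [this]
      have : 1 + E ^ 2 ≠ 0 := po
      have s := sq_sqrt (by norm_num : (0:Rl) <= 8)
      simp only [neg_zero, exp_zero]
      field_simp
      rw [s]; ring
    have bz : 0 < sA m a 0 (lo / 2) ^ 2 := by
      have : 0 < sA m a 0 (lo / 2) := by unfold sA; positivity
      positivity
    rw [show d.f (lo / 2) 0 ^ 2 + d.g (lo / 2) 0 ^ 2 = d.r (lo / 2) 0 from rfl, <- bx] at h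
    have : ‖z‖ ^ 2 = 1 := by
      apply mul_right_cancel₀ bz.ne'; linarith
    exact (pow_eq_one_iff_of_nonneg (norm_nonneg z) two_ne_zero).1 this
  refine ⟨z.arg, fun t ht x => ?_⟩
  rw [vz t ht x]
  have := Complex.norm_mul_exp_arg_mul_I z
  rw [zn, Complex.ofReal_one, one_mul, mul_comm] at this
  rw [this]
end

def Dat.Dn (d : Dat) (n : ℕ) (t : Rl) : Rl := ∫ x in (0:Rl)..n, en * chi n x * d.v t x
section
variable {m lo hi C : Rl} {d : Dat} {fxt gxt : Rl -> RR}
lemma miy {r : RR} (h : PMC r) {A B : Rl} (hAB : A <= B) :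
    ∫ x in A..B, r x * xp <= 4 * mo := by
  rw [iol hAB, <- h.mass]
  exact sli h.int (evf h.qnn)
lemma vcz (S : Sol m lo hi d) : JC lo hi d.v := by
  have := S.cfx; have := S.cgx; unfold JC Dat.v at *; fun_prop
lemma DnI (S : Sol m lo hi d) (n : ℕ) : JC lo hi (fun t x => en * chi n x * d.v t x) := by
  have := vcz S; have := cct n; unfold JC at *; fun_prop
lemma pwq (f g a b : Rl) {θ E F : Rl} (hθ : 0 < θ) (e : E * F = 1) (hE : 0 < E) (s : Rl) :
    |s * (f * a + g * b)| <= θ / 2 * (E * s ^ 2 * (a ^ 2 + b ^ 2)) + 1 / (2 * θ) * ((f ^ 2 + g ^ 2) * F) := by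
  have fa : F = 1 / E := by field_simp; linarith
  have k : ∀ f a : Rl, |s * f * a| <= θ / 2 * (E * s ^ 2 * a ^ 2) + 1 / (2 * θ) * (f ^ 2 * F) := by
    intro f a
    have h : ∀ f : Rl, s * f * a <= θ / 2 * (E * s ^ 2 * a ^ 2) + 1 / (2 * θ) * (f ^ 2 * F) := by
      intro f
      have : θ / 2 * (E * s ^ 2 * a ^ 2) + 1 / (2 * θ) * (f ^ 2 * F) - s * f * a = (θ * E * s * a - f) ^ 2 / (2 * θ * E) := by
        rw [fa]; field_simp; ring
      have : 0 <= (θ * E * s * a - f) ^ 2 / (2 * θ * E) := po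
      linarith
    have := h f; have := h (-f)
    rw [alz]; constructor <;> nlinarith
  have := aalz (s * f * a) (s * g * b)
  rw [show s * (f * a + g * b) = s * f * a + s * g * b by ring]
  linarith [k f a, k g b]
lemma esz (S : Sol m lo hi d) {t} (ht : t ∈ Irl) (hP : PMC rdd)
    {n : ℕ} (hn : 1 <= n) {θ : Rl} (hθ : 0 < θ) {x : Rl} (hx : x ∈ Icc (0:Rl) n) :
    xna ^ 3 * drx <= θ * d.Dn n t + (6 + 1 / θ) * (4 * mo) := by
  have nc : (1:Rl) <= n := by exact_mod_cast hn
  set h : RR := fun x => θ * (en * chi n x * d.v t x) +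
    (6 + 1 / θ) * (rdd x * xp) with hh
  have cj := cts (fun t x => en * chi n x * d.v t x) (DnI S n) ht
  have ch : Continuous h := by have := hP.qcont; fun_prop
  have gh : ∀ y ∈ Icc (0:Rl) n, 0 <= h y := fun y hy => by
    have := (cbd hn (alz.2 ⟨by linarith [hy.1], hy.2⟩)).1
    have := hP.qnn y
    have : 0 <= d.v t y := by unfold Dat.v; positivity
    simp only [hh]; positivity
  have hd : forall y, HasDerivAt (fun y => yna ^ 3 * d.r t y)
      (-6 * (y / n) / n * yna ^ 2 * d.r t y +
        yna ^ 3 * (2 * (d.f t y * d.fx t y + d.g t y * d.gx t y))) y := fun y => by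
    have hj : HasDerivAt (fun x : Rl => x / n) (1 / n) y := (hid y).div_const (n : Rl)
    refine ((((hj.fun_pow 2).const_sub 1).fun_pow 3).mul (rdq S ht y)).congr_deriv ?_
    push_cast; simp only [div_eq_mul_inv]; ring
  have cf := cts _ S.cf ht; have cg := cts _ S.cg ht
  have cfx := cts _ S.cfx ht; have cgx := cts _ S.cgx ht
  have cr : Continuous (d.r t) := hP.cont
  have F := ftc (a := x) (b := n) (fun y _ => hd y)
    ((by fun_prop : Continuous _).intervalIntegrable _ _)
  have nb : (n:Rl) ≠ 0 := po
  simp only [div_self nb, one_pow, sub_self, ne_eq, OfNat.ofNat_ne_zero, not_false_eq_true, zero_pow, zero_mul, zero_sub] at F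
  have key : -∫ y in x..n, (-6 * (y / n) / n * yna ^ 2 * d.r t y +
        yna ^ 3 * (2 * (d.f t y * d.fx t y + d.g t y * d.gx t y))) <= ∫ y in x..n, h y := by
    rw [<- intervalIntegral.integral_neg]
    refine imo hx.2 ((by fun_prop : Continuous _).intervalIntegrable _ _)
      (ch.intervalIntegrable _ _) fun y hy => ?_
    have yc : 0 <= y := hx.1.trans hy.1
    have hya : |y| <= n := alz.2 ⟨li, hy.2⟩
    obtain ⟨zb, zd⟩ := dsl hn hya
    have ej : (1:Rl) <= exp (2 * y) := one_le_exp li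
    have rn := hP.nn y
    have P := pwq (d.f t y) (d.g t y) (d.fx t y) (d.gx t y) (E := exp (-(2 * y))) (F := exp (2 * y)) (hpz hθ)
      (by rw [<- xad]; simp) (xpp _) (yna ^ 3 * 2)
    have P' := (alz.1 P).1
    have af : 6 * (y / n) / n * yna ^ 2 * d.r t y <= 6 * (rdd y * exp (2 * y)) := by
      have bf : (y / n) / n * yna ^ 2 <= 1 := by
        refine mloq ?_ (sqn _) (ploz li (by nlinarith [sqn (y / n)]))
        rw [div_le_one po]; linarith [(alz.1 zb).2]
      have : rdd y <= rdd y * exp (2 * y) := le_mul_of_one_le_right rn ej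
      have := mlr bf rn
      unfold Dat.r
      rw [show 6 * (y / n) / n * yna ^ 2 = 6 * ((y / n) / n * yna ^ 2) by ring]
      linarith
    have ag : yna ^ 6 <= chi n y :=
      pow_le_pow_of_le_one li (by nlinarith [sqn (y / n)]) nu
    have va : 0 <= exp (-(2 * y)) * d.v t y := by unfold Dat.v; positivity
    have ah := mll (mlr ag va) hθ.le
    have ei : 1 / (2 * (θ / 2)) = 1 / θ := by congr 1; ring
    rw [ei] at P'
    have et : rdd y = d.f t y ^ 2 + d.g t y ^ 2 := rfl
    simp only [hh, et, Dat.v] at *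
    simp only [neg_mul, neg_div]
    linarith
  have mono : ∫ y in x..n, h y <= ∫ y in (0:Rl)..n, h y := by
    rw [iol hx.2, iol (hx.1.trans hx.2)]
    refine setIntegral_mono_set (ch.integrableOn_Icc.mono_set Ioc_subset_Icc_self) ?_
      (Ioc_subset_Ioc_left hx.1).eventuallyLE
    exact (ae_restrict_iff' miw).2 (evf fun y hy => gh y ⟨hy.1.le, hy.2⟩)
  have tot : ∫ y in (0:Rl)..n, h y <= θ * d.Dn n t + (6 + 1 / θ) * (4 * mo) := by
    rw [hh, iad ((cj.const_mul θ).intervalIntegrable _ _)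
      ((hP.qcont.const_mul _).intervalIntegrable _ _), icm, icm]
    have := miy hP (hx.1.trans hx.2)
    unfold Dat.Dn
    gcongr
  linarith
end

section
variable {m lo hi C : Rl} {d : Dat} {fxt gxt : Rl -> RR}
def kq (n : ℕ) (x : Rl) : Rl := -(en * chi n x)
def ja (m : Rl) (d : Dat) (t : Rl) : Rl :=
  |d.f t 0 * d.gt t 0 - d.g t 0 * d.ft t 0| + 28 * d.r t 0 + d.v t 0 + (m ^ 2 + d.r t 0 + 4 * mo ^ 2) * d.r t 0 + d.r t 0 ^ 2
set_option maxHeartbeats 800000 in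
lemma lm (S : Sol m lo hi d) (X : SolX lo hi d fxt gxt) {t} (ht : t ∈ Irl)
    (hP : PMC rdd) {n : ℕ} (hn : 1 <= n) :
    3 / 2 * d.Dn n t <= (∫ x in (0:Rl)..n, kq n x * xp * d.pt fxt gxt t x) +
      (296 + 8 * mo ^ 2 + 4 * ((6 + 32 * mo) * (4 * mo))) * (4 * mo) + ja m d t := by
  have nc : (1:Rl) <= n := by exact_mod_cast hn
  have nb : (n:Rl) ≠ 0 := po
  have mf := hP.hm
  have de : ∀ x : Rl, HasDerivAt (fun x : Rl => en) (-(2 * en)) x := fun x => by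
    refine (((hid x).const_mul 2).neg.exp).congr_deriv ?_
    simp; ring
  set kf : RR := fun x => en * (2 * chi n x - aq n x) with hv
  set kg : RR := fun x => en * (-4 * chi n x + 4 * aq n x - ar n x) with bu
  set kh : RR := fun x => en * (8 * chi n x - 12 * aq n x + 6 * ar n x - au n x) with bx
  have dc := cdw n; have ds := cdz n; have du := cdq n
  have db : forall x, HasDerivAt (kq n) (kf x) x := fun x =>
    ((de x).mul (dc x)).neg.congr_deriv (by rw [hv]; ring)
  have dj : forall x, HasDerivAt kf (kg x) x := fun x =>
    ((de x).mul (((dc x).const_mul 2).sub (ds x))).congr_deriv (by simp only [bu, Pi.sub_apply]; ring)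
  have dk : forall x, HasDerivAt kg (kh x) x := fun x =>
    ((de x).mul ((((dc x).const_mul (-4)).add ((ds x).const_mul 4)).sub (du x))).congr_deriv (by
      simp only [bx, paaz, Pi.sub_apply]; ring)
  have cj := cct n; have cn := ccz n; have cs' := ccq n
  have co : Continuous (ar n) := cic.2 fun x => (du x).continuousAt
  have cs : Continuous kh := fp
  have ck : Continuous (kq n) := by unfold kq; fun_prop
  have I := miqz S X ht hP db dj dk cs 0 n
  have Jn : momJ m d (kq n) kf kg t n = 0 := by
    have ei := ceq n hn; have ej := cez n hn
    simp [momJ, kq, hv, bu, ei.1, ej.2.1, ej.2.2]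
  have rf : 0 <= d.r t 0 := hP.nn 0
  have ja' : momJ m d (kq n) kf kg t 0 <= ja m d t := by
    have za : chi n 0 = 1 := by simp [chi]
    have zb : aq n 0 = 0 := by simp [aq]
    have zd := alz.1 (cbq n hn 0 (by simp))
    have ze : (56:Rl) / n <= 56 := dlsz nu nc
    have zz := alz.1 (hP.Z_abs2 0)
    have va : 0 <= d.v t 0 := by unfold Dat.v; positivity
    have hr : rdd 0 = d.r t 0 := rfl
    have aa := neg_abs_le (d.f t 0 * d.gt t 0 - d.g t 0 * d.ft t 0)
    have : ar n 0 * d.r t 0 ≥ -56 * d.r t 0 := mlr li rf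
    simp only [mzz, neg_zero, exp_zero, mul_one] at zz
    have : Zz m rdd 0 * d.r t 0 <= 2 * mo ^ 2 * d.r t 0 := mlr zz.2 rf
    have := mnn rf rf
    simp only [momJ, ja, kq, hv, bu, za, zb, Vv, hr, mzz, neg_zero, exp_zero]
    nlinarith
  set θ : Rl := 1 / (32 * mo) with hθ
  have θ0 : 0 < θ := po
  set Y : Rl := θ * d.Dn n t + (6 + 1 / θ) * (4 * mo) with hY
  have low : 2 * d.Dn n t - (296 + 8 * mo ^ 2 + 4 * Y) * (4 * mo) <=
      ∫ x in (0:Rl)..n, momR m d (kq n) kf kg kh t x := by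
    have cD := cts (fun t x => en * chi n x * d.v t x) (DnI S n) ht
    have yb : 0 <= Y := by
      have := esz S ht hP hn θ0 (x := 0) ⟨lrz, li⟩
      have : 0 <= (1 - (0 / (n:Rl)) ^ 2) ^ 3 * d.r t 0 := by simpa using rf
      linarith
    have ib : ∫ x in (0:Rl)..n, (2 * (en * chi n x * d.v t x) - (296 + 8 * mo ^ 2 + 4 * Y) * (rdd x * xp)) <=
        ∫ x in (0:Rl)..n, momR m d (kq n) kf kg kh t x := by
      have := hP.qcont
      refine imo li ((by fun_prop : Continuous _).intervalIntegrable _ _)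
        ((mcz S ht hP ck fp fp cs).intervalIntegrable _ _) fun x hx => ?_
      have ya : |x| <= n := alz.2 ⟨by linarith [hx.1], hx.2⟩
      have wa := cbd hn ya
      have wf := alz.1 (cbz hn ya); have wg := alz.1 (cbq n hn x ya); have wh := alz.1 (cbw n hn x ya)
      have dv : ∀ c : Rl, 0 <= c -> c / n <= c := fun c hc => dlsz hc nc
      have := dv 8 nu; have := dv 56 nu; have := dv 336 nu
      have es := esz S ht hP hn θ0 hx
      have ei : (1:Rl) <= xp := one_le_exp (by linarith [hx.1])
      have ee : en * xp = 1 := by rw [<- xad]; simp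
      have ej : en <= 1 := by rw [Real.exp_le_one_iff]; linarith [hx.1]
      have ep := xpp (-(2 * x))
      have rn : 0 <= drx := hP.nn x
      have hr : rdd x = drx := rfl
      set E := en; set F := xp; set R := drx
      have rF : R <= R * F := le_mul_of_one_le_right rn ei
      have bf : E * (-4 * aq n x + 4 * ar n x - au n x) * R <= 592 * (R * F) := by
        have : E * (-4 * aq n x + 4 * ar n x - au n x) <= 592 := by
          calc _ <= E * 592 := mll li ep.le
            _ <= _ := li
        have := mlr this rn
        linarith
      have bg : E * chi n x * mdx ^ 2 * R <= 4 * mo ^ 2 * (R * F) := by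
        have ma : 0 <= d.M t x := hP.M_nn x
        have mc : d.M t x <= 2 * mo := hP.M_le x
        have : mdx ^ 2 <= 4 * mo ^ 2 := by nlinarith
        have q : E * chi n x <= 1 := mloq ej wa.1 wa.2
        have qc : E * chi n x * mdx ^ 2 <= 1 * (4 * mo ^ 2) := mlmz q this (sqn _) zero_le_one
        have := mlr qc rn
        nlinarith
      have bh : -aq n x * R * R <= 8 * Y * (R * F) := by
        have q : x / n / n <= 1 := by
          rw [div_le_one po]; linarith [(alz.1 (dsl hn ya).1).2]
        have qa : 0 <= x / n / n := by have := hx.1; positivity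
        have : -aq n x * R * R = 8 * (x / n / n) * (xna ^ 3 * R) * R := by unfold aq; ring
        rw [this]
        calc _ <= 8 * (x / n / n) * Y * R := by gcongr
          _ <= 8 * 1 * Y * (R * F) := by gcongr
          _ = _ := by ring
      simp only [momR, kq, hv, bu, bx, hr]
      have ay : E * (-4 * aq n x + 4 * ar n x - au n x) * R = (E * (8 * chi n x - 12 * aq n x + 6 * ar n x - au n x) + 2 * (E * (-4 * chi n x + 4 * aq n x - ar n x))) * R := by ring
      have az : (-(E * chi n x) + 1 / 2 * (E * (2 * chi n x - aq n x))) * (R * (R * F)) = - 1 / 2 * aq n x * R * R := by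
        linear_combination (-1 / 2 * aq n x * R * R) * ee
      have bo : 0 <= -(E * aq n x * d.v t x) := by
        have : 0 <= x / n := by have := hx.1; positivity
        have q := (dsl hn ya).2
        have : 0 <= d.v t x := by unfold Dat.v; positivity
        have : 0 <= - aq n x := by
          have qd : 0 <= 1 - (x / n) ^ 2 := li
          have : - aq n x = 8 * (x / n) / n * xna ^ 3 := by unfold aq; ring
          rw [this]; positivity
        have : 0 <= E * -aq n x * d.v t x := po
        linarith
      linarith
    rw [isb ((cD.const_mul _).intervalIntegrable _ _)
      ((hP.qcont.const_mul _).intervalIntegrable _ _), icm, icm] at ib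
    have := miy hP (A := 0) (B := n) li
    have : (296 + 8 * mo ^ 2 + 4 * Y) * (∫ x in (0:Rl)..n, rdd x * xp) <=
      (296 + 8 * mo ^ 2 + 4 * Y) * (4 * mo) := by gcongr
    unfold Dat.Dn
    linarith
  have eY : 4 * Y * (4 * mo) = 1 / 2 * d.Dn n t + 4 * ((6 + 32 * mo) * (4 * mo)) * (4 * mo) := by
    rw [hY, hθ]; field_simp; ring
  rw [I, Jn]
  linarith
set_option maxHeartbeats 800000 in
lemma locsm (S : Sol m lo hi d) (X : SolX lo hi d fxt gxt) {a b : Rl} (hab : a < b) (ha : lo < a) (hb : b < hi)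
    (hP : ∀ t ∈ Icc a b, PMC rdd) :
    ∃ K, ∀ n : ℕ, 1 <= n -> ∫ t in a..b, ((t - a) * (b - t)) ^ 2 * d.Dn n t <= K := by
  have sub : Icc a b ⊆ Irl := fun t h => ⟨by linarith [h.1], by linarith [h.2]⟩
  obtain ⟨ka, fs⟩ : ∃ ka, ∀ t ∈ Icc a b, ja m d t <= ka := by
    have e : ∀ {G : Rl -> RR}, JC lo hi G -> ContinuousOn (fun t => G t 0) Irl := fun h => h.comp (f := fun t : Rl => (t, (0:Rl))) fp fun t ht => ⟨ht, muz _⟩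
    have := e S.cf; have := e S.cg; have := e S.cft; have := e S.cgt; have := e S.cfx; have := e S.cgx
    have c : ContinuousOn (ja m d) Irl := by
      unfold ja Dat.r Dat.v rr; fun_prop
    obtain ⟨K, h⟩ := (isCompact_Icc.image_of_continuousOn (c.mono sub)).bddAbove
    exact ⟨K, fun t ht => h ⟨t, ht, rfl⟩⟩
  have mf := (hP a ⟨lrz, hab.le⟩).hm
  set cb := (296 + 8 * mo ^ 2 + 4 * ((6 + 32 * mo) * (4 * mo))) * (4 * mo) with fi
  have cm : 0 <= cb := po
  set ce := (b - a) ^ 4 * (cb + |ka|) + (b - a) ^ 2 * (4 * mo) with fj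
  refine ⟨2 * (ce * (b - a)), fun n hn => ?_⟩
  have nc : (1:Rl) <= n := by exact_mod_cast hn
  have ck : Continuous (kq n) := by have := cct n; unfold kq; fun_prop
  have dP := fun t (ht : t ∈ Irl) => mdz S X (A := 0) (B := n) ck ht
  set P := fun t => ∫ x in (0:Rl)..n, kq n x * xp * d.p t x with hPd
  set P' := fun t => ∫ x in (0:Rl)..n, kq n x * xp * d.pt fxt gxt t x with hPt
  have cP : ContinuousOn P Irl := fun t ht => (dP t ht).continuousAt.continuousWithinAt
  have cP' : ContinuousOn P' Irl := cpq (fun t x => kq n x * xp * d.pt fxt gxt t x) (by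
    have := pcq S X; unfold JC at *; fun_prop)
  have cD : ContinuousOn (d.Dn n) Irl := cpq _ (DnI S n)
  have iI : ∀ {g : RR}, ContinuousOn g Irl -> IntervalIntegrable g volume a b := fun h =>
    (h.mono (by rw [uIcc_of_le hab.le]; exact sub)).intervalIntegrable
  have F := ftc (a := a) (b := b)
    (f := fun t => ((t - a) * (b - t)) ^ 2 * P t)
    (f' := fun t => 2 * ((t - a) * (b - t)) * ((b - t) - (t - a)) * P t + ((t - a) * (b - t)) ^ 2 * P' t)
    (fun t ht => by
      rw [uIcc_of_le hab.le] at ht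
      refine (((((hid t).sub_const a).mul ((hid t).const_sub b)).pow 2).mul (dP t (sub ht))).congr_deriv ?_
      simp only [hPd, hPt, id, Pi.mul_apply, Pi.pow_apply, Nat.cast_ofNat]; ring) (iI fp)
  have key : ∀ t ∈ Icc a b, 1 / 2 * (((t - a) * (b - t)) ^ 2 * d.Dn n t) - ce <=
      2 * ((t - a) * (b - t)) * ((b - t) - (t - a)) * P t + ((t - a) * (b - t)) ^ 2 * P' t := by
    intro t ht
    have hv := lm S X (sub ht) (hP t ht) hn
    have hJ := (fs t ht).trans (lasz _)
    have tb := ht.1; have tc := ht.2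
    have qb : (t - a) * (b - t) <= (b - a) ^ 2 := by nlinarith
    have qa : 0 <= (t - a) * (b - t) := mnn li li
    have qc : ((b - t) - (t - a)) ^ 2 <= (b - a) ^ 2 := by nlinarith
    set κ := (t - a) * (b - t); set κ' := (b - t) - (t - a)
    have qd : κ ^ 2 <= (b - a) ^ 4 := by nlinarith [sqn (b - a)]
    have bu : κ ^ 2 * (3 / 2 * d.Dn n t) <= κ ^ 2 * (P' t + (cb + |ka|)) := by
      refine mll ?_ (sqn _)
      simp only [hPt, fi]; linarith
    have bx : κ ^ 2 * (cb + |ka|) <= (b - a) ^ 4 * (cb + |ka|) := by gcongr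
    have cf := cts _ S.cf (sub ht); have cg := cts _ S.cg (sub ht)
    have cp := cts _ (pcz S) (sub ht)
    have cD := cts (fun t x => en * chi n x * d.v t x) (DnI S n) (sub ht)
    have cq := (hP t ht).qcont
    have bz : -(κ ^ 2 * d.Dn n t + κ' ^ 2 * ∫ x in (0:Rl)..n, rdd x * xp) <= 2 * κ * κ' * P t := by
      simp only [hPd, Dat.Dn]
      rw [<- icm, <- icm, <- icm, <- iad ((cD.const_mul _).intervalIntegrable _ _) ((cq.const_mul _).intervalIntegrable _ _), <- intervalIntegral.integral_neg]
      refine imo li ((by fun_prop : Continuous _).intervalIntegrable _ _)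
        ((by fun_prop : Continuous _).intervalIntegrable _ _) fun x hx => ?_
      have w := cbd hn (x := x) (alz.2 ⟨by linarith [hx.1], hx.2⟩)
      have ee : en * xp = 1 := by rw [<- xad]; simp
      have ei : en = exp (-x) ^ 2 := by rw [<- xnm]; congr 1; push_cast; ring
      have ej : xp = exp x ^ 2 := by rw [<- xnm]; congr 1
      have et : exp (-x) * exp x = 1 := by rw [<- xad]; simp
      have rf := (hP t ht).qnn x
      have : 2 * κ * κ' * (kq n x * xp * d.p t x) = -(chi n x * (2 * κ * κ' * d.p t x)) := by
        unfold kq; linear_combination (-2 * κ * κ' * chi n x * d.p t x) * ee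
      rw [this]
      have s : 2 * κ * κ' * d.p t x <= κ ^ 2 * (en * d.v t x) + κ' ^ 2 * (rdd x * xp) := by
        rw [ei, ej]; unfold Dat.p Dat.v rr
        have sd := sqn (κ * exp (-x) * gdx - κ' * exp x * fd)
        have se := sqn (κ * exp (-x) * fdx + κ' * exp x * gd)
        linear_combination sd + se - 2 * κ * κ' * (fd * gdx - gd * fdx) * et
      have sd := mll s w.1
      have se : chi n x * (κ' ^ 2 * (rdd x * xp)) <= κ' ^ 2 * (rdd x * xp) := mloz po w.2
      linarith
    have dy : κ' ^ 2 * (∫ x in (0:Rl)..n, rdd x * xp) <= (b - a) ^ 2 * (4 * mo) := by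
      have := miy (hP t ht) (A := 0) (B := n) li
      refine (mll this (sqn _)).trans ?_
      gcongr
    linarith
  have G := imo hab.le (iI fp) (iI fp) key
  rw [F, isb (iI fp) icz, icm] at G
  simp at G
  linarith
end

noncomputable section
def sE (m a t x : Rl) : Rl := exp (mo * xq)
def sM (m a t x : Rl) : Rl := 2 * mo * sE m a t x ^ 2 / sEa
def sF (m a γ t x : Rl) : Rl := sA m a x t * cos (γ + xp / (4 * t))
def sG (m a γ t x : Rl) : Rl := sA m a x t * sin (γ + xp / (4 * t))
def sFx (m a γ t x : Rl) : Rl := (m - sM m a t x) * sF m a γ t x - xp / (2 * t) * sG m a γ t x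
def sGx (m a γ t x : Rl) : Rl := (m - sM m a t x) * sG m a γ t x + xp / (2 * t) * sF m a γ t x
def sB (m a t x : Rl) : Rl := sM m a t x * (2 * mo - sM m a t x)
def dS (m a γ : Rl) : Dat where
  f := sF m a γ
  g := sG m a γ
  ft t x := -((m + 1 - sM m a t x) / t) * sF m a γ t x + xp / (4 * t ^ 2) * sG m a γ t x
  gt t x := -((m + 1 - sM m a t x) / t) * sG m a γ t x - xp / (4 * t ^ 2) * sF m a γ t x
  fx := sFx m a γ
  gx := sGx m a γ
  fxx t x := -sB m a t x * sF m a γ t x + (m - sM m a t x) * sFx m a γ t x - 2 * (xp / (2 * t)) * sG m a γ t x - xp / (2 * t) * sGx m a γ t x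
  gxx t x := -sB m a t x * sG m a γ t x + (m - sM m a t x) * sGx m a γ t x + 2 * (xp / (2 * t)) * sF m a γ t x + xp / (2 * t) * sFx m a γ t x
end
section
variable {m a γ t : Rl}
lemma sdk x : HasDerivAt (sE m a t) (mo * sE m a t x) x :=
  ((((hid x).sub_const a).sub_const (log (-t))).const_mul mo).exp.congr_deriv (by
    simp [sE]; ring)
lemma sdw (ht : t < 0) x : HasDerivAt (fun t => sE m a t x) (-(mo / t) * sE m a t x) t := by
  have h := (hid t).neg.log (by simpa using ht.ne)
  refine (((h.const_sub (x - a)).const_mul mo).exp).congr_deriv ?_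
  have := ht.ne
  simp only [sE, id, Pi.neg_apply]; field_simp
lemma sez x : sA m a x t = √8 * mo * sE m a t x / sEa * exp (-x) := by
  unfold sA sE; rw [<- xnm]; congr 4; push_cast; ring_nf
lemma sdq x : HasDerivAt (fun x => sA m a x t) ((m - sM m a t x) * sA m a x t) x := by
  simp_rw [sez]
  have h := sdk (m := m) (a := a) (t := t) x
  have p : sEa ≠ 0 := po
  refine (((h.const_mul (√8 * mo)).fun_div ((h.fun_pow 2).const_add 1) p).fun_mul (hasDerivAt_neg x).exp).congr_deriv ?_
  simp only [sM]; push_cast; field_simp; ring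
lemma sdqz x : HasDerivAt (sM m a t) (sB m a t x) x := by
  have h := sdk (m := m) (a := a) (t := t) x
  have p : sEa ≠ 0 := po
  refine (((h.pow 2).const_mul (2 * mo)).div ((h.pow 2).const_add 1) p).congr_deriv ?_
  simp only [sB, sM, Pi.pow_apply]; push_cast; field_simp
lemma sdz (ht : t < 0) x :
    HasDerivAt (fun t => sA m a x t) (-((m + 1 - sM m a t x) / t) * sA m a x t) t := by
  simp_rw [sez]
  have h := sdw (m := m) (a := a) ht x
  have p : sEa ≠ 0 := po
  have := ht.ne
  refine (((h.const_mul (√8 * mo)).fun_div ((h.fun_pow 2).const_add 1) p).mul_const (exp (-x))).congr_deriv ?_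
  simp only [sM]; push_cast; field_simp; ring
lemma sq_dx x : HasDerivAt (fun x => xp / (2 * t)) (2 * (xp / (2 * t))) x :=
  ((bt x).div_const _).congr_deriv (by ring)
lemma sp_dx (ht : t < 0) x : HasDerivAt (fun x => γ + xp / (4 * t)) (xp / (2 * t)) x :=
  (((bt x).div_const (4 * t)).const_add γ).congr_deriv (by have := ht.ne; field_simp; norm_num)
lemma sp_dt (ht : t < 0) x : HasDerivAt (fun t => γ + xp / (4 * t)) (-(xp / (4 * t ^ 2))) t := by
  have := ht.ne
  refine ((((hid t).const_mul 4).inv (by simpa using this)).const_mul xp |>.const_add γ).congr_deriv ?_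
  simp only [id]; field_simp
lemma sdy (ht : t < 0) x : HasDerivAt (sF m a γ t) (sFx m a γ t x) x :=
  ((sdq x).mul (sp_dx ht x).cos).congr_deriv (by unfold sFx sF sG; ring)
lemma sdzz (ht : t < 0) x : HasDerivAt (sG m a γ t) (sGx m a γ t x) x :=
  ((sdq x).mul (sp_dx ht x).sin).congr_deriv (by unfold sGx sF sG; ring)
lemma srz x : rsg x = sA m a x t ^ 2 := by
  have := Real.sin_sq_add_cos_sq (γ + xp / (4 * t))
  unfold rr sF sG; linear_combination sA m a x t ^ 2 * this
lemma sqq x : rsg x * xp = 2 * sB m a t x := by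
  have p : sEa ≠ 0 := po
  have e : exp (-x) ^ 2 * xp = 1 := by rw [<- xnm, <- xad]; simp
  have sk : √8 ^ 2 = 8 := sq_sqrt nu
  rw [srz, sez]
  calc _ = √8 ^ 2 * (mo * sE m a t x / sEa) ^ 2 * (exp (-x) ^ 2 * xp) := by ring
    _ = _ := by rw [e, sk]; unfold sB sM; field_simp; ring
lemma s_dec (hm : 1 <= m) x : 2 * sB m a t x <= 8 * mo ^ 2 * exp (-|x - a - log (-t)|) ∧
    xp * (2 * sB m a t x) <=
      8 * mo ^ 2 * (exp (2 * (a + log (-t))) * exp (-|x - a - log (-t)|)) := by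
  set y := x - a - log (-t) with hy
  have ex : xp = exp (2 * (a + log (-t))) * exp (2 * y) := by
    rw [<- xad]; congr 1; rw [hy]; ring
  have eB : 2 * sB m a t x = 8 * mo ^ 2 * (sE m a t x ^ 2 / sEa ^ 2) := by
    have p : sEa ≠ 0 := po
    unfold sB sM; field_simp; ring
  have ei : sE m a t x ^ 2 = exp (2 * mo * y) := by unfold sE; rw [<- xnm]; congr 1; push_cast; ring
  have pa : 0 < sE m a t x ^ 2 := by unfold sE; positivity
  have bf : sE m a t x ^ 2 / sEa ^ 2 <= exp (2 * mo * y) := by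
    rw [<- ei]; exact dlsz pa.le (by nlinarith)
  have bg : sE m a t x ^ 2 / sEa ^ 2 <= exp (-(2 * mo * y)) := by
    rw [exp_neg, <- ei, inv_eq_one_div, div_le_div_iff₀ po pa]; nlinarith
  set w := sE m a t x ^ 2 / sEa ^ 2
  have cn : w <= exp (-|y|) ∧ exp (2 * y) * w <= exp (-|y|) := by
    rcases le_or_gt 0 y with h | h
    · rw [abn h]
      refine ⟨bg.trans (relz.2 (by nlinarith)), (mll bg (xpp _).le).trans ?_⟩
      rw [<- xad]; exact relz.2 (by nlinarith)
    · rw [abs_of_neg h]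
      refine ⟨bf.trans (relz.2 (by nlinarith)), (mll bf (xpp _).le).trans ?_⟩
      rw [<- xad]; exact relz.2 (by nlinarith)
  rw [eB, ex]
  refine ⟨mll cn.1 po, ?_⟩
  have := mll cn.2 (by positivity : 0 <= 8 * mo ^ 2 * exp (2 * (a + log (-t))))
  linarith
lemma slz (hm : 1 <= m) : Tendsto (sM m a t) atBot (𝓝 0) ∧ Tendsto (sM m a t) atTop (𝓝 (2 * mo)) := by
  have me : 0 < m + 1 := li
  have e : forall x, sE m a t x ^ 2 = exp (2 * mo * xq) := fun x => by
    unfold sE; rw [<- xnm]; congr 1; push_cast; ring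
  have ej : forall x, sM m a t x = 2 * mo - 2 * mo / sEa := fun x => by
    have p : sEa ≠ 0 := po
    unfold sM; field_simp; ring
  have lb : Tendsto (fun x : Rl => 2 * mo * xq) atBot atBot := Tendsto.const_mul_atBot po (taaz _ _ (taaz _ _ tiz))
  have lt : Tendsto (fun x : Rl => 2 * mo * xq) atTop atTop := Tendsto.const_mul_atTop po (tendsto_atTop_add_const_right _ _ (tendsto_atTop_add_const_right _ _ tiz))
  constructor
  · have h := (rtez.comp lb)
    have : Tendsto (fun x => 2 * mo - 2 * mo / (1 + exp (2 * mo * xq))) atBot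
        (𝓝 (2 * mo - 2 * mo / (1 + 0))) := ((tendsto_const_nhds).div (h.const_add 1) nu).const_sub _
    simp only [add_zero, div_one, sub_self] at this
    exact this.congr fun x => by rw [ej, e]
  · have h := tendsto_atTop_add_const_left atTop 1 (Real.tendsto_exp_atTop.comp lt)
    have := (h.const_div_atTop (2 * mo)).const_sub (2 * mo)
    simp only [sub_zero] at this
    exact this.congr fun x => by rw [ej, e]; rfl
lemma spz (hm : 1 <= m) (ht : t < 0) {C : Rl} (hC : 8 * mo ^ 2 * exp (-(2 * mo * (a + log (-t)))) <= C) :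
    PMC rsg ∧ forall x, Mm rsg x = sM m a t x := by
  have cf : Continuous (sF m a γ t) := cic.2 fun x => (sdy ht x).continuousAt
  have cg : Continuous (sG m a γ t) := cic.2 fun x => (sdzz ht x).continuousAt
  have cM : Continuous (sM m a t) := cic.2 fun x => (sdqz x).continuousAt
  have sub : ∀ x : Rl, x - (a + log (-t)) = x - a - log (-t) := fun x => by ring
  have iB : Integrable (fun x => 2 * sB m a t x) := by
    refine iob ((iea.comp_sub_right (a + log (-t))).const_mul (8 * mo ^ 2)) (by unfold sB; fun_prop) fun x => ?_
    rw [abn, sub]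
    · exact (s_dec hm x).1
    · rw [<- sqq (γ := γ)]; unfold rr; positivity
  have hq : (fun x => rsg x * xp) = fun x => 2 * sB m a t x := funext sqq
  have L := slz (m := m) (a := a) (t := t) hm
  have dM : forall x, HasDerivAt (fun x => 2 * sM m a t x) (2 * sB m a t x) x := fun x => (sdqz x).const_mul 2
  refine ⟨⟨hm, ltz po hC, by unfold rr; fun_prop, fun x => by unfold rr; positivity, by rwa [hq], ?_, ?_⟩, ?_⟩
  · rw [hq, iohz dM iB (L.1.const_mul 2) (L.2.const_mul 2)]; ring
  · intro x hx
    rw [srz, sez]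
    have sk : √8 ^ 2 = 8 := sq_sqrt nu
    calc _ = 8 * mo ^ 2 * ((sE m a t x) ^ 2 * exp (-x) ^ 2) / sEa ^ 2 := by
          rw [mul_pow, div_pow, mul_pow, mul_pow, sk]; ring
      _ <= 8 * mo ^ 2 * ((sE m a t x) ^ 2 * exp (-x) ^ 2) := dlsz po (by nlinarith [sqn (sE m a t x)])
      _ <= 8 * mo ^ 2 * (exp (-(2 * mo * (a + log (-t)))) * xp) := by
          refine mll ?_ po
          unfold sE
          rw [<- xnm, <- xnm, <- xad, <- xad]
          refine relz.2 ?_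
          push_cast; nlinarith
      _ <= _ := by rw [<- maz]; gcongr
  · intro x
    unfold Mm
    rw [hq, integral_Iic_of_hasDerivAt_of_tendsto (f := fun x => 2 * sM m a t x)
      (dM x).continuousAt.continuousWithinAt (fun y _ => dM y) iB.integrableOn (L.1.const_mul 2)]
    ring
lemma ssz (hm : 1 <= m) (lo : Rl) : Sol m lo 0 (dS m a γ) := by
  have cl : ContinuousOn (fun p : RxR => log (-p.1)) (Ioo lo 0 ×ˢ univ) :=
    ContinuousOn.log fp fun p hp => by have := hp.1.2.ne; simpa using this
  have ci : ∀ {g h : Rl × Rl -> Rl}, Continuous g -> Continuous h -> (forall p, p.1 < 0 -> h p ≠ 0) -> ContinuousOn (fun p : RxR => g p / h p) (Ioo lo 0 ×ˢ univ) := fun hg hh hj => hg.continuousOn.div hh.continuousOn fun p hp => hj p hp.1.2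
  have ib := ci (g := fun p => exp (2 * p.2)) (h := fun p => 4 * p.1) fp fp fun p hp => by have := hp.ne; positivity
  have ic := ci (g := fun p => exp (2 * p.2)) (h := fun p => 2 * p.1) fp fp fun p hp => by have := hp.ne; positivity
  have ie := ci (g := fun p => exp (2 * p.2)) (h := fun p => 4 * p.1 ^ 2) fp fp fun p hp => by have := hp.ne; positivity
  have cE : JC lo 0 (sE m a) := by unfold JC sE; fun_prop
  have cM : JC lo 0 (sM m a) := by
    unfold JC sM at *
    exact (by fun_prop : ContinuousOn (fun p : RxR => 2 * mo * sE m a p.1 p.2 ^ 2) _).div fp fun p _ => po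
  have cA : JC lo 0 (fun t x => sA m a x t) := by
    simp_rw [sez]
    unfold JC at *
    exact ((by fun_prop : ContinuousOn (fun p : RxR => √8 * mo * sE m a p.1 p.2) _).div fp fun p _ => po).mul fp
  have cF : JC lo 0 (sF m a γ) := by unfold JC sF at *; fun_prop
  have cG : JC lo 0 (sG m a γ) := by unfold JC sG at *; fun_prop
  have cFx : JC lo 0 (sFx m a γ) := by unfold JC sFx at *; fun_prop
  have cGx : JC lo 0 (sGx m a γ) := by unfold JC sGx at *; fun_prop
  have cN : ContinuousOn (fun p : RxR => (m + 1 - sM m a p.1 p.2) / p.1) (Ioo lo 0 ×ˢ univ) :=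
    ContinuousOn.div jcf fp fun p hp => hp.1.2.ne
  have cB : JC lo 0 (sB m a) := by unfold JC sB at *; fun_prop
  have eqs : ∀ t ∈ Ioo lo 0, forall x, (dS m a γ).W m t x = m ^ 2 - 2 * sB m a t x + 2 * sM m a t x := fun t ht x => by
    have P := spz (γ := γ) (a := a) hm ht.2 lrz
    have := zpz P.1 (fun x => by rw [P.2, sqq]; rfl) x
    unfold Dat.W
    rw [P.2] at this
    show m ^ 2 + xp * Vv m rsg x = _
    rw [this]; unfold sB; ring
  have ex : ∀ t < 0, ∀ x : Rl, xp = 2 * t * (xp / (2 * t)) ∧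
      xp / (4 * t ^ 2) = (xp / (2 * t)) / (2 * t) := fun t ht x => by
    have := ht.ne
    constructor <;> field_simp; norm_num
  refine ⟨cF, cG, ?_, ?_, cFx, cGx, ?_, ?_, ?_, ?_, fun t ht x => sdy ht.2 x, fun t ht x => sdzz ht.2 x, ?_, ?_, ?_, ?_⟩
  · unfold JC dS at *; dsimp only; fun_prop
  · unfold JC dS at *; dsimp only; fun_prop
  · unfold JC dS at *; dsimp only; fun_prop
  · unfold JC dS at *; dsimp only; fun_prop
  · exact fun t ht x => ((sdz ht.2 x).mul (sp_dt ht.2 x).cos).congr_deriv (by simp only [dS, sF, sG]; ring)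
  · exact fun t ht x => ((sdz ht.2 x).mul (sp_dt ht.2 x).sin).congr_deriv (by simp only [dS, sF, sG]; ring)
  · exact fun t ht x => ((((sdqz x).const_sub m).mul (sdy ht.2 x)).sub ((sq_dx x).mul (sdzz ht.2 x))).congr_deriv (by
      simp only [dS]; ring)
  · exact fun t ht x => ((((sdqz x).const_sub m).mul (sdzz ht.2 x)).add ((sq_dx x).mul (sdy ht.2 x))).congr_deriv (by
      simp only [dS]; ring)
  · intro t ht x
    have ta := ht.2.ne
    rw [eqs t ht x]
    obtain ⟨ei, ej⟩ := ex t ht.2 x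
    simp only [dS, ej]
    unfold sFx sGx sB
    generalize xp / (2 * t) = P at *
    rw [ei]
    field_simp; ring
  · intro t ht x
    have ta := ht.2.ne
    rw [eqs t ht x]
    obtain ⟨ei, ej⟩ := ex t ht.2 x
    simp only [dS, ej]
    unfold sFx sGx sB
    generalize xp / (2 * t) = P at *
    rw [ei]
    field_simp; ring
lemma spq (hm : 1 <= m) {c b : Rl} (hb : b < 0) :
    ∃ C, ∀ t ∈ Icc c b, ProfH m C (sF m a γ t) (sG m a γ t) (sFx m a γ t) (sGx m a γ t) := by
  set kb : RR := fun t => 8 * mo ^ 2 * exp (-(2 * mo * (a + log (-t)))) with hv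
  set kc : RR := fun t => 4 * mo ^ 2 * (kb t * ed + 4 * mo) +
    8 * mo ^ 2 * (exp (2 * (a + log (-t))) * ed) / (4 * t ^ 2) with bu
  have sub : ∀ t ∈ Icc c b, t < 0 := fun t ht => ht.2.trans_lt hb
  have cK : ContinuousOn (fun t => kb t + kc t) (Icc c b) := by
    have cl : ContinuousOn (fun t : Rl => log (-t)) (Icc c b) :=
      ContinuousOn.log fp fun t ht => by have := (sub t ht).ne; simpa using this
    refine ContinuousOn.add fp (ContinuousOn.add fp (ContinuousOn.div fp fp fun t ht => ?_))
    have := (sub t ht).ne; positivity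
  obtain ⟨C, hC⟩ := (isCompact_Icc.image_of_continuousOn cK).bddAbove
  refine ⟨C, fun t ht => ?_⟩
  have ta := sub t ht
  have hC' : kb t + kc t <= C := hC ⟨t, ht, rfl⟩
  have E0n := ezn
  have qb : 0 <= kb t := by simp only [hv]; positivity
  have qc : 0 <= kc t := by simp only [bu]; positivity
  obtain ⟨P, PM⟩ := spz (γ := γ) (a := a) hm ta (C := C) li
  have pb := (spz (γ := γ) (a := a) hm ta lrz).1
  have cfx : Continuous (sFx m a γ t) := cts _ (ssz hm (t - 1)).cfx ⟨li, ta⟩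
  have cgx : Continuous (sGx m a γ t) := cts _ (ssz hm (t - 1)).cgx ⟨li, ta⟩
  set G : RR := fun x => 4 * mo ^ 2 * rsg x +
    8 * mo ^ 2 * (exp (2 * (a + log (-t))) * exp (-|x - (a + log (-t))|)) / (4 * t ^ 2) with hG
  have iE := iea.comp_sub_right (a + log (-t))
  have iG : Integrable G := (pb.r_int.const_mul _).add (((iE.const_mul _).const_mul _).div_const _)
  have bd : forall x, sFx m a γ t x ^ 2 + sGx m a γ t x ^ 2 <= G x := fun x => by
    have e : sFx m a γ t x ^ 2 + sGx m a γ t x ^ 2 = (m - sM m a t x) ^ 2 * rsg x +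
        xp * (rsg x * xp) / (4 * t ^ 2) := by
      have := ta.ne
      unfold sFx sGx rr; field_simp; ring
    have s := (s_dec (a := a) (t := t) hm x).2
    rw [e, sqq, hG]
    have ma := P.M_nn x; have mc := P.M_le x
    rw [PM] at ma mc
    have : (m - sM m a t x) ^ 2 <= 4 * mo ^ 2 := by nlinarith
    have := P.nn x
    dsimp only
    rw [show x - (a + log (-t)) = x - a - log (-t) by ring]
    gcongr
  have i' : Integrable (fun x => sFx m a γ t x ^ 2 + sGx m a γ t x ^ 2) :=
    iob iG fp fun x => by rw [abn po]; exact bd x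
  refine ⟨P, sdy ta, sdzz ta, cfx, cgx, i', ?_⟩
  have := imz i' iG bd
  rw [hG, iaz (pb.r_int.const_mul _) (((iE.const_mul _).const_mul _).div_const _), ntcm, integral_div, ntcm, ntcm, integral_sub_right_eq_self (fun x => exp (-|x|))] at this
  have r := mll pb.r_tot (by positivity : 0 <= 4 * mo ^ 2)
  have : kc t = 4 * mo ^ 2 * (kb t * ed + 4 * mo) + 8 * mo ^ 2 * (exp (2 * (a + log (-t))) * ed) / (4 * t ^ 2) := rfl
  unfold ed at *
  linarith
end

lemma ilq {F : RR} (h : Integrable F) (hj : forall x, 0 <= F x) {A B : Rl} (hAB : A <= B) :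
    ∫ x in A..B, F x <= ∫ x, F x := by
  rw [iol hAB]
  exact sli h (evf hj)
lemma crs (a b c e : Rl) : |a * b - c * e| <= ((a ^ 2 + c ^ 2) + (b ^ 2 + e ^ 2)) / 2 := by
  rw [alz]
  constructor <;> linarith [sqn (a - b), sqn (a + b), sqn (c - e), sqn (c + e)]
lemma adz (f g p q : Rl) : (g * p - f * q) ^ 2 <= fpq * pq ∧
    |(f ^ 2 + g ^ 2) - pq| * |g * p - f * q| <=
      fpq * ((f ^ 2 + g ^ 2) + 2 * pq) := by
  have hv : (g * p - f * q) ^ 2 <= fpq * pq := by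
    linarith [sqn ((f - p) * p + (g - q) * q)]
  refine ⟨hv, ?_⟩
  have bu : ((f ^ 2 + g ^ 2) - pq) ^ 2 <=
      fpq * (2 * ((f ^ 2 + g ^ 2) + pq)) := by
    have : fpq * ((f + p) ^ 2 + (g + q) ^ 2) <=
      fpq * (2 * ((f ^ 2 + g ^ 2) + pq)) := by
      refine mll ?_ po
      linarith [sqn (f - p), sqn (g - q)]
    refine ltz ?_ this
    linarith [sqn ((f - p) * (g + q) - (g - q) * (f + p))]
  rw [<- amz]
  refine aloz ?_ po
  have := mlmz bu hv po po
  rw [mul_pow]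
  refine this.trans ?_
  set D := (f - p) ^ 2 + (g - q) ^ 2
  set a := f ^ 2 + g ^ 2 with ha
  set b := p ^ 2 + q ^ 2 with hb
  have ad : 0 <= a := po
  have bc : 0 <= b := po
  have : 2 * (a + b) * b <= (a + 2 * b) ^ 2 := by nlinarith [mnn ad bc]
  linarith [mll this (sqn D)]
section
variable {m lo hi C C' : Rl} {d s : Dat} {fxt gxt : Rl -> RR}
def Dat.Rt (d s : Dat) (t x : Rl) : Rl := d.ft t x * fsx + fd * s.ft t x + (d.gt t x * gsx + gd * s.gt t x)
def Dat.Y (d s : Dat) (t : Rl) : Rl := di (d.f t) (d.g t) (s.f t) (s.g t)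
lemma Rder (S : Sol m lo hi d) (T : Sol m lo hi s) {t} (ht : t ∈ Irl)
    {n : ℕ} (hn : 1 <= n) (cV : Continuous (Vv m rdd)) (cV' : Continuous (Vv m rs)) :
    ∫ x in (-(n:Rl))..n, chi n x * (xp * d.Rt s t x) = ∫ x in (-(n:Rl))..n, (ar n x * (fd * gsx - gd * fsx) - 2 * aq n x * (gd * s.fx t x - fd * s.gx t x) + chi n x * (xp * ((Vv m rdd x - Vv m rs x) *
        (gd * fsx - fd * gsx)))) := by
  set J : RR := fun x => chi n x * (-gdx * fsx + gd * s.fx t x + (fdx * gsx - fd * s.gx t x))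
    - aq n x * (fd * gsx - gd * fsx) with hJ
  have cf := cts _ S.cf ht; have cg := cts _ S.cg ht
  have cft := cts _ S.cft ht; have cgt := cts _ S.cgt ht
  have cfx := cts _ S.cfx ht; have cgx := cts _ S.cgx ht
  have sf := cts _ T.cf ht; have sg := cts _ T.cg ht
  have sft := cts _ T.cft ht; have sgt := cts _ T.cgt ht
  have sfx := cts _ T.cfx ht; have sgx := cts _ T.cgx ht
  have cj := cct n; have cn := ccz n
  have co : Continuous (ar n) := by unfold ar; fun_prop
  set fb : RR := fun x => chi n x * (xp * d.Rt s t x) with fq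
  set fc : RR := fun x => (ar n x * (fd * gsx - gd * fsx) - 2 * aq n x * (gd * s.fx t x - fd * s.gx t x) + chi n x * (xp * ((Vv m rdd x - Vv m rs x) *
        (gd * fsx - fd * gsx)))) with fr
  have kf : Continuous fb := by simp only [fq, Dat.Rt]; fun_prop
  have kg : Continuous fc := by simp only [fr]; fun_prop
  have hd : forall x, HasDerivAt J (fb x - fc x) x := fun x => by
    have := ((cdw n x).fun_mul ((((S.dgx t ht |> fun _ => S.dgxx t ht x).fun_neg.fun_mul (T.dfx t ht x)).fun_add
      ((S.dgx t ht x).fun_mul (T.dfxx t ht x))).fun_add (((S.dfxx t ht x).fun_mul (T.dgx t ht x)).fun_sub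
      ((S.dfx t ht x).fun_mul (T.dgxx t ht x))))).fun_sub ((cdz n x).fun_mul
      (((S.dfx t ht x).fun_mul (T.dgx t ht x)).fun_sub ((S.dgx t ht x).fun_mul (T.dfx t ht x))))
    refine this.congr_deriv ?_
    have ei := S.bp t ht x; have ej := S.bq t ht x
    have et := T.bp t ht x; have eu := T.bq t ht x
    simp only [fq, fr, Dat.Rt]
    unfold Dat.W at ei ej et eu
    linear_combination (-chi n x) * (fsx * ei + fd * et + gsx * ej + gd * eu)
  have F := ftc (a := -(n:Rl)) (b := n) (fun y _ => hd y)
    ((kf.sub kg).intervalIntegrable _ _)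
  rw [isb (kf.intervalIntegrable _ _) (kg.intervalIntegrable _ _)] at F
  have z := ceq n hn; have z' := cez n hn
  simp only [hJ, z.1, z.2, z'.1.1, z'.2.1] at F
  linarith
lemma dyz {fe gb ff gc : RR} (hv : PMC rfa) (bu : Prof m C' rfb)
    (c : Continuous dda) x : |Zz m rfa x - Zz m rfb x| <=
      4 * mo * (√(Dda * (C + C' + 4 * mo)) * exp (-x)) := by
  have hm := hv.hm; have := hv.hC; have := bu.hC
  have eh := integral_exp_neg_Ioi x
  rw [<- eh, <- ntcm]
  refine doz hv bu x _ ((integrableOn_exp_neg_Ioi x).const_mul _) fun y _ => ?_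
  have a : (Mm rfa y - Mm rfb y) ^ 2 <= Dda * (C + C' + 4 * mo) * exp (2 * y) := by
    refine (dsq hv bu c y).trans ?_
    rw [maz]
    refine mll ?_ (dtn _ _ _ _)
    have bf := hv.M_bd y; have bg := bu.M_bd y
    have : exp (2 * y - 2 * |y|) <= exp (2 * y) := relz.2 (by linarith [abnn y])
    nlinarith
  have b : |Mm rfa y - Mm rfb y| <= √(Dda * (C + C' + 4 * mo)) * exp y := by
    refine aloz ?_ po
    rw [mul_pow, sq_sqrt (mnn (dtn _ _ _ _) li), <- xnm]
    exact_mod_cast a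
  calc _ <= √(Dda * (C + C' + 4 * mo)) * exp y * exp (-(2 * y)) := by gcongr
    _ = _ := by rw [maz, <- xad]; ring_nf
lemma third {f g p q V y M Z e k : Rl} (yc : 0 <= y) (he : 0 < e) (hk : 0 <= M)
    (hV : V = -((f ^ 2 + g ^ 2) - pq) - 2 * Z) (hZ : |Z| <= M * (√(y * k) * e⁻¹)) :
    |e ^ 2 * (V * (g * p - f * q))| <= fpq * e ^ 2 * ((f ^ 2 + g ^ 2) + 2 * pq) +
      M * √k * (fpq * e ^ 2 + y * pq) := by
  obtain ⟨hv, bu⟩ := adz f g p q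
  set D := (f - p) ^ 2 + (g - q) ^ 2
  set A := g * p - f * q
  have bx : √y * e * |A| <= (D * e ^ 2 + y * pq) / 2 := by
    refine (lasz _).trans (aloz ?_ po)
    rw [mul_pow, mul_pow, sq_sqrt yc, sq_abs]
    have := mll hv (by positivity : 0 <= y * e ^ 2)
    linarith [sqn (D * e ^ 2 - y * pq)]
  have bz : e ^ 2 * (2 * |Z|) * |A| <= M * √k * (D * e ^ 2 + y * pq) := by
    calc _ <= e ^ 2 * (2 * (M * (√(y * k) * e⁻¹))) * |A| := by gcongr
      _ = 2 * M * √k * (√y * e * |A|) := by rw [Real.sqrt_mul yc]; field_simp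
      _ <= 2 * M * √k * ((D * e ^ 2 + y * pq) / 2) := by gcongr
      _ = _ := by ring
  rw [hV, amz, amz, abp (by positivity : 0 < e ^ 2)]
  have dy : |-((f ^ 2 + g ^ 2) - pq) - 2 * Z| <= |(f ^ 2 + g ^ 2) - pq| + 2 * |Z| := by
    refine (abs_sub _ _).trans ?_
    rw [abs_neg, amz]; norm_num
  have := mlr dy (by positivity : 0 <= e ^ 2 * |A|)
  have := mll bu (by positivity : 0 <= e ^ 2)
  linarith
set_option maxHeartbeats 800000 in
lemma ub (S : Sol m lo hi d) (T : Sol m lo hi s) {t} (ht : t ∈ Irl)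
    (hP : PMC rdd) (hT : ProfH m C' (s.f t) (s.g t) (s.fx t) (s.gx t))
    {n : ℕ} (hn : 1 <= n) {θ : Rl} (hθ : 0 < θ) :
    |∫ x in (-(n:Rl))..n, chi n x * (xp * d.Rt s t x)| <= (36 * (C * ed + 4 * mo) + 28 * (C' * ed + 4 * mo) + 8 * C') / n + (C + 3 * (θ * d.Dn (2 * n) t + (6 + 1 / θ) * (4 * mo)) + 2 * KH m C' +
        4 * mo * √(C + C' + 4 * mo) * (1 + (C' * ed + 4 * mo))) * d.Y s t := by
  have hm := hP.hm; have hC := hP.hC; have hC' := hT.prof.hC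
  have nc : (1:Rl) <= n := by exact_mod_cast hn
  have nl : -(n:Rl) <= n := li
  have cf := cts _ S.cf ht; have cg := cts _ S.cg ht
  have sf := cts _ T.cf ht; have sg := cts _ T.cg ht
  have cd : Continuous dds := by unfold dl; fun_prop
  have iD := diz hP hT.prof cd
  have yc : 0 <= d.Y s t := dtn _ _ _ _
  set B := C + 3 * (θ * d.Dn (2 * n) t + (6 + 1 / θ) * (4 * mo)) with hB
  set M := 4 * mo with hM
  set k := C + C' + 4 * mo with hk
  have ke : 0 <= k := by rw [hk]; linarith
  have ma : 0 <= M := by rw [hM]; linarith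
  have nd : 1 <= 2 * n := by omega
  have da : 0 <= d.Dn (2 * n) t := by
    refine iinz po fun x hx => ?_
    have := (cbd nd (alz.2 ⟨by linarith [hx.1, (ncnz (2 * n) : (0:Rl) <= _)], hx.2⟩)).1
    unfold Dat.v; positivity
  have hr : ∀ x ≤ (n:Rl), rdd x <= B := fun x hx => by
    have qa : 0 <= 3 * (θ * d.Dn (2 * n) t + (6 + 1 / θ) * M) := po
    rcases le_total x 0 with h | h
    · have := hP.near x h
      have : xp <= 1 := Real.exp_le_one_iff.2 li
      nlinarith
    · have E := esz S ht hP nd hθ (x := x) ⟨h, by push_cast; linarith⟩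
      have z : (x / (2 * n : ℕ)) ^ 2 <= 1 / 4 := by
        push_cast
        have : x / (2 * n) <= 1 / 2 := by rw [div_le_div_iff₀ po nu]; linarith
        have : 0 <= x / (2 * n) := po
        nlinarith
      have ze : (3/4:Rl) ^ 3 <= (1 - (x / (2 * n : ℕ)) ^ 2) ^ 3 := by gcongr; linarith
      have := hP.nn x
      have e : drx = rdd x := rfl
      rw [e] at E
      have := mlr ze (hP.nn x)
      rw [hB]; nlinarith
  have hs : forall x, rs x <= KH m C' := hT.r_sup
  rw [Rder S T ht hn hP.V_cont hT.prof.V_cont]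
  set G : RR := fun x => (1 / n) * (36 * rdd x + 28 * rs x + 8 * (s.fx t x ^ 2 + s.gx t x ^ 2)) + ((B + 2 * KH m C' + M * √k) * (dds x * xp) +
      M * √k * d.Y s t * rs x) with hG
  have kd : 0 <= KH m C' := hT.KH_nn
  have ba : 0 <= B := by rw [hB]; positivity
  have HIG : HI G _ := ((((hio hP.r_int).mul 36).add ((hio hT.prof.r_int).mul 28)).add ((hio hT.int').mul 8)).mul (1 / n)
    |>.add (((hio iD).mul (B + 2 * KH m C' + M * √k)).add ((hio hT.prof.r_int).mul (M * √k * d.Y s t)))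
  have ga : forall x, 0 <= G x := fun x => by
    have := hP.nn x; have := hT.prof.nn x; have := dln (d.f t) (d.g t) (s.f t) (s.g t) x
    simp only [hG]; positivity
  have main := inl (a := -(n:Rl)) (b := n) (μ := volume) (f := fun x => (ar n x * (fd * gsx - gd * fsx) - 2 * aq n x * (gd * s.fx t x - fd * s.gx t x) + chi n x * (xp * ((Vv m rdd x - Vv m rs x) *
        (gd * fsx - fd * gsx))))) (g := G) nl (aoaz _ fun x hx => by
    have hxa : |x| <= n := alz.2 ⟨hx.1.le, hx.2⟩
    have bc := cbd hn hxa
    have bf := cbz hn hxa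
    have bg := cbq n hn x hxa
    have dZ := dyz hP hT.prof cd x
    rw [exp_neg] at dZ
    have td := third (f := fd) (g := gd) (p := fsx) (q := gsx)
      (V := Vv m rdd x - Vv m rs x) yc (xpp x) ma
      (by unfold Vv rr; ring) dZ
    have ee : exp x ^ 2 = xp := by rw [<- xnm]; norm_num
    rw [ee] at td
    have rg := hr x hx.2; have rh := hs x
    have dn := dln (d.f t) (d.g t) (s.f t) (s.g t) x
    have td' : |xp * ((Vv m rdd x - Vv m rs x) * (gd * fsx - fd * gsx))| <= (B + 2 * KH m C' + M * √k) * (dds x * xp) +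
      M * √k * d.Y s t * rs x := by
      have : dds x * xp * (rdd x + 2 * rs x) <=
        dds x * xp * (B + 2 * KH m C') := by gcongr
      refine td.trans ?_
      unfold dl rr at *
      linarith
    have cn : |ar n x * (fd * gsx - gd * fsx)| <= 56 / n * ((rdd x + rs x) / 2) := by
      rw [amz]
      refine mlmz bg ?_ (abnn _) po
      exact (crs _ _ _ _).trans (by unfold rr; linarith)
    have co : |2 * aq n x * (gd * s.fx t x - fd * s.gx t x)| <= 2 * (8 / n) * ((rdd x + (s.fx t x ^ 2 + s.gx t x ^ 2)) / 2) := by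
      rw [amz, amz, abs_two]
      refine mlmz li ?_ (abnn _) po
      exact (crs _ _ _ _).trans (by unfold rr; linarith)
    have cs := mll td' (abnn (chi n x))
    rw [<- amz] at cs
    have ct : |chi n x| <= 1 := alz.2 ⟨by linarith [bc.1], bc.2⟩
    have cu := mlr ct ((abnn _).trans td')
    rw [rnez]
    refine (aalz _ _).trans ?_
    have cv := abs_sub (ar n x * (fd * gsx - gd * fsx)) (2 * aq n x * (gd * s.fx t x - fd * s.gx t x))
    simp only [hG]
    have : 56 / (n:Rl) * ((rdd x + rs x) / 2) + 2 * (8 / n) * ((rdd x + (s.fx t x ^ 2 + s.gx t x ^ 2)) / 2) =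
      (1 / n) * (36 * rdd x + 28 * rs x + 8 * (s.fx t x ^ 2 + s.gx t x ^ 2)) := by ring
    linarith) HIG.1.intervalIntegrable
  rw [rnez] at main
  refine main.trans ((ilq HIG.1 ga nl).trans ?_)
  rw [HIG.2]
  have af := hP.r_tot; have ag := hT.prof.r_tot; have ah := hT.bd'
  have this_1 : (1 / (n:Rl)) * (36 * (∫ x, rdd x) + 28 * (∫ x, rs x) + 8 * ∫ x, (s.fx t x ^ 2 + s.gx t x ^ 2)) <=
    (1 / n) * (36 * (C * ed + M) + 28 * (C' * ed + M) + 8 * C') := by gcongr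
  have : M * √k * d.Y s t * (∫ x, rs x) <= M * √k * d.Y s t * (C' * ed + M) := by gcongr
  have e : d.Y s t = ∫ x, dds x * xp := rfl
  rw [<- e]
  rw [show (36 * (C * ed + M) + 28 * (C' * ed + M) + 8 * C') / (n:Rl) = (1 / n) * (36 * (C * ed + M) + 28 * (C' * ed + M) + 8 * C') by ring]
  linarith
end

section
variable {m lo hi C C' : Rl} {d s : Dat} {fxt gxt : Rl -> RR}
def Dat.Rn (d s : Dat) (n : ℕ) (t : Rl) : Rl := ∫ x in (-(n:Rl))..n, chi n x * (xp * (fd * fsx + gd * gsx))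
lemma dnz (d : Dat) (n : ℕ) (hn : 1 <= n) (t : Rl) : 0 <= d.Dn n t := by
  refine iinz po fun x hx => ?_
  have := (cbd hn (alz.2 ⟨by linarith [hx.1, (ncnz n : (0:Rl) <= _)], hx.2⟩)).1
  unfold Dat.v; positivity
lemma rcz (S : Sol m lo hi d) (T : Sol m lo hi s) (n : ℕ) :
    JC lo hi (fun t x => chi n x * (xp * d.Rt s t x)) := by
  have := S.cf; have := S.cg; have := S.cft; have := S.cgt
  have := T.cf; have := T.cg; have := T.cft; have := T.cgt
  have := cct n
  unfold JC Dat.Rt at *; fun_prop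
lemma rdz (S : Sol m lo hi d) (T : Sol m lo hi s) (n : ℕ) {t} (ht : t ∈ Irl) :
    HasDerivAt (d.Rn s n) (∫ x in (-(n:Rl))..n, chi n x * (xp * d.Rt s t x)) t := by
  refine dui (G := fun t x => chi n x * (xp * (fd * fsx + gd * gsx)))
    (Gt := fun t x => chi n x * (xp * d.Rt s t x)) ?_ (rcz S T n) (fun t ht x => ?_) ht
  · have := S.cf; have := S.cg; have := T.cf; have := T.cg; have := cct n
    unfold JC at *; fun_prop
  · exact (((((S.dft t ht x).fun_mul (T.dft t ht x)).fun_add ((S.dgt t ht x).fun_mul (T.dgt t ht x))).const_mul _).const_mul _)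
lemma rlz (S : Sol m lo hi d) (T : Sol m lo hi s) {t} (ht : t ∈ Irl)
    (hP : PMC rdd) (hT : Prof m C' rs) :
    Tendsto (fun n : ℕ => d.Rn s n t) atTop (𝓝 ((8 * mo - d.Y s t) / 2)) := by
  have cf := cts _ S.cf ht; have cg := cts _ S.cg ht
  have sf := cts _ T.cf ht; have sg := cts _ T.cg ht
  have cd : Continuous dds := by unfold dl; fun_prop
  have e : (8 * mo - d.Y s t) / 2 = ∫ x, xp * (fd * fsx + gd * gsx) := by
    have h := ((((hio hP.int).add (hio hT.int)).sub (hio (diz hP hT cd))).mul hlf).congr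
      (g := fun x => xp * (fd * fsx + gd * gsx)) (fun x => by unfold dl rr; ring)
    rw [h.2, hP.mass, hT.mass]; unfold Dat.Y di; ring
  rw [e]
  refine ctk _ _ (hP.int.add hT.int) (fun n x => chi n x * (xp * (fd * fsx + gd * gsx)))
    (fun n => by have := cct n; fun_prop) (fun n hn x hx => ?_) fun x => ?_
  · have b := cbd hn hx
    have k := crs fd fsx gd (-gsx)
    rw [amz, abn b.1, amz, abp (xpp _)]
    simp only [paaz]
    have hj := hP.nn x; have hv := hT.nn x
    have k' : |fd * fsx + gd * gsx| <= rdd x + rs x := by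
      rw [show fd * fsx + gd * gsx = fd * fsx - gd * (-gsx) by ring]
      refine k.trans ?_
      unfold rr at *; linarith
    have := mlmz b.2 (mll k' (xpp (2 * x)).le) po zero_le_one
    linarith
  · have := (cte x).mul_const (xp * (fd * fsx + gd * gsx))
    rwa [one_mul] at this
lemma step (S : Sol m lo hi d) (T : Sol m lo hi s) {af ta L : Rl} (ha : lo < af) (hb : ta < hi) (la : 0 <= L)
    (hP : ∀ t ∈ Icc af ta, PMC rdd)
    (hT : ∀ t ∈ Icc af ta, ProfH m C' (s.f t) (s.g t) (s.fx t) (s.gx t))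
    (hL : ∀ n : ℕ, 1 <= n -> ∫ t in af..ta, d.Dn n t <= L) (ho : af <= ta) :
    ∃ δ > 0, ∀ τ ∈ Icc af ta, d.Y s τ = 0 -> ∀ t ∈ Icc af τ, τ - t <= δ -> d.Y s t = 0 := by
  have hm := (hP af ⟨lrz, ho⟩).hm; have hC := (hP af ⟨lrz, ho⟩).hC; have hC' := (hT af ⟨lrz, ho⟩).prof.hC
  have kd := (hT af ⟨lrz, ho⟩).KH_nn
  have ef := ezn
  set θ : Rl := 1 / (24 * (L + 1)) with hθ
  have θ0 : 0 < θ := po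
  set N := 36 * (C * ed + 4 * mo) + 28 * (C' * ed + 4 * mo) + 8 * C' with hN
  set K := C + 3 * ((6 + 1 / θ) * (4 * mo)) + 2 * KH m C' +
        4 * mo * √(C + C' + 4 * mo) * (1 + (C' * ed + 4 * mo)) with hK
  have ka : 0 <= K := by rw [hK]; positivity
  have sub : Icc af ta ⊆ Irl := fun t h => ⟨by linarith [h.1], by linarith [h.2]⟩
  have na : 0 <= N := by rw [hN]; positivity
  refine ⟨1 / (8 * (K + 1)), po, fun τ hτ yc => ?_⟩
  have cD : forall n, ContinuousOn (d.Dn n) Irl := fun n => cpq _ (DnI S n)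
  have main : ∀ k : ℕ, ∀ t ∈ Icc af τ, τ - t <= 1 / (8 * (K + 1)) -> d.Y s t <= 16 * mo / 2 ^ k := by
    intro k
    induction k with
    | zero =>
      intro t ht _
      have ht' : t ∈ Icc af ta := ⟨ht.1, ht.2.trans hτ.2⟩
      have cf := cts _ S.cf (sub ht'); have cg := cts _ S.cg (sub ht')
      have sf := cts _ T.cf (sub ht'); have sg := cts _ T.cg (sub ht')
      have cd : Continuous dds := by unfold dl; fun_prop
      have := (hio (diz (hP t ht') (hT t ht').prof cd)).le (((hio (hP t ht').int).add (hio (hT t ht').prof.int)).mul 2) (fun x => by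
        have := mlr (dlw (d.f t) (d.g t) (s.f t) (s.g t) x) (xpp (2 * x)).le
        linarith)
      rw [(hP t ht').mass, (hT t ht').prof.mass] at this
      unfold Dat.Y di; linarith
    | succ k ih =>
      intro t ht hδ
      set Yk := 16 * mo / (2:Rl) ^ k with hYk
      have yb : 0 <= Yk := po
      have ss : Icc t τ ⊆ Icc af ta := Icc_subset_Icc ht.1 hτ.2
      have est : ∀ n : ℕ, 1 <= n -> |d.Rn s n τ - d.Rn s n t| <= N / n * (τ - t) + Yk / 4 := by
        intro n hn
        have cR := cpq (c := -(n:Rl)) (d := n) (fun t x => chi n x * (xp * d.Rt s t x)) (rcz S T n)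
        have iR := (cR.mono (ss.trans sub)).intervalIntegrable_of_Icc (μ := volume) ht.2
        rw [<- ftc (fun x hx => rdz S T n (sub (ss (by rwa [uIcc_of_le ht.2] at hx)))) iR]
        have iD := ((cD (2 * n)).mono (ss.trans sub)).intervalIntegrable_of_Icc (μ := volume) ht.2
        have ic := (icz (c := N / n + K * Yk) (a := t) (b := τ) (μ := volume)).add (iD.const_mul (3 * θ * Yk))
        have b := inl (a := t) (b := τ) (μ := volume)
          (f := fun t => ∫ x in (-(n:Rl))..n, chi n x * (xp * d.Rt s t x))
          (g := fun t => N / n + K * Yk + 3 * θ * Yk * d.Dn (2 * n) t) ht.2 (aoaz _ fun x hx => by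
            have hx' : x ∈ Icc af ta := ss ⟨hx.1.le, hx.2⟩
            have u := ub S T (sub hx') (hP x hx') (hT x hx') hn θ0
            have da := dnz d (2 * n) (by omega) x
            have yy := ih x ⟨hx'.1, hx.2⟩ (by linarith [hx.1])
            have := mll yy (by positivity : 0 <= K + 3 * θ * d.Dn (2 * n) x)
            rw [rnez]
            refine u.trans ?_
            rw [<- hN]
            have e : C + 3 * (θ * d.Dn (2 * n) x + (6 + 1 / θ) * (4 * mo)) + 2 * KH m C' +
              4 * mo * √(C + C' + 4 * mo) * (1 + (C' * ed + 4 * mo)) = K + 3 * θ * d.Dn (2 * n) x := by rw [hK]; ring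
            rw [e]; linarith) ic
        rw [iad (by simp) (iD.const_mul _), intervalIntegral.integral_const, icm, smul_eq_mul, rnez] at b
        have ld : ∫ x in t..τ, d.Dn (2 * n) x <= L := by
          refine ltz ?_ (hL (2 * n) (by omega))
          exact intervalIntegral.integral_mono_interval ht.1 ht.2 hτ.2 (aoaz _ fun x => dnz d (2 * n) (by omega) x)
            (((cD (2 * n)).mono sub).intervalIntegrable_of_Icc ho)
        have lf : 3 * θ * Yk * ∫ x in t..τ, d.Dn (2 * n) x <= Yk / 8 := by
          have : 3 * θ * Yk * ∫ x in t..τ, d.Dn (2 * n) x <= 3 * θ * Yk * (L + 1) := by gcongr; linarith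
          have e : 3 * θ * Yk * (L + 1) = Yk / 8 := by rw [hθ]; field_simp; ring
          linarith
        have lg : (τ - t) * (K * Yk) <= Yk / 8 := by
          have : (τ - t) * (K * Yk) <= 1 / (8 * (K + 1)) * ((K + 1) * Yk) := by gcongr; linarith
          have e : 1 / (8 * (K + 1)) * ((K + 1) * Yk) = Yk / 8 := by field_simp
          linarith
        refine b.trans ?_
        linarith
      have ht' : t ∈ Icc af ta := ⟨ht.1, ht.2.trans hτ.2⟩
      have lim := ((rlz S T (sub hτ) (hP τ hτ) (hT τ hτ).prof).sub (rlz S T (sub ht') (hP t ht') (hT t ht').prof)).abs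
      have lj : Tendsto (fun n : ℕ => N / n * (τ - t) + Yk / 4) atTop (𝓝 (0 * (τ - t) + Yk / 4)) := ((tcn N).mul_const _).add_const _
      have := lotz lim lj (eventually_atTop.2 ⟨1, est⟩)
      rw [yc] at this
      have a := (lasz _).trans this
      rw [pow_succ, <- div_div, <- hYk]
      linarith
  intro t ht hδ
  have l : Tendsto (fun k : ℕ => 16 * mo / (2:Rl) ^ k) atTop (𝓝 0) := by
    have := (tendsto_pow_atTop_nhds_zero_of_lt_one (r := (1/2:Rl)) nu nu).const_mul (16 * mo)
    rw [mzz] at this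
    refine this.congr fun k => ?_
    rw [one_div, inv_pow]; rfl
  exact le_antisymm (ge_of_tendsto' l fun k => main k t ht hδ) (dtn _ _ _ _)
lemma uniq (S : Sol m lo hi d) (X : SolX lo hi d fxt gxt) (T : Sol m lo hi s)
    (hP : forall a b, lo < a -> b < hi -> ∃ C, ∀ t ∈ Icc a b, PMC rdd)
    (hT : forall a b, lo < a -> b < hi -> ∃ C, ∀ t ∈ Icc a b, ProfH m C (s.f t) (s.g t) (s.fx t) (s.gx t))
    {ta t : Rl} (hj : ta < hi) (yc : d.Y s ta = 0) (ht : lo < t) (htt : t <= ta) x :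
    fd = fsx ∧ gd = gsx := by
  obtain ⟨C, hC⟩ := hP ((lo + t) / 2) ((ta + hi) / 2) li li
  obtain ⟨C', hC'⟩ := hT ((lo + t) / 2) ((ta + hi) / 2) li li
  obtain ⟨K, hK⟩ := locsm S X (a := (lo + t) / 2) (b := (ta + hi) / 2) li li li hC
  have sub : Icc t ta ⊆ Icc ((lo + t) / 2) ((ta + hi) / 2) := Icc_subset_Icc li li
  have sl : Icc ((lo + t) / 2) ((ta + hi) / 2) ⊆ Irl := fun t h => ⟨by linarith [h.1], by linarith [h.2]⟩
  set c := ((t - (lo + t) / 2) * ((ta + hi) / 2 - ta)) ^ 2 with hc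
  have ad : 0 < t - (lo + t) / 2 := li
  have bc : 0 < (ta + hi) / 2 - ta := li
  have cj : 0 < c := po
  have hL : ∀ n : ℕ, 1 <= n -> ∫ t in t..ta, d.Dn n t <= K / c := fun n hn => by
    rw [le_div_iff₀ cj, mul_comm]
    refine ltz ?_ (hK n hn)
    have cD : ContinuousOn (d.Dn n) Irl := cpq _ (DnI S n)
    have cD' : ContinuousOn (d.Dn n) (Icc ((lo + t) / 2) ((ta + hi) / 2)) := cD.mono sl
    have ib : IntervalIntegrable (fun x => ((x - (lo + t) / 2) * ((ta + hi) / 2 - x)) ^ 2 * d.Dn n x) volume ((lo + t) / 2) ((ta + hi) / 2) := ContinuousOn.intervalIntegrable_of_Icc li fp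
    have ic : IntervalIntegrable (fun x => ((x - (lo + t) / 2) * ((ta + hi) / 2 - x)) ^ 2 * d.Dn n x) volume t ta :=
      ContinuousOn.intervalIntegrable_of_Icc htt (by have := cD'.mono sub; fun_prop)
    rw [<- icm]
    refine ltz (imo htt (((cD'.mono sub).intervalIntegrable_of_Icc htt).const_mul _) ic fun x hx => ?_)
      (intervalIntegral.integral_mono_interval li htt li (aoaz _ fun x => mnn (sqn _) (dnz d n hn x)) ib)
    have := dnz d n hn x
    have hv := hx.1; have bu := hx.2
    rw [hc]
    gcongr
    linarith
  obtain ⟨δ, δ0, hδ⟩ := step S T ht hj (L := max (K / c) 0) (le_max_right _ _) (fun t h => hC t (sub h)) (fun t h => hC' t (sub h))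
    (fun n hn => (hL n hn).trans (le_max_left _ _)) htt
  have all : ∀ k : ℕ, ∀ τ ∈ Icc t ta, ta - τ <= k * δ -> d.Y s τ = 0 := by
    intro k
    induction k with
    | zero => intro τ hv bu; rw [le_antisymm hv.2 (by simp at bu; linarith), yc]
    | succ k ih =>
      intro τ hv bu
      push_cast at bu
      have ke : 0 <= k * δ := po
      refine hδ (min ta (τ + δ)) ⟨le_min htt (by linarith [hv.1]), min_le_left _ _⟩ (ih _ ⟨le_min htt (by linarith [hv.1]), min_le_left _ _⟩ ?_)
        τ ⟨hv.1, le_min hv.2 li⟩ (by linarith [min_le_right ta (τ + δ)])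
      rcases min_cases ta (τ + δ) with h | h <;> rw [h.1] <;> linarith
  obtain ⟨k, hk⟩ := exists_nat_ge ((ta - t) / δ)
  have y := all k t ⟨lrz, htt⟩ (by rwa [div_le_iff₀ δ0] at hk)
  have ts : t ∈ Icc t ta := ⟨lrz, htt⟩
  have cf := cts _ S.cf (sl (sub ts)); have cg := cts _ S.cg (sl (sub ts))
  have sf := cts _ T.cf (sl (sub ts)); have sg := cts _ T.cg (sl (sub ts))
  have cd : Continuous dds := by unfold dl; fun_prop
  have i := diz (hC t (sub ts)) (hC' t (sub ts)).prof cd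
  have z := (integral_eq_zero_iff_of_nonneg (fun x => mnn (dln _ _ _ _ x) (xpp _).le) i).1 y
  have zd := congrFun ((Continuous.ae_eq_iff_eq volume (cd.mul (by fun_prop : Continuous fun x : Rl => xp)) continuous_const).1 z) x
  have ze : dds x = 0 := by
    have := (mul_eq_zero.1 zd).resolve_right (xpp _).ne'
    exact this
  unfold dl at ze
  constructor <;> nlinarith [sqn (fd - fsx), sqn (gd - gsx)]
end

def Dx (φ : Rl -> RR) (t x : Rl) : Rl := fderiv Rl (fun p : RxR => φ p.1 p.2) (t, x) (0, 1)
def Dt (φ : Rl -> RR) (t x : Rl) : Rl := fderiv Rl (fun p : RxR => φ p.1 p.2) (t, x) (1, 0)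
def Sm (lo hi : Rl) (φ : Rl -> RR) : Prop := ContDiffOn Rl (⊤ : ℕ∞) (fun p : RxR => φ p.1 p.2) (Irl ×ˢ univ)
namespace Sm
variable {lo hi : Rl} {φ : Rl -> RR}
lemma op : IsOpen (Irl ×ˢ (univ : Set Rl)) := isOpen_Ioo.prod isOpen_univ
lemma dv (h : Sm lo hi φ) (v : RxR) : ContDiffOn Rl (⊤ : ℕ∞)
    (fun p : RxR => fderiv Rl (fun p : RxR => φ p.1 p.2) p v) (Irl ×ˢ univ) := (ContDiffOn.fderiv_of_isOpen h op nu).clm_apply contDiffOn_const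
lemma dx (h : Sm lo hi φ) : Sm lo hi (Dx φ) := h.dv (0, 1)
lemma dt (h : Sm lo hi φ) : Sm lo hi (Dt φ) := h.dv (1, 0)
lemma jc (h : Sm lo hi φ) : JC lo hi φ := ContDiffOn.continuousOn h
lemma at_ (h : Sm lo hi φ) {t} (ht : t ∈ Irl) x :
    ContDiffAt Rl (⊤ : ℕ∞) (fun p : RxR => φ p.1 p.2) (t, x) := ContDiffOn.contDiffAt h (op.mem_nhds ⟨ht, muz _⟩)
lemma hx (h : Sm lo hi φ) (t : Rl) (ht : t ∈ Irl) x : HasDerivAt (φ t) (Dx φ t x) x := by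
  have := ((h.at_ ht x).differentiableAt nu).hasFDerivAt
  exact this.comp_hasDerivAt x ((hasDerivAt_const x t).prodMk (hid x))
lemma ht (h : Sm lo hi φ) (t : Rl) (ht : t ∈ Irl) x : HasDerivAt (fun s => φ s x) (Dt φ t x) t := by
  have := ((h.at_ ht x).differentiableAt nu).hasFDerivAt
  exact this.comp_hasDerivAt t ((hid t).prodMk (hasDerivAt_const t x))
lemma symm (h : Sm lo hi φ) (t : Rl) (ht : t ∈ Irl) x : Dx (Dt φ) t x = Dt (Dx φ) t x := by
  have bu : ContDiffAt Rl 2 (fun p : RxR => φ p.1 p.2) (t, x) := contDiffAt_infty.1 (h.at_ ht x) 2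
  have s := bu.isSymmSndFDerivAt (by simp)
  have d := (bu.fderiv_right (m := 1) nu).differentiableAt nu
  have e : ∀ v w : RxR, fderiv Rl (fun p => fderiv Rl (fun p : RxR => φ p.1 p.2) p v) (t, x) w =
      fderiv Rl (fderiv Rl (fun p : RxR => φ p.1 p.2)) (t, x) w v := fun v w => by
    rw [fderiv_clm_apply d fp]; simp
  exact (e (1, 0) (0, 1)).trans ((s _ _).trans (e (0, 1) (1, 0)).symm)
lemma solX {f g : Rl -> RR} (F : Sm lo hi f) (G : Sm lo hi g) :
    SolX lo hi ⟨f, g, Dt f, Dt g, Dx f, Dx g, Dx (Dx f), Dx (Dx g)⟩ (Dt (Dx f)) (Dt (Dx g)) := ⟨F.dx.dt.jc, G.dx.dt.jc, F.dx.ht, G.dx.ht, fun t ht x => F.symm t ht x ▸ F.dt.hx t ht x, fun t ht x => G.symm t ht x ▸ G.dt.hx t ht x⟩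
end Sm
lemma ciq (F : RR) {s : Set Rl} (hs : MeasurableSet s) :
    ∫ r in exp '' s, F r = ∫ x in s, exp x * F (exp x) := by
  rw [integral_image_eq_integral_abs_deriv_smul hs (fun x _ => (hasDerivAt_exp x).hasDerivWithinAt)
    Real.exp_injective.injOn]
  simp only [abs_exp, smul_eq_mul]
lemma ciw (F : RR) : IntegrableOn F (Ioi 0) ↔ Integrable fun x => exp x * F (exp x) := by
  rw [<- Real.range_exp, <- image_univ, integrableOn_image_iff_integrableOn_abs_deriv_smul MeasurableSet.univ
    (fun x _ => (hasDerivAt_exp x).hasDerivWithinAt) Real.exp_injective.injOn]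
  simp only [abs_exp, smul_eq_mul, integrableOn_univ]
lemma cov_0 (F : RR) : ∫ r in Ioi 0, F r = ∫ x, exp x * F (exp x) := by
  rw [<- Real.range_exp, <- image_univ, ciq F MeasurableSet.univ, setIntegral_univ]
lemma iiq x : exp '' Ioi x = Ioi (exp x) := by
  ext r; constructor
  · rintro ⟨y, hy, rfl⟩; exact Real.exp_lt_exp.2 hy
  · intro h
    have rf : 0 < r := (xpp x).trans h
    exact ⟨log r, (Real.lt_log_iff_exp_lt rf).2 h, exp_log rf⟩
lemma iiz x : exp '' Iic x = Ioc 0 (exp x) := by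
  ext r; constructor
  · rintro ⟨y, hy, rfl⟩; exact ⟨xpp _, relz.2 hy⟩
  · intro h
    exact ⟨log r, (Real.log_le_iff_le_exp h.1).2 h.2, exp_log h.1⟩
lemma vp (m : Rl) {r : RR} {C : Rl} (h : PMC r) x :
    (-∫ s in Ioi x, (m - Mm r s) * r s) * xp + (m - Mm r x) ^ 2 = m ^ 2 - 2 * xp * Zz m r x := by
  have hd : forall s, HasDerivAt (fun s => Vs * esn)
      ((m - Mm r s) * r s - 2 * (Vs * esn)) s := fun s => by
    have e := ((hid s).const_mul 2).fun_neg.exp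
    refine ((((h.M_deriv s).const_mul (2 * m)).fun_sub ((h.M_deriv s).fun_pow 2)).fun_mul e).congr_deriv ?_
    have : exp (2 * s) * esn = 1 := by rw [<- xad]; simp
    simp only [id]; push_cast
    linear_combination ((m - Mm r s) * r s) * this
  have hm := h.hm
  have cM : Continuous (Mm r) := h.M_cont
  have cr := h.cont
  have ib : Integrable (fun s => (m - Mm r s) * r s) := by
    refine iob (h.r_int.const_mul (3 * mo)) fp fun s => ?_
    rw [amz, abn (h.nn s)]
    refine mlr ?_ (h.nn s)
    rw [alz]; constructor <;> linarith [h.M_nn s, h.M_le s]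
  have ic := (h.Bi_int.const_mul 2)
  have lim : Tendsto (fun s => Vs * esn) atTop (𝓝 0) := by
    have eh : Tendsto (fun s : Rl => esn) atTop (𝓝 0) := Real.tendsto_exp_neg_atTop_nhds_zero.comp (tiz.const_mul_atTop two_pos)
    have := ((h.M_top.const_mul (2 * m)).sub (h.M_top.pow 2)).mul eh
    rwa [mzz] at this
  have F := integral_Ioi_of_hasDerivAt_of_tendsto (a := x) (hd x).continuousAt.continuousWithinAt (fun s _ => hd s) (ib.sub ic).integrableOn lim
  rw [integral_sub ib.integrableOn ic.integrableOn, ntcm] at F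
  change _ - 2 * Zz m r x = _ at F
  have : xp * en = 1 := by rw [<- xad]; simp
  linear_combination (-xp) * F + Vx * this

def uF (u : Rl -> Rl -> ℂ) (t x : Rl) : Rl := (u t (exp x)).re
def uG (u : Rl -> Rl -> ℂ) (t x : Rl) : Rl := (u t (exp x)).im
def uD (u : Rl -> Rl -> ℂ) : Dat := ⟨uF u, uG u, Dt (uF u), Dt (uG u), Dx (uF u), Dx (uG u), Dx (Dx (uF u)), Dx (Dx (uG u))⟩
lemma urz (u : Rl -> Rl -> ℂ) (t x : Rl) : ruv x = ‖u t (exp x)‖ ^ 2 := by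
  rw [Complex.sq_norm, Complex.normSq_apply]; unfold rr uF uG; ring
lemma cx (E a b c d W f g : Rl) (h : (E : ℂ) * (Ci * ((a : ℂ) + b * Ci)) = -((c : ℂ) + d * Ci) + (W : ℂ) * (f + g * Ci)) :
    E * a = -d + W * g ∧ E * b = c - W * f := by
  have hv := congrArg Complex.im h
  have bu := congrArg Complex.re h
  simp at hv bu
  exact ⟨li, li⟩
section
variable {m : ℕ} {u : Rl -> Rl -> ℂ} (hu : IsCSS m (Ioo (-1) 0) u)
include hu
lemma usz : ContDiffOn Rl (⊤ : ℕ∞) (fun p : RxR => u p.1 (exp p.2)) (Ioo (-1:Rl) 0 ×ˢ univ) := hu.smooth.comp (g := fun p : RxR => u p.1 p.2) (f := fun p : RxR => (p.1, exp p.2))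
    (ContDiff.contDiffOn fp) fun p hp => ⟨hp.1, xpp _⟩
lemma ufz : Sm (-1) 0 (uF u) := Complex.reCLM.contDiff.comp_contDiffOn (usz hu)
lemma ugz : Sm (-1) 0 (uG u) := Complex.imCLM.contDiff.comp_contDiffOn (usz hu)
lemma uzz (hm : 1 <= m) {t} (ht : t ∈ Ioo (-1:Rl) 0) {U : Rl -> Rl × Rl -> ℂ}
    (hU : Continuous (U t)) (h : ∀ x : RxR, x ≠ 0 -> U t x = u t (sqrt (x.1 ^ 2 + x.2 ^ 2)) * (((x.1 : ℂ) + (x.2 : ℂ) * Ci) / ((sqrt (x.1 ^ 2 + x.2 ^ 2) : Rl) : ℂ)) ^ m) :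
    U t 0 = 0 ∧ ∀ r > 0, U t (r, 0) = u t r := by
  have key : ∀ φ r : Rl, 0 < r -> U t (r * cos φ, r * sin φ) = u t r * Complex.exp (m * (φ * Ci)) := by
    intro φ r hr
    have s : √((r * cos φ) ^ 2 + (r * sin φ) ^ 2) = r := by
      rw [show (r * cos φ) ^ 2 + (r * sin φ) ^ 2 = r ^ 2 * (cos φ ^ 2 + sin φ ^ 2) by ring, Real.cos_sq_add_sin_sq, mul_one, Real.sqrt_sq hr.le]
    have nb : ((r * cos φ, r * sin φ) : RxR) ≠ 0 := by
      intro e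
      have ei := congrArg Prod.fst e; have ej := congrArg Prod.snd e
      simp only [Prod.fst_zero, Prod.snd_zero] at ei ej
      rw [ei, ej] at s
      simp at s; linarith
    rw [h _ nb]
    simp only [s]
    rw [Complex.exp_nat_mul, Complex.exp_mul_I]
    have : (r : ℂ) ≠ 0 := by exact_mod_cast hr.ne'
    congr 2
    push_cast
    field_simp
  have ke : ∀ r > 0, U t (r, 0) = u t r := fun r hr => by simpa using key 0 r hr
  refine ⟨?_, ke⟩
  have kf : ∀ r > 0, U t (r * cos (pie / m), r * sin (pie / m)) = -U t (r, 0) := fun r hr => by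
    rw [ke r hr, key _ r hr]
    have : (m : ℂ) ≠ 0 := by exact_mod_cast (by omega : m ≠ 0)
    push_cast
    rw [show (m : ℂ) * (pie / m * Ci) = pie * Ci by field_simp, Complex.exp_pi_mul_I]; ring
  have ld : Tendsto (fun r : Rl => U t (r * cos (pie / m), r * sin (pie / m))) (𝓝[>] 0) (𝓝 (U t 0)) := by
    have : Continuous fun r : Rl => U t (r * cos (pie / m), r * sin (pie / m)) := fp
    have := this.tendsto 0
    simp only [zero_mul] at this
    exact this.mono_left nwn
  have lf : Tendsto (fun r : Rl => -U t (r, 0)) (𝓝[>] 0) (𝓝 (-U t 0)) := by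
    have : Continuous fun r : Rl => -U t (r, 0) := fp
    exact (this.tendsto 0).mono_left nwn
  have := tnuz ld (lf.congr' (eventually_nhdsWithin_of_forall fun r hr => (kf r hr).symm))
  exact self_eq_neg.1 this
lemma unz (hm : 1 <= m) (a b : Rl) (ha : -1 < a) (hb : b < 0) : ∃ C, 0 <= C ∧ ∀ t ∈ Icc a b, ∀ x ≤ 0,
    ruv x <= C * xp := by
  obtain ⟨U, hU, h⟩ := hu.equivariant
  have op : IsOpen (Ioo (-1:Rl) 0 ×ˢ (univ : Set (RxR))) := isOpen_Ioo.prod isOpen_univ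
  have cF : ContinuousOn (fderiv Rl (fun p : Rl × (RxR) => U p.1 p.2)) (Ioo (-1:Rl) 0 ×ˢ univ) := hU.continuousOn_fderiv_of_isOpen op nu
  have sub : Icc a b ⊆ Ioo (-1:Rl) 0 := fun t ht => ⟨hta, htb⟩
  obtain ⟨K, hK⟩ := (isCompact_Icc.prod isCompact_Icc).exists_bound_of_continuousOn (s := Icc a b ×ˢ Icc (0:Rl) 1)
    (f := fun p : RxR => fderiv Rl (fun p : Rl × (RxR) => U p.1 p.2) (p.1, (p.2, 0)) (0, (1, 0)))
    ((cF.comp (f := fun p : RxR => (p.1, (p.2, (0:Rl)))) fp fun p hp => ⟨sub hp.1, muz _⟩).clm_apply continuousOn_const)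
  refine ⟨K ^ 2, sqn _, fun t ht x hx => ?_⟩
  have cU : Continuous (U t) := by
    rw [<- continuousOn_univ]
    exact hU.continuousOn.comp (f := fun x : RxR => (t, x)) fp fun x _ => ⟨sub ht, muz _⟩
  obtain ⟨z, k⟩ := uzz hu hm (sub ht) cU (h t (sub ht))
  have ei : exp x ∈ Icc (0:Rl) 1 := ⟨(xpp x).le, Real.exp_le_one_iff.2 hx⟩
  have hd : ∀ s ∈ Icc (0:Rl) 1, HasDerivWithinAt (fun s : Rl => U t (s, 0))
      (fderiv Rl (fun p : Rl × (RxR) => U p.1 p.2) (t, (s, 0)) (0, (1, 0))) (Icc 0 1) s := fun s _ => by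
    have := ((hU.contDiffAt (op.mem_nhds (show (t, (s, (0:Rl))) ∈ Ioo (-1:Rl) 0 ×ˢ (univ : Set (RxR)) from ⟨sub ht, muz _⟩))).differentiableAt nu).hasFDerivAt
    exact (this.comp_hasDerivAt s ((hasDerivAt_const s t).prodMk ((hid s).prodMk (hasDerivAt_const s (0:Rl))))).hasDerivWithinAt
  have := (convex_Icc (0:Rl) 1).norm_image_sub_le_of_norm_hasDerivWithin_le hd (fun s hs => hK (t, s) ⟨ht, hs⟩)
    (left_mem_Icc.2 zero_le_one) ei
  rw [k _ (xpp x), show ((0:Rl), (0:Rl)) = 0 from rfl, z, sub_zero, sub_zero, rnez, abs_exp] at this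
  rw [urz, two_mul, xad]
  have := plpz (norm_nonneg _) this 2
  linarith
variable (hm : 1 <= m) (hmass : ∀ t ∈ Set.Ioo (-1 : Rl) 0, L2sq (u t) = 8 * pie * mo)
include hm hmass
lemma upz (a b : Rl) (ha : -1 < a) (hb : b < 0) : ∃ C, ∀ t ∈ Icc a b, PMC ruv := by
  obtain ⟨C, ca, hC⟩ := unz hu hm a b ha hb
  refine ⟨C, fun t ht => ?_⟩
  have ht' : t ∈ Ioo (-1:Rl) 0 := ⟨hta, htb⟩
  have e : (fun x => ruv x * xp) = fun x => exp x * (‖u t (exp x)‖ ^ 2 * exp x) := by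
    funext x; rw [urz, two_mul, xad]; ring
  have cf := cts _ (ufz hu).jc ht'; have cg := cts _ (ugz hu).jc ht'
  refine ⟨by exact_mod_cast hm, ca, by unfold rr; fun_prop, fun x => by unfold rr; positivity, ?_, ?_, hC t ht⟩
  · rw [e]; exact (ciw fun r => ‖u t r‖ ^ 2 * r).1 (hu.integrable t ht')
  · rw [e, <- cov_0 fun r => ‖u t r‖ ^ 2 * r]
    have := hmass t ht'
    unfold L2sq at this
    have p := Real.pi_pos
    have : (2 * pie) * (∫ r in Ioi (0:Rl), ‖u t r‖ ^ 2 * r) = 2 * pie * (4 * mo) := li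
    exact mul_left_cancel₀ po this
omit hm hmass in
lemma udz {t} (ht : t ∈ Ioo (-1:Rl) 0) x :
    HasDerivAt (fun x => u t (exp x)) (deriv (u t) (exp x) * exp x) x ∧
    HasDerivAt (fun x => deriv (u t) (exp x) * exp x)
      (deriv (deriv (u t)) (exp x) * exp x * exp x + deriv (u t) (exp x) * exp x) x ∧
    HasDerivAt (fun s => u s (exp x)) (deriv (fun s => u s (exp x)) t) t := by
  have c : ContDiffOn Rl (⊤ : ℕ∞) (u t) (Ioi 0) := hu.smooth.comp (f := fun x : Rl => (t, x)) (ContDiff.contDiffOn fp) fun r hr => ⟨ht, hr⟩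
  have c' : ContDiffOn Rl (⊤ : ℕ∞) (deriv (u t)) (Ioi 0) := c.deriv_of_isOpen isOpen_Ioi nu
  have n := Ioi_mem_nhds (xpp x)
  have hv := ((c.contDiffAt n).differentiableAt nu).hasDerivAt
  have bu := ((c'.contDiffAt n).differentiableAt nu).hasDerivAt
  have e := hasDerivAt_exp x
  have ec : HasDerivAt (fun x : Rl => (exp x : ℂ)) (exp x : ℂ) x := e.ofReal_comp
  refine ⟨(hv.scomp x e).congr_deriv (by rw [Complex.real_smul, mul_comm]),
    ((bu.scomp x e).mul ec).congr_deriv (by rw [Complex.real_smul]; simp only [Function.comp]; ring), ?_⟩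
  have cs : ContDiffOn Rl (⊤ : ℕ∞) (fun s => u s (exp x)) (Ioo (-1) 0) := hu.smooth.comp (f := fun s : Rl => (s, exp x)) (ContDiff.contDiffOn fp) fun r hr => ⟨hr, xpp x⟩
  exact ((cs.contDiffAt (isOpen_Ioo.mem_nhds ht)).differentiableAt nu).hasDerivAt
omit hm hmass in
lemma udq {t} (ht : t ∈ Ioo (-1:Rl) 0) x :
    (Dx (uF u) t x = (deriv (u t) (exp x) * exp x).re ∧ Dx (uG u) t x = (deriv (u t) (exp x) * exp x).im) ∧
    (Dx (Dx (uF u)) t x : ℂ) + Dx (Dx (uG u)) t x * Ci = deriv (deriv (u t)) (exp x) * exp x * exp x + deriv (u t) (exp x) * exp x ∧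
    (Dt (uF u) t x : ℂ) + Dt (uG u) t x * Ci = deriv (fun s => u s (exp x)) t := by
  have R : ∀ {w : Rl -> ℂ} {c : ℂ} {y : Rl}, HasDerivAt w c y -> HasDerivAt (fun y => (w y).re) c.re y := fun h => Complex.reCLM.hasFDerivAt.comp_hasDerivAt _ h
  have J : ∀ {w : Rl -> ℂ} {c : ℂ} {y : Rl}, HasDerivAt w c y -> HasDerivAt (fun y => (w y).im) c.im y := fun h => Complex.imCLM.hasFDerivAt.comp_hasDerivAt _ h
  have ei : forall x, Dx (uF u) t x = (deriv (u t) (exp x) * exp x).re := fun x => ((ufz hu).hx t ht x).unique (R (udz hu ht x).1)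
  have ej : forall x, Dx (uG u) t x = (deriv (u t) (exp x) * exp x).im := fun x => ((ugz hu).hx t ht x).unique (J (udz hu ht x).1)
  refine ⟨⟨ei x, ej x⟩, ?_, ?_⟩
  · have et := ((ufz hu).dx.hx t ht x).unique ((R (udz hu ht x).2.1).congr_of_eventuallyEq (evf ei))
    have eu := ((ugz hu).dx.hx t ht x).unique ((J (udz hu ht x).2.1).congr_of_eventuallyEq (evf ej))
    rw [et, eu, craz]
  · rw [((ufz hu).ht t ht x).unique (R (udz hu ht x).2.2), ((ugz hu).ht t ht x).unique (J (udz hu ht x).2.2), craz]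
lemma uwz {t} (ht : t ∈ Ioo (-1:Rl) 0) x : (uD u).W m t x = xp * At m (u t) (exp x) +
    (m + Atheta (u t) (exp x)) ^ 2 - xp * ‖u t (exp x)‖ ^ 2 := by
  obtain ⟨C, hC⟩ := upz hu hm hmass t t ht.1 ht.2
  have P := hC t ⟨lrz, lrz⟩
  have a : forall x, Atheta (u t) (exp x) = -Mm ruv x := fun x => by
    unfold Atheta Mm
    rw [iol (xpp x).le, <- iiz, ciq _ miz]
    rw [neg_mul]; congr 2
    refine integral_congr_ae (aoaz _ fun y => ?_)
    simp only [urz, two_mul, xad]; ring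
  have b : At m (u t) (exp x) = -∫ s in Ioi x, (m - Mm ruv s) * ruv s := by
    unfold At
    rw [<- iiq, ciq _ miq]
    congr 1
    refine integral_congr_ae (aoaz _ fun y => ?_)
    simp only [a, urz]
    have := (xpp y).ne'
    field_simp; ring
  have v := vp m P x
  rw [<- b] at v
  rw [a x]
  unfold Dat.W Vv
  change (m:Rl) ^ 2 + xp * (-ruv x - 2 * Zz m ruv x) = _
  rw [urz]
  linarith
lemma usq : Sol m (-1) 0 (uD u) := by
  have key : ∀ t ∈ Ioo (-1:Rl) 0, forall x, (xp : ℂ) * (Ci * ((Dt (uF u) t x : ℂ) + Dt (uG u) t x * Ci)) =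
      -((Dx (Dx (uF u)) t x : ℂ) + Dx (Dx (uG u)) t x * Ci) + ((uD u).W m t x : ℂ) * (uF u t x + uG u t x * Ci) := by
    intro t ht x
    obtain ⟨_, ei, ej⟩ := udq hu ht x
    rw [ei, ej, uwz hu hm hmass ht x]
    have e := hu.eq t ht _ (xpp x)
    unfold CSSeq at e
    have w : (uF u t x : ℂ) + uG u t x * Ci = u t (exp x) := craz _
    have ne : (exp x : ℂ) ≠ 0 := by exact_mod_cast (xpp x).ne'
    rw [w, two_mul, xad]
    push_cast at e ⊢
    push_cast at ne
    field_simp at e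
    linear_combination e
  have f := ufz hu; have g := ugz hu
  refine ⟨f.jc, g.jc, f.dt.jc, g.dt.jc, f.dx.jc, g.dx.jc, f.dx.dx.jc, g.dx.dx.jc, f.ht, g.ht, f.hx, g.hx, f.dx.hx, g.dx.hx, ?_, ?_⟩
  · intro t ht x
    exact (cx _ _ _ _ _ _ _ _ (key t ht x)).1
  · intro t ht x
    exact (cx _ _ _ _ _ _ _ _ (key t ht x)).2
end

section
variable {m : ℕ} {u : Rl -> Rl -> ℂ} (hu : IsCSS m (Ioo (-1) 0) u)
include hu
lemma uvz {t} (ht : t ∈ Ioo (-1:Rl) 0) : (uD u).v t = fun x => exp x * (‖deriv (u t) (exp x)‖ ^ 2 * exp x) := by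
  funext x
  obtain ⟨⟨ei, ej⟩, _⟩ := udq hu ht x
  change Dx (uF u) t x ^ 2 + Dx (uG u) t x ^ 2 = _
  have : ‖deriv (u t) (exp x) * exp x‖ ^ 2 = ‖deriv (u t) (exp x)‖ ^ 2 * exp x ^ 2 := by
    rw [norm_mul, Complex.norm_real, rnez, abs_exp, mul_pow]
  rw [Complex.sq_norm, Complex.normSq_apply] at this
  rw [ei, ej]
  linarith
variable (hm : 1 <= m) (hmass : ∀ t ∈ Set.Ioo (-1 : Rl) 0, L2sq (u t) = 8 * pie * mo)
include hm hmass
lemma ubz (hblow : Tendsto (fun t => sqrt (2 * pie * ∫ r in Set.Ioi (0:Rl), ‖deriv (u t) r‖ ^ 2 * r))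
      (nhdsWithin 0 (Set.Ioo (-1 : Rl) 0)) atTop) :
    ∃ lo, -1 < lo ∧ Bl m lo (uD u) (Dt (Dx (uF u))) (Dt (Dx (uG u))) := by
  have pi := Real.pi_pos
  have I : ∀ t ∈ Ioo (-1:Rl) 0, ∫ r in Ioi (0:Rl), ‖deriv (u t) r‖ ^ 2 * r = ∫ x, (uD u).v t x := fun t ht => by
    rw [cov_0 fun r => ‖deriv (u t) r‖ ^ 2 * r, uvz hu ht]
  have bl : ∀ K : Rl, ∃ ta, -1 < ta ∧ ta < 0 ∧ ∀ t ∈ Ioo ta 0, K < ∫ x, (uD u).v t x := by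
    intro K
    have h := hblow.eventually_gt_atTop (√(2 * pie * K))
    rw [nhdsWithin_Ioo_eq_nhdsLT (by norm_num : (-1:Rl) < 0), eventually_iff, mem_nhdsLT_iff_exists_Ioo_subset' (l' := -1) nu] at h
    obtain ⟨l, hl, h⟩ := h
    refine ⟨max l (-1/2), by simp; right; norm_num, max_lt hl nu, fun t ht => ?_⟩
    have hv : t ∈ Ioo (-1:Rl) 0 := ⟨by linarith [ht.1, le_max_right l (-1/2)], ht.2⟩
    have := h (⟨by linarith [ht.1, le_max_left l (-1/2)], ht.2⟩ : t ∈ Ioo l 0)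
    rw [mem_setOf_eq, I t hv] at this
    exact lt_of_mul_lt_mul_left (lt_of_not_ge fun h => not_lt.2 (Real.sqrt_le_sqrt h) this) po
  obtain ⟨lo, ld, lf, hl⟩ := bl 0
  have S := usq hu hm hmass
  have X : SolX (-1) 0 (uD u) (Dt (Dx (uF u))) (Dt (Dx (uG u))) := (ufz hu).solX (ugz hu)
  refine ⟨lo, ld, lf, S.mono ld.le lrz, X.mono ld.le lrz, ?_, fun K => ?_⟩
  · intro a b ha hb
    obtain ⟨C, hC⟩ := upz hu hm hmass a b li hb
    obtain ⟨K, hK⟩ := hu.bounded (Icc a b) (fun t ht => ⟨hta, htb⟩) isCompact_Icc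
    refine ⟨max C (K ^ 2 / (2 * pie)), fun t ht => ?_⟩
    have tb : t ∈ Icc a b := ⟨ht.1.le, ht.2.le⟩
    have tc : t ∈ Ioo lo 0 := ⟨hta, htb⟩
    have td : t ∈ Ioo (-1:Rl) 0 := ⟨by linarith [tc.1], tc.2⟩
    have P := hC t tb
    have vi : Integrable ((uD u).v t) := by
      by_contra h
      have := hl t tc
      rw [integral_undef h] at this
      exact lt_irrefl _ this
    have ri := P.r_int
    refine ⟨⟨P.hm, le_max_of_le_left P.hC, P.cont, P.nn, P.int, P.mass, fun x hx => (P.near x hx).trans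
      (mlr (le_max_left _ _) (xpp _).le)⟩, S.dfx t td, S.dgx t td, cts _ S.cfx td, cts _ S.cgx td, vi, le_max_of_le_right ?_⟩
    have e : H1msq m (u t) = 2 * pie * ((∫ x, (uD u).v t x) + (m:Rl) ^ 2 * ∫ x, ruv x) := by
      unfold H1msq
      rw [cov_0 fun r => (‖deriv (u t) r‖ ^ 2 + (m : Rl) ^ 2 * ‖u t r‖ ^ 2 / r ^ 2) * r, <- ntcm ((m:Rl) ^ 2), <- iaz vi (ri.const_mul _)]
      congr 1
      refine integral_congr_ae (aoaz _ fun x => ?_)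
      simp only [uvz hu td, urz]
      have := (xpp x).ne'
      field_simp
    have va : 0 <= ∫ x, (uD u).v t x := inz fun x => by unfold Dat.v; positivity
    have rf : 0 <= ∫ x, ruv x := inz P.nn
    have k := hK t tb
    have kg : √(H1msq m (u t)) <= K := by linarith [Real.sqrt_nonneg (L2sq (u t))]
    have kh : H1msq m (u t) <= K ^ 2 := (Real.sqrt_le_left ((Real.sqrt_nonneg _).trans kg)).1 kg
    rw [e] at kh
    change ∫ x, (uD u).v t x <= _
    rw [le_div_iff₀ po]
    have : 0 <= 2 * pie * ((m:Rl) ^ 2 * ∫ x, ruv x) := po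
    linarith
  · obtain ⟨ta, _, bu, bx⟩ := bl K
    exact ⟨ta, bu, bx⟩
end
lemma sqz {m : ℕ} {a x t : Rl} (ht : t < 0) :
    sA m a x t = 1 / (exp a * |t|) * Q m (exp x / (exp a * |t|)) := by
  have p : exp xq = exp x / (exp a * |t|) := by
    rw [Real.exp_sub, Real.exp_sub, exp_log li, abs_of_neg ht, div_div]
  rw [<- p]
  have q : exp xq * exp (-x) = 1 / (exp a * |t|) := by
    rw [p, exp_neg]; have := (xpp x).ne'; field_simp
  rw [<- q]
  unfold sA Q
  generalize x - a - log (-t) = y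
  rw [show ((m:Rl) + 1) * y = m * y + y by ring, xad, xnm,
    show 2 * ((m:Rl) + 1) * y = ((2 * m + 2 : ℕ) : Rl) * y by push_cast; ring, xnm]
  ring
theorem stmt9 (m : ℕ) (hm : 1 ≤ m) (u : ℝ → ℝ → ℂ)
    (hu : IsCSS m (Set.Ioo (-1 : ℝ) 0) u)
    (hmass : ∀ t ∈ Set.Ioo (-1 : ℝ) 0, L2sq (u t) = 8 * Real.pi * (m + 1))
    (hblow : Tendsto (fun t => Real.sqrt (2 * Real.pi * ∫ r in Set.Ioi (0:ℝ), ‖deriv (u t) r‖ ^ 2 * r))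
      (nhdsWithin 0 (Set.Ioo (-1 : ℝ) 0)) atTop) :
    ∃ lam γ : ℝ, 0 < lam ∧ ∀ t ∈ Set.Ioo (-1 : ℝ) 0, ∀ r : ℝ, 0 < r →
      u t r = (Complex.exp (Complex.I * (γ : ℂ)) / ((lam * |t| : ℝ) : ℂ)) *
        (Q m (r / (lam * |t|)) : ℂ) * Complex.exp (Complex.I * (r : ℂ) ^ 2 / (4 * (t : ℂ))) := by
  obtain ⟨lo, ld, B⟩ := ubz hu hm hmass hblow
  obtain ⟨a, γ, h⟩ := B.form
  have sc : ∀ t x : Rl, Complex.exp (Ci * γ) * (sA m a x t : Rl) * Complex.exp (Ci * (xp / (4 * t) : Rl)) =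
      (sF m a γ t x : ℂ) + sG m a γ t x * Ci := by
    intro t x
    unfold sF sG
    rw [mul_right_comm, <- Complex.exp_add, <- mul_add, mul_comm Ci, <- Complex.ofReal_add, Complex.exp_mul_I]
    push_cast
    ring
  have lc := B.lk
  have yc : (uD u).Y (dS m a γ) (lo / 2) = 0 := by
    unfold Dat.Y di
    rw [integral_eq_zero_of_ae]
    refine aoaz _ fun x => ?_
    have e := h (lo / 2) ⟨li, li⟩ x
    rw [sc] at e
    have ei := congrArg Complex.re e
    have ej := congrArg Complex.im e
    simp at ei ej
    have ei' : (uD u).f (lo / 2) x = (dS m a γ).f (lo / 2) x := ei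
    have ej' : (uD u).g (lo / 2) x = (dS m a γ).g (lo / 2) x := ej
    simp [dl, ei', ej']
  have hm' : (1:Rl) <= m := by exact_mod_cast hm
  have X : SolX (-1) 0 (uD u) (Dt (Dx (uF u))) (Dt (Dx (uG u))) := (ufz hu).solX (ugz hu)
  have U := fun t => uniq (t := t) (usq hu hm hmass) X (ssz hm' (-1) (a := a) (γ := γ)) (fun a b => upz hu hm hmass a b)
    (fun c b _ hb => spq hm' hb) li yc
  have fin : ∀ t ∈ Ioo (-1:Rl) 0, forall x, u t (exp x) = Complex.exp (Ci * γ) * (sA m a x t : Rl) *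
      Complex.exp (Ci * (xp / (4 * t) : Rl)) := by
    intro t ht x
    have w : (uF u t x : ℂ) + uG u t x * Ci = u t (exp x) := craz _
    rcases le_or_gt t (lo / 2) with c | c
    · obtain ⟨ei, ej⟩ := U t ht.1 c x
      have ei' : uF u t x = sF m a γ t x := ei
      have ej' : uG u t x = sG m a γ t x := ej
      rw [sc, <- w, ei', ej']
    · rw [<- h t ⟨li, ht.2⟩ x, <- w]; rfl
  refine ⟨exp a, γ, xpp a, fun t ht r hr => ?_⟩
  have := fin t ht (log r)
  rw [sqz ht.2, two_mul, xad, exp_log hr] at this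
  rw [this]
  push_cast
  rw [show Ci * ((r:ℂ) * r / (4 * t)) = Ci * r ^ 2 / (4 * t) by ring]
  ring
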